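/- arXiv:2004.08802 — 2 statements merged into one kernel-verified Lean document; each statement's English description precedes it below -/
import Mathlib

section
/- Assume N ≥ 4 and p = 1 + 4/(N−3). For every n ∈ ℕ, let u_n be a C² solution of (PDE) on [0, ρ_n] for some ρ_n > 1 (regular up to the endpoints), and assume that u_n(0) → +∞ as n → ∞ and that u_n(1) = b_∞ for all n. Then u_n′(1) → −α b_∞ as n → ∞. -/
open Set Filter

noncomputable def alphaP (p : ℝ) : ℝ := 2 / (p - 1)

noncomputable def b0 (p : ℝ) : ℝ := (2 * (p + 1) / (p - 1) ^ 2) ^ ((1 : ℝ) / (p - 1))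

noncomputable def bInf (N : ℕ) (p : ℝ) : ℝ :=
  (alphaP p * ((N : ℝ) - 2 - alphaP p)) ^ (alphaP p / 2)

noncomputable def uInf (N : ℕ) (p : ℝ) (ρ : ℝ) : ℝ := bInf N p * ρ ^ (-(alphaP p))

/-- `u` solves `(1-ρ²)u'' + ((N-1)/ρ - 2(α+1)ρ)u' - α(α+1)u + |u|^{p-1}u = 0` on `s`. -/
def IsSolOn (N : ℕ) (p : ℝ) (u : ℝ → ℝ) (s : Set ℝ) : Prop :=
  ∀ ρ ∈ s,
    (1 - ρ ^ 2) * deriv (deriv u) ρ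
      + (((N : ℝ) - 1) / ρ - 2 * (alphaP p + 1) * ρ) * deriv u ρ
      - alphaP p * (alphaP p + 1) * u ρ + |u ρ| ^ (p - 1) * u ρ = 0
/-- The nonlinearity `|w|^(p-1) w - β w` of the conformally rescaled profile equation. -/
noncomputable def force (p β w : ℝ) : ℝ := |w| ^ (p - 1) * w - β * w

/-- The primitive of `force p β` vanishing at `0`. -/
noncomputable def pot (p β w : ℝ) : ℝ := |w| ^ (p + 1) / (p + 1) - β * w ^ 2 / 2

lemma hasDerivAt_pot {p β : ℝ} (hp : 1 < p) (w : ℝ) : HasDerivAt (pot p β) (force p β w) w := by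
  have h1 := (hasDerivAt_abs_rpow w (show 1 < p + 1 by linarith)).div_const (p + 1)
  have h2 := ((hasDerivAt_pow 2 w).const_mul β).div_const 2
  refine (h1.sub h2).congr_deriv ?_
  rw [force, show p + 1 - 2 = p - 1 by ring]
  have : p + 1 ≠ 0 := by linarith
  field_simp
  ring

lemma continuous_pot {p β : ℝ} (hp : 1 < p) : Continuous (pot p β) :=
  continuous_iff_continuousAt.2 fun w => (hasDerivAt_pot hp w).continuousAt

lemma continuous_force {p β : ℝ} (hp : 1 < p) : Continuous (force p β) := by
  unfold force
  exact ((continuous_abs.rpow_const fun x => Or.inr (by linarith)).mul continuous_id).sub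
    (continuous_const.mul continuous_id)

lemma pot_eq {p β : ℝ} (hp : 1 < p) (w : ℝ) :
    pot p β w = w ^ 2 * (|w| ^ (p - 1) / (p + 1) - β / 2) := by
  have : |w| ^ (p + 1) = |w| ^ (p - 1) * w ^ 2 := by
    rw [show p + 1 = (p - 1) + (2 : ℕ) by push_cast; ring,
      Real.rpow_add_of_nonneg (abs_nonneg w) (by linarith) (by norm_num), Real.rpow_natCast, sq_abs]
  rw [pot, this]
  ring

lemma hasDerivAt_force {p β w : ℝ} (hw : 0 < w) :
    HasDerivAt (force p β) (p * w ^ (p - 1) - β) w := by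
  have h := (Real.hasDerivAt_rpow_const (x := w) (p := p) (Or.inl hw.ne')).sub
    ((hasDerivAt_id w).const_mul β)
  rw [mul_one] at h
  refine h.congr_of_eventuallyEq ?_
  filter_upwards [lt_mem_nhds hw] with z hz
  simp only [force, Pi.sub_apply, id]
  rw [abs_of_pos hz, Real.rpow_sub_one hz.ne', div_mul_cancel₀ _ hz.ne']

/-- The global minimum of the potential over nonnegative arguments is at the equilibrium. -/
lemma pot_min {p β b w : ℝ} (hp : 1 < p) (hb : 0 < b) (hbβ : b ^ (p - 1) = β) (hw : 0 ≤ w) :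
    pot p β b ≤ pot p β w := by
  have hB := one_add_mul_self_le_rpow_one_add (s := (w / b) ^ 2 - 1)
    (by nlinarith [sq_nonneg (w / b)]) (p := (p + 1) / 2) (by linarith)
  have hwb : 0 ≤ w / b := by positivity
  have e1 : (1 + ((w / b) ^ 2 - 1)) ^ ((p + 1) / 2) = w ^ (p + 1) / b ^ (p + 1) := by
    rw [add_sub_cancel, ← Real.rpow_natCast, ← Real.rpow_mul hwb, Real.div_rpow hw hb.le]
    congr 2 <;> · push_cast; ring
  have e2 : b ^ (p + 1) = β * b ^ 2 := by
    rw [← hbβ, show p + 1 = (p - 1) + (2 : ℕ) by push_cast; ring, Real.rpow_add hb,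
      Real.rpow_natCast]
  have hβ : 0 < β := hbβ ▸ Real.rpow_pos_of_pos hb _
  rw [e1, e2] at hB
  have hB' := mul_le_mul_of_nonneg_left hB (show 0 ≤ β * b ^ 2 by positivity)
  rw [mul_div_cancel₀ _ (show β * b ^ 2 ≠ 0 by positivity)] at hB'
  rw [pot, pot, abs_of_pos hb, abs_of_nonneg hw, e2]
  have h1 : β * b ^ 2 * (1 + (p + 1) / 2 * ((w / b) ^ 2 - 1))
      = β * b ^ 2 + (p + 1) * (β * w ^ 2 / 2 - β * b ^ 2 / 2) := by
    field_simp
  rw [h1] at hB'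
  have hp1 : 0 < p + 1 := by linarith
  have := div_le_div_of_nonneg_right hB' hp1.le
  rw [add_div, mul_div_cancel_left₀ _ hp1.ne'] at this
  linarith

lemma force_eq_zero {p β b w : ℝ} (hp : 1 < p) (hb : 0 < b) (hbβ : b ^ (p - 1) = β) (hw : 0 < w)
    (h : force p β w = 0) : w = b := by
  rw [force, abs_of_pos hw, ← sub_mul, mul_eq_zero, sub_eq_zero, ← hbβ] at h
  exact (Real.rpow_left_inj hw.le hb.le (by linarith)).1 (h.resolve_right hw.ne')

/-- In the variables `v = ρ^α u`, `y = ρ v'`, the profile equation becomes the first-order system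
`ρ v' = y`, `ρ y' = -y - force v / (1 - ρ²)`. -/
structure ProfileOrbit (p β b : ℝ) (v y : ℝ → ℝ) : Prop where
  contv : ContinuousOn v (Icc 0 1)
  conty : ContinuousOn y (Icc 0 1)
  v_zero : v 0 = 0
  y_zero : y 0 = 0
  v_one : v 1 = b
  deriv_v : ∀ x ∈ Ioo (0 : ℝ) 1, HasDerivAt v (y x / x) x
  deriv_y : ∀ x ∈ Ioo (0 : ℝ) 1, HasDerivAt y ((-y x - force p β (v x) / (1 - x ^ 2)) / x) x

/-- The energy, which decreases from `0` at the centre to the potential minimum at `x = 1`. -/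
noncomputable def energy (p β : ℝ) (v y : ℝ → ℝ) (x : ℝ) : ℝ :=
  (1 - x ^ 2) * y x ^ 2 / 2 + pot p β (v x)

namespace ProfileOrbit

variable {p β b : ℝ} {v y : ℝ → ℝ}

lemma hasDerivAt_energy (h : ProfileOrbit p β b v y) (hp : 1 < p) {x : ℝ} (hx : x ∈ Ioo (0 : ℝ) 1) :
    HasDerivAt (energy p β v y) (-(y x ^ 2 / x)) x := by
  have h1 : HasDerivAt (fun x : ℝ => 1 - x ^ 2) (-(2 * x)) x := by
    simpa using (hasDerivAt_pow 2 x).const_sub 1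
  have h2 := ((h1.mul ((h.deriv_y x hx).pow 2)).div_const 2).add
    ((hasDerivAt_pot (β := β) hp (v x)).comp x (h.deriv_v x hx))
  refine h2.congr_deriv ?_
  have : x ≠ 0 := hx.1.ne'
  have : 1 - x ^ 2 ≠ 0 := by nlinarith [hx.1, hx.2]
  simp only [Pi.pow_apply]
  field_simp
  push_cast
  ring

lemma continuousOn_energy (h : ProfileOrbit p β b v y) (hp : 1 < p) :
    ContinuousOn (energy p β v y) (Icc 0 1) := by
  have hv := (continuous_pot (β := β) hp).comp_continuousOn h.contv
  have hy := h.conty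
  exact (((continuousOn_const.sub (continuousOn_id.pow 2)).mul (hy.pow 2)).div_const 2).add hv

lemma antitoneOn_energy (h : ProfileOrbit p β b v y) (hp : 1 < p) :
    AntitoneOn (energy p β v y) (Icc 0 1) := by
  refine antitoneOn_of_hasDerivWithinAt_nonpos (convex_Icc 0 1) (h.continuousOn_energy hp)
    (f' := fun x => -(y x ^ 2 / x)) ?_ ?_ <;> rw [interior_Icc] <;> intro x hx
  · exact (h.hasDerivAt_energy hp hx).hasDerivWithinAt
  · have := hx.1
    simp only [Left.neg_nonpos_iff]
    positivity

lemma energy_one (h : ProfileOrbit p β b v y) : energy p β v y 1 = pot p β b := by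
  simp [energy, h.v_one]

lemma energy_zero (h : ProfileOrbit p β b v y) (hp : 1 < p) : energy p β v y 0 = 0 := by
  simp [energy, h.v_zero, h.y_zero, pot, Real.zero_rpow (show p + 1 ≠ 0 by linarith)]

lemma pot_le_energy {x : ℝ} (hx : x ∈ Icc (0 : ℝ) 1) : pot p β (v x) ≤ energy p β v y x := by
  have : 0 ≤ 1 - x ^ 2 := by nlinarith [hx.1, hx.2]
  have : 0 ≤ (1 - x ^ 2) * y x ^ 2 / 2 := by positivity
  rw [energy]
  linarith

end ProfileOrbit

lemma rpow_le_of_pot_neg {p β w : ℝ} (hp : 1 < p) (hw : 0 < w) (h : pot p β w ≤ 0) :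
    w ^ (p - 1) ≤ β * (p + 1) / 2 := by
  rw [pot_eq hp, abs_of_pos hw] at h
  have hp1 : 0 < p + 1 := by linarith
  have := nonpos_of_mul_nonpos_right h (by positivity)
  rw [sub_nonpos, div_le_iff₀ hp1] at this
  linarith

lemma sq_ge_of_pot_le {p β c w : ℝ} (hp : 1 < p) (hβ : 0 < β) (h : pot p β w ≤ -c) :
    2 * c / β ≤ w ^ 2 := by
  have hp1 : 0 < p + 1 := by linarith
  have : 0 ≤ |w| ^ (p + 1) / (p + 1) := by positivity
  rw [pot] at h
  rw [div_le_iff₀ hβ]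
  linarith

lemma exists_abs_deriv_force_le (p β : ℝ) {m : ℝ} (B : ℝ) (hm : 0 < m) :
    ∃ K, 0 < K ∧ ∀ w ∈ Icc m B, |p * w ^ (p - 1) - β| ≤ K := by
  have hcont : ContinuousOn (fun w : ℝ => p * w ^ (p - 1) - β) (Icc m B) :=
    (continuousOn_const.mul (continuousOn_id.rpow_const
      fun w hw => Or.inl (hm.trans_le hw.1).ne')).sub continuousOn_const
  obtain ⟨K, hK⟩ := isCompact_Icc.exists_bound_of_continuousOn hcont
  exact ⟨|K| + 1, by positivity, fun w hw => (hK w hw).trans (by linarith [le_abs_self K])⟩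

/-- On a compact subset of the positive axis, the potential is close to its minimum wherever the
force is small. -/
lemma exists_pot_le_of_force_small {p β b m B ε : ℝ} (hp : 1 < p) (hb : 0 < b)
    (hbβ : b ^ (p - 1) = β) (hm : 0 < m) (hε : 0 < ε) :
    ∃ η > 0, ∀ w ∈ Icc m B, |force p β w| ≤ η → pot p β w ≤ pot p β b + ε := by
  have hK : IsCompact (Icc m B ∩ {w | pot p β b + ε ≤ pot p β w}) :=
    isCompact_Icc.inter_right (isClosed_le continuous_const (continuous_pot hp))
  rcases (Icc m B ∩ {w | pot p β b + ε ≤ pot p β w}).eq_empty_or_nonempty with he | hne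
  · refine ⟨1, one_pos, fun w hw _ => ?_⟩
    by_contra! hlt
    exact (he.subset ⟨hw, hlt.le⟩ : w ∈ (∅ : Set ℝ))
  · obtain ⟨z, ⟨hz, hzε⟩, hmin⟩ := hK.exists_isMinOn hne (f := fun w => |force p β w|)
      (continuous_force hp).abs.continuousOn
    have hz0 : 0 < |force p β z| := by
      refine abs_pos.2 fun h0 => ?_
      have hzb := force_eq_zero hp hb hbβ (hm.trans_le hz.1) h0
      rw [mem_ofPred_eq, hzb] at hzε
      linarith
    refine ⟨|force p β z| / 2, by positivity, fun w hw hf => ?_⟩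
    by_contra! hlt
    have : |force p β z| ≤ |force p β w| := hmin ⟨hw, hlt.le⟩
    linarith

namespace ProfileOrbit

variable {p β b : ℝ} {v y : ℝ → ℝ}

lemma pos_of_energy_neg (h : ProfileOrbit p β b v y) (hp : 1 < p) (hb : 0 < b) {a : ℝ}
    (ha : a ∈ Icc (0 : ℝ) 1) (hE : energy p β v y a < 0) {x : ℝ} (hx : x ∈ Icc a 1) : 0 < v x := by
  by_contra! hle
  have hcont : ContinuousOn v (Icc x 1) := h.contv.mono (Icc_subset_Icc_left (ha.1.trans hx.1))
  obtain ⟨z, hz, hz0⟩ := intermediate_value_Icc hx.2 hcont ⟨hle, h.v_one ▸ hb.le⟩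
  have hz01 : z ∈ Icc (0 : ℝ) 1 := ⟨ha.1.trans (hx.1.trans hz.1), hz.2⟩
  have h1 := pot_le_energy (p := p) (β := β) (v := v) (y := y) hz01
  have h2 := h.antitoneOn_energy hp ha hz01 (hx.1.trans hz.1)
  rw [hz0, pot_eq hp] at h1
  simp at h1
  linarith

lemma hasDerivAt_modifiedEnergy (h : ProfileOrbit p β b v y) (hp : 1 < p) (κ : ℝ) {x : ℝ}
    (hx : x ∈ Ioo (0 : ℝ) 1) (hv : 0 < v x) :
    HasDerivAt (fun s => energy p β v y s + κ * (y s * force p β (v s)))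
      ((-y x ^ 2 + κ * ((p * v x ^ (p - 1) - β) * y x ^ 2 - y x * force p β (v x)
        - force p β (v x) ^ 2 / (1 - x ^ 2))) / x) x := by
  have hf : HasDerivAt (fun s => force p β (v s)) ((p * v x ^ (p - 1) - β) * (y x / x)) x :=
    (hasDerivAt_force hv).comp x (h.deriv_v x hx)
  refine ((h.hasDerivAt_energy hp hx).add (((h.deriv_y x hx).mul hf).const_mul κ)).congr_deriv ?_
  have : x ≠ 0 := hx.1.ne'
  have : 1 - x ^ 2 ≠ 0 := by nlinarith [hx.1, hx.2]
  field_simp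
  ring

/-- On a long logarithmic window, the orbit comes close to an equilibrium. -/
lemma exists_near_equilibrium (h : ProfileOrbit p β b v y) (hp : 1 < p) {a r K C : ℝ}
    (ha : 0 < a) (har : a < r) (hr : r < 1) (hv : ∀ x ∈ Icc a r, 0 < v x)
    (hK : ∀ x ∈ Icc a r, |p * v x ^ (p - 1) - β| ≤ K)
    (hC : ∀ x ∈ Icc a r,
      |energy p β v y x + 1 / (2 * K + 1) * (y x * force p β (v x))| ≤ C) :
    ∃ x ∈ Ioo a r, (y x ^ 2 + 1 / (2 * K + 1) * force p β (v x) ^ 2) * Real.log (r / a)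
      ≤ 4 * C := by
  have hsub : Icc a r ⊆ Icc 0 1 := Icc_subset_Icc ha.le hr.le
  have hK0 : 0 ≤ K := (abs_nonneg _).trans (hK a ⟨le_rfl, har.le⟩)
  have hcont : ContinuousOn (fun s => energy p β v y s + 1 / (2 * K + 1) * (y s * force p β (v s)))
      (Icc a r) :=
    ((h.continuousOn_energy hp).mono hsub).add (continuousOn_const.mul
      ((h.conty.mono hsub).mul ((continuous_force hp).comp_continuousOn (h.contv.mono hsub))))
  obtain ⟨x, hx, heq⟩ := exists_ratio_hasDerivAt_eq_ratio_slope _ _ har hcont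
    (fun x hx => h.hasDerivAt_modifiedEnergy hp _ ⟨ha.trans hx.1, hx.2.trans hr⟩
      (hv x (Ioo_subset_Icc_self hx)))
    Real.log (fun x => x⁻¹)
    (Real.continuousOn_log.mono fun s hs => (ha.trans_le hs.1).ne')
    (fun x hx => Real.hasDerivAt_log (ha.trans hx.1).ne')
  have hxI := Ioo_subset_Icc_self hx
  refine ⟨x, hx, ?_⟩
  have hx0 : 0 < x := ha.trans hx.1
  have hx1 : x < 1 := hx.2.trans hr
  have hL : 0 < Real.log (r / a) := Real.log_pos ((one_lt_div ha).2 har)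
  rw [← Real.log_div (ha.trans har).ne' ha.ne', mul_div_assoc', div_eq_mul_inv] at heq
  have heq := mul_right_cancel₀ (inv_ne_zero hx0.ne') heq
  have h1 := abs_le.1 (hC a ⟨le_rfl, har.le⟩)
  have h2 := abs_le.1 (hC r ⟨har.le, le_rfl⟩)
  have h3 := abs_le.1 (hK x hxI)
  set κ := 1 / (2 * K + 1) with hκ
  have hκ0 : 0 < κ := by positivity
  have hκK : κ * (2 * K + 1) = 1 := by rw [hκ]; field_simp
  set f := force p β (v x)
  have h4 : f ^ 2 ≤ f ^ 2 / (1 - x ^ 2) :=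
    le_div_self (sq_nonneg _) (by nlinarith) (by nlinarith)
  have h5 : (p * v x ^ (p - 1) - β) * y x ^ 2 ≤ K * y x ^ 2 :=
    mul_le_mul_of_nonneg_right h3.2 (sq_nonneg _)
  have h6 : -(y x * f) ≤ (y x ^ 2 + f ^ 2) / 2 := by nlinarith [sq_nonneg (y x + f)]
  have h7 : κ * ((p * v x ^ (p - 1) - β) * y x ^ 2 - y x * f - f ^ 2 / (1 - x ^ 2)) ≤
      κ * (K * y x ^ 2 + (y x ^ 2 + f ^ 2) / 2 - f ^ 2) :=
    mul_le_mul_of_nonneg_left (by linarith) hκ0.le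
  have h8 : κ * (K * y x ^ 2 + (y x ^ 2 + f ^ 2) / 2 - f ^ 2)
      = y x ^ 2 / 2 - κ * f ^ 2 / 2 := by
    linear_combination (y x ^ 2 / 2) * hκK
  have h9 : (y x ^ 2 + κ * f ^ 2) / 2 ≤
      -(-y x ^ 2 + κ * ((p * v x ^ (p - 1) - β) * y x ^ 2 - y x * f - f ^ 2 / (1 - x ^ 2))) := by
    linarith
  have h10 := mul_le_mul_of_nonneg_left h9 hL.le
  rw [mul_neg, heq] at h10
  linarith

/-- Once the energy is at most `-c`, the orbit stays in a fixed compact subset of the positive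
axis. -/
lemma exists_trapping (hp : 1 < p) (hb : 0 < b) (hβ : 0 < β) {c : ℝ} (hc : 0 < c) :
    ∃ m B, 0 < m ∧ ∀ v y, ProfileOrbit p β b v y → ∀ a ∈ Icc (0 : ℝ) 1, energy p β v y a ≤ -c →
      ∀ x ∈ Icc a 1, v x ∈ Icc m B := by
  have hp1 : 0 < p + 1 := by linarith
  refine ⟨√(2 * c / β), (β * (p + 1) / 2) ^ (p - 1)⁻¹, Real.sqrt_pos.2 (by positivity),
    fun v y h a ha hEa x hx => ?_⟩
  have hx01 : x ∈ Icc (0 : ℝ) 1 := ⟨ha.1.trans hx.1, hx.2⟩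
  have hv : 0 < v x := h.pos_of_energy_neg hp hb ha (by linarith) hx
  have hpot : pot p β (v x) ≤ -c :=
    (pot_le_energy hx01).trans ((h.antitoneOn_energy hp ha hx01 hx.1).trans hEa)
  refine ⟨Real.sqrt_le_iff.2 ⟨hv.le, sq_ge_of_pot_le hp hβ hpot⟩, ?_⟩
  rw [Real.le_rpow_inv_iff_of_pos hv.le (by positivity) (by linarith)]
  exact rpow_le_of_pot_neg hp hv (by linarith)

lemma sq_le_of_energy_nonpos (hp : 1 < p) (hb : 0 < b) (hbβ : b ^ (p - 1) = β) {x r : ℝ}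
    (hx : x ∈ Icc 0 r) (hr : r < 1) (hv : 0 ≤ v x) (hE : energy p β v y x ≤ 0) :
    y x ^ 2 ≤ 2 * |pot p β b| / (1 - r ^ 2) := by
  have h1 := pot_min hp hb hbβ hv
  have h3 : 1 - r ^ 2 ≤ 1 - x ^ 2 := by nlinarith [hx.1, hx.2]
  have h4 := mul_le_mul_of_nonneg_right h3 (sq_nonneg (y x))
  have h5 := neg_abs_le (pot p β b)
  rw [energy] at hE
  rw [le_div_iff₀ (by nlinarith [hx.1, hx.2])]
  linarith

/-- If the energy is at most `-c` sufficiently far in the logarithmic past, then at `r` it is close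
to its minimum. The window length depends only on the constants. -/
lemma exists_energy_le (hp : 1 < p) (hb : 0 < b) (hbβ : b ^ (p - 1) = β) {c r ε : ℝ} (hc : 0 < c)
    (hr0 : 0 < r) (hr1 : r < 1) (hε : 0 < ε) :
    ∃ R ∈ Ioo 0 r, ∀ v y, ProfileOrbit p β b v y → ∀ a ∈ Ioc 0 R, energy p β v y a ≤ -c →
      energy p β v y r ≤ pot p β b + ε := by
  have hβ : 0 < β := hbβ ▸ Real.rpow_pos_of_pos hb _
  obtain ⟨m, B, hm, htrap⟩ := exists_trapping hp hb hβ hc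
  obtain ⟨K, hK0, hK⟩ := exists_abs_deriv_force_le p β B hm
  obtain ⟨D, hD⟩ := isCompact_Icc.exists_bound_of_continuousOn
    ((continuous_force (β := β) hp).continuousOn (s := Icc m B))
  obtain ⟨η, hη, hηf⟩ := exists_pot_le_of_force_small (B := B) hp hb hbβ hm (half_pos hε)
  obtain ⟨P, hP⟩ : ∃ P, P = |pot p β b| := ⟨_, rfl⟩
  have hP0 : 0 ≤ P := hP ▸ abs_nonneg _
  have hr2 : 0 < 1 - r ^ 2 := by nlinarith
  obtain ⟨κ, hκ⟩ : ∃ κ, κ = 1 / (2 * K + 1) := ⟨_, rfl⟩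
  have hκ0 : 0 < κ := by rw [hκ]; positivity
  obtain ⟨C, hC⟩ : ∃ C, C = P + κ * ((2 * P / (1 - r ^ 2) + D ^ 2) / 2) + 1 := ⟨_, rfl⟩
  have hC0 : 0 < C := by rw [hC]; positivity
  obtain ⟨μ, hμ⟩ : ∃ μ, μ = min ε (κ * η ^ 2) := ⟨_, rfl⟩
  have hμ0 : 0 < μ := by rw [hμ]; positivity
  have hRr : r * Real.exp (-(4 * C / μ)) < r :=
    mul_lt_of_lt_one_right hr0 (Real.exp_lt_one_iff.2 (by simp; positivity))
  refine ⟨r * Real.exp (-(4 * C / μ)), ⟨by positivity, hRr⟩, fun v y h a ha hEa => ?_⟩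
  have har : a < r := ha.2.trans_lt hRr
  have ha01 : a ∈ Icc (0 : ℝ) 1 := ⟨ha.1.le, (har.trans hr1).le⟩
  have hI : ∀ x ∈ Icc a r, x ∈ Icc (0 : ℝ) 1 := fun x hx =>
    ⟨ha.1.le.trans hx.1, hx.2.trans hr1.le⟩
  have hvI : ∀ x ∈ Icc a r, v x ∈ Icc m B := fun x hx =>
    htrap v y h a ha01 hEa x ⟨hx.1, hx.2.trans hr1.le⟩
  have hv : ∀ x ∈ Icc a r, 0 < v x := fun x hx => hm.trans_le (hvI x hx).1
  obtain ⟨x, hx, hxs⟩ := h.exists_near_equilibrium hp ha.1 har hr1 hv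
    (fun x hx => hK _ (hvI x hx)) (C := C) (fun x hx => by
    have hE0 : energy p β v y x ≤ 0 :=
      (h.antitoneOn_energy hp ha01 (hI x hx) hx.1).trans (by linarith)
    have h1 : |energy p β v y x| ≤ P := by
      have h3 : pot p β b ≤ energy p β v y x :=
        h.energy_one ▸ h.antitoneOn_energy hp (hI x hx) ⟨zero_le_one, le_rfl⟩ (hI x hx).2
      have h5 := neg_abs_le (pot p β b)
      rw [abs_le]
      constructor <;> linarith
    have h2 : |y x * force p β (v x)| ≤ (2 * P / (1 - r ^ 2) + D ^ 2) / 2 := by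
      have h3 := sq_le_of_energy_nonpos hp hb hbβ ⟨(hI x hx).1, hx.2⟩ hr1 (hv x hx).le hE0
      have h4 : force p β (v x) ^ 2 ≤ D ^ 2 := sq_le_sq' (abs_le.1 (hD _ (hvI x hx))).1
        (abs_le.1 (hD _ (hvI x hx))).2
      rw [← hP] at h3
      rw [abs_le]
      constructor
      · linarith [sq_nonneg (y x + force p β (v x)), add_sq (y x) (force p β (v x))]
      · linarith [sq_nonneg (y x - force p β (v x)), sub_sq (y x) (force p β (v x))]
    rw [← hκ]
    refine (abs_add_le _ _).trans ?_
    rw [abs_mul, abs_of_pos hκ0]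
    linarith [mul_le_mul_of_nonneg_left h2 hκ0.le])
  rw [← hκ] at hxs
  have hlog : 4 * C / μ ≤ Real.log (r / a) := by
    rw [Real.le_log_iff_exp_le (div_pos hr0 ha.1), le_div_iff₀ ha.1]
    calc Real.exp (4 * C / μ) * a ≤ Real.exp (4 * C / μ) * (r * Real.exp (-(4 * C / μ))) := by
          gcongr
          exact ha.2
      _ = r := by rw [Real.exp_neg]; field_simp
  have hxI := Ioo_subset_Icc_self hx
  have hsmall : y x ^ 2 + κ * force p β (v x) ^ 2 ≤ μ := by
    rw [div_le_iff₀ hμ0] at hlog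
    have hL : 0 < Real.log (r / a) := Real.log_pos ((one_lt_div ha.1).2 har)
    refine le_of_mul_le_mul_right ?_ hL
    linarith
  rw [hμ, le_min_iff] at hsmall
  have hyε : y x ^ 2 ≤ ε := by
    linarith [mul_nonneg hκ0.le (sq_nonneg (force p β (v x)))]
  have hfη : |force p β (v x)| ≤ η := by
    refine abs_le_of_sq_le_sq (le_of_mul_le_mul_left ?_ hκ0) hη.le
    linarith [sq_nonneg (y x)]
  have hpx := hηf (v x) (hvI x hxI) hfη
  have hEx : energy p β v y x ≤ pot p β b + ε := by
    rw [energy]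
    linarith [mul_nonneg (sq_nonneg x) (sq_nonneg (y x))]
  exact (h.antitoneOn_energy hp (hI x hxI) ⟨hr0.le, hr1.le⟩ hx.2.le).trans hEx

/-- Near the regular singular endpoint `1`, the slope at `1` is controlled by the slope at `r`. -/
lemma abs_slope_one_le (h : ProfileOrbit p β b v y) (hb : 0 < b) (hbβ : b ^ (p - 1) = β)
    {m B K r : ℝ} (hm : 0 < m) (hK0 : 0 ≤ K) (hK : ∀ w ∈ Icc m B, |p * w ^ (p - 1) - β| ≤ K)
    (hr : 3 / 4 ≤ r) (hr1 : r < 1) (hrK : 8 * K * (1 - r) ≤ 1) (hv : ∀ x ∈ Icc r 1, v x ∈ Icc m B) :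
    |y 1| ≤ 2 * |y r| := by
  have hr0 : 0 < r := by linarith
  have hsub : Icc r 1 ⊆ Icc (0 : ℝ) 1 := Icc_subset_Icc_left hr0.le
  obtain ⟨x₀, hx₀, hmax⟩ := isCompact_Icc.exists_isMaxOn (nonempty_Icc.2 hr1.le)
    (h.conty.mono hsub).abs
  obtain ⟨M, hM⟩ : ∃ M, M = |y x₀| := ⟨_, rfl⟩
  have hyM : ∀ x ∈ Icc r 1, |y x| ≤ M := fun x hx => hM ▸ hmax hx
  have hM0 : 0 ≤ M := hM ▸ abs_nonneg _
  have hvb : ∀ x ∈ Ioo r 1, |v x - b| ≤ M / r * (1 - x) := fun x hx => by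
    obtain ⟨c, hc, hceq⟩ := exists_hasDerivAt_eq_slope v (fun s => y s / s) hx.2
      (h.contv.mono (Icc_subset_Icc_left (hr0.trans hx.1).le))
      (fun s hs => h.deriv_v s ⟨hr0.trans (hx.1.trans hs.1), hs.2⟩)
    have hx1 : 0 < 1 - x := by linarith [hx.2]
    rw [eq_div_iff hx1.ne', h.v_one] at hceq
    have hrc : r < c := hx.1.trans hc.1
    rw [abs_sub_comm, ← hceq, abs_mul, abs_div, abs_of_pos hx1, abs_of_pos (hr0.trans hrc)]
    have := hyM c ⟨hrc.le, hc.2.le⟩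
    gcongr
  have hfb : force p β b = 0 := by rw [force, abs_of_pos hb, hbβ, sub_self]
  have hbI : b ∈ Icc m B := h.v_one ▸ hv 1 ⟨hr1.le, le_rfl⟩
  have hf : ∀ x ∈ Ioo r 1, |force p β (v x) / (1 - x ^ 2)| ≤ 2 * K * M := fun x hx => by
    have h1 := Convex.norm_image_sub_le_of_norm_hasDerivWithin_le
      (fun w hw => (hasDerivAt_force (p := p) (β := β) (hm.trans_le hw.1)).hasDerivWithinAt) hK
      (convex_Icc m B) hbI (hv x (Ioo_subset_Icc_self hx))
    rw [hfb, sub_zero, Real.norm_eq_abs, Real.norm_eq_abs] at h1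
    have hx0 : 0 < x := hr0.trans hx.1
    have hx1 : 0 < 1 - x := by linarith [hx.2]
    have h2 : 0 < 1 - x ^ 2 := by nlinarith
    have h3 : M / r ≤ 2 * M := by
      rw [div_le_iff₀ hr0]
      nlinarith
    rw [abs_div, abs_of_pos h2, div_le_iff₀ h2]
    calc |force p β (v x)| ≤ K * (2 * M * (1 - x)) := by
          refine h1.trans (mul_le_mul_of_nonneg_left ((hvb x hx).trans ?_) hK0)
          gcongr
      _ ≤ K * (2 * M * (1 - x ^ 2)) := by
          gcongr
          nlinarith
      _ = 2 * K * M * (1 - x ^ 2) := by ring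
  have hdiff : |x₀ * y x₀ - r * y r| ≤ 2 * K * M * (1 - r) := by
    rcases hx₀.1.eq_or_lt with heq | hlt
    · rw [← heq, sub_self, abs_zero]
      have : 0 ≤ 1 - r := by linarith
      positivity
    · obtain ⟨c, hc, hceq⟩ := exists_hasDerivAt_eq_slope (fun s => s * y s)
        (fun s => -(force p β (v s) / (1 - s ^ 2))) hlt
        (continuousOn_id.mul (h.conty.mono ((Icc_subset_Icc_right hx₀.2).trans hsub)))
        (fun s hs => by
          have hs01 : s ∈ Ioo (0 : ℝ) 1 := ⟨hr0.trans hs.1, hs.2.trans_le hx₀.2⟩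
          refine ((hasDerivAt_id s).mul (h.deriv_y s hs01)).congr_deriv ?_
          simp only [id, one_mul]
          rw [mul_div_cancel₀ _ hs01.1.ne']
          ring)
      have hpos : 0 < x₀ - r := by linarith
      rw [eq_div_iff hpos.ne'] at hceq
      rw [← hceq, abs_mul, abs_neg, abs_of_pos hpos]
      have := hf c ⟨hc.1, hc.2.trans_le hx₀.2⟩
      have := hx₀.2
      gcongr
  have h1 : x₀ * M ≤ r * |y r| + 2 * K * M * (1 - r) := by
    have h2 := abs_sub_abs_le_abs_sub (x₀ * y x₀) (r * y r)
    rw [abs_mul, abs_mul, abs_of_pos hr0, abs_of_pos (hr0.trans_le hx₀.1), ← hM] at h2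
    linarith
  have h2 : 3 / 4 * M ≤ x₀ * M := by
    have := hx₀.1
    gcongr
    linarith
  have h3 : M * (8 * K * (1 - r)) ≤ M * 1 := mul_le_mul_of_nonneg_left hrK hM0
  have h4 : r * |y r| ≤ 1 * |y r| := by gcongr
  have := hyM 1 ⟨hr1.le, le_rfl⟩
  linarith

lemma slope_ge_of_small (h : ProfileOrbit p β b v y) (hp : 1 < p) {α X : ℝ} (hα : 0 < α)
    (hβ : β = α * (α + 1)) (hX : X ≤ 1)
    (hv : ∀ x ∈ Ioo 0 X, 0 < v x) (hq : ∀ x ∈ Ioo 0 X, p * v x ^ (p - 1) ≤ α) :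
    ∀ x ∈ Ioo 0 X, α * v x - v x ^ p ≤ y x := by
  intro x hx
  suffices H : ∀ ε > 0, α * v x - v x ^ p - y x ≤ ε by
    linarith [le_of_forall_pos_le_add fun ε hε => (H ε hε).trans (zero_add ε).ge]
  intro ε hε
  have hcont : ContinuousOn (fun s => α * v s - v s ^ p - y s) (Icc 0 1) :=
    ((continuousOn_const.mul h.contv).sub
      (h.contv.rpow_const fun _ _ => Or.inr (by linarith))).sub h.conty
  have hx1 : x < 1 := hx.2.trans_le hX
  obtain ⟨a, ha, haε⟩ : ∃ a ∈ Ioo 0 x, α * v a - v a ^ p - y a ≤ ε := by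
    have h0 := hcont 0 ⟨le_rfl, zero_le_one⟩
    have h1 := (h0.mono (Ioo_subset_Icc_self.trans (Icc_subset_Icc_right hx1.le) :
      Ioo 0 x ⊆ Icc 0 1)).eventually_lt_const (u := ε) (by
        simp [h.v_zero, h.y_zero, Real.zero_rpow (show p ≠ 0 by linarith), hε])
    have := left_nhdsWithin_Ioo_neBot hx.1
    obtain ⟨a, ha, ha'⟩ := (h1.and self_mem_nhdsWithin).exists
    exact ⟨a, ha', ha.le⟩
  have hI : ∀ s ∈ Ico a x, s ∈ Ioo 0 X := fun s hs => ⟨ha.1.trans_le hs.1, hs.2.trans hx.2⟩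
  refine image_le_of_deriv_right_lt_deriv_boundary
    (f' := fun s => α * (y s / s) - y s / s * p * v s ^ (p - 1)
      - (-y s - force p β (v s) / (1 - s ^ 2)) / s)
    (hcont.mono (Icc_subset_Icc ha.1.le hx1.le)) (fun s hs => ?_) (B := fun _ => ε)
    (B' := fun _ => 0) haε (fun s => hasDerivAt_const s ε) (fun s hs heq => ?_)
    (right_mem_Icc.2 ha.2.le)
  · have hs01 : s ∈ Ioo (0 : ℝ) 1 := ⟨(hI s hs).1, (hI s hs).2.trans_le hX⟩
    exact ((((h.deriv_v s hs01).const_mul α).sub ((h.deriv_v s hs01).rpow_const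
      (Or.inl (hv s (hI s hs)).ne'))).sub (h.deriv_y s hs01)).hasDerivWithinAt
  · have hs0 : 0 < s := (hI s hs).1
    have hs1 : s < 1 := (hI s hs).2.trans_le hX
    have hvs := hv s (hI s hs)
    have hqs := hq s (hI s hs)
    obtain ⟨q, hqdef⟩ : ∃ q, q = v s ^ (p - 1) := ⟨_, rfl⟩
    have hvp : v s ^ p = q * v s := by
      rw [hqdef, Real.rpow_sub_one hvs.ne', div_mul_cancel₀ _ hvs.ne']
    have hq0 : 0 < q := hqdef ▸ Real.rpow_pos_of_pos hvs _
    rw [← hqdef] at hqs ⊢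
    have hfs : force p β (v s) = (q - β) * v s := by
      rw [force, abs_of_pos hvs, ← hqdef]
      ring
    have hs2 : 0 < 1 - s ^ 2 := by nlinarith
    have hqβ : q ≤ β := by nlinarith
    have hforce : force p β (v s) / (1 - s ^ 2) ≤ (q - β) * v s := by
      rw [hfs, div_le_iff₀ hs2]
      nlinarith [mul_nonneg (mul_nonneg (sub_nonneg.2 hqβ) hvs.le) (sq_nonneg s)]
    rw [show α * (y s / s) - y s / s * p * q - (-y s - force p β (v s) / (1 - s ^ 2)) / s
      = ((α + 1 - p * q) * y s + force p β (v s) / (1 - s ^ 2)) / s by ring]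
    refine div_neg_of_neg_of_pos ?_ hs0
    have hy : y s = α * v s - q * v s - ε := by
      rw [← hvp]
      linarith
    have h1 : (α + 1 - p * q) * y s + (q - β) * v s
        = -(v s * q * (α + p * α - p * q)) - (α + 1 - p * q) * ε := by
      rw [hy, hβ]
      ring
    have h2 : 0 < (α + 1 - p * q) * ε := mul_pos (by linarith) hε
    have h3 : 0 < v s * q * (α + p * α - p * q) := mul_pos (by positivity) (by nlinarith)
    linarith

/-- A profile with large value at the centre has energy at most a fixed negative constant at some
point close to the centre. -/
lemma exists_energy_le_near_zero (h : ProfileOrbit p β b v y) (hp : 1 < p) {α δ R : ℝ}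
    {u : ℝ → ℝ} (hα : 0 < α) (hαp : α * (p - 1) = 2) (hβ : β = α * (α + 1)) (hδ : 0 < δ)
    (hδα : p * δ ≤ α) (hδα' : δ ≤ α / 2) (hδp : p * δ ≤ 1) (hR : R ∈ Ioo (0 : ℝ) 1)
    (hu : ContinuousOn u (Icc 0 1)) (hvu : ∀ x ∈ Icc (0 : ℝ) 1, v x = x ^ α * u x)
    (hu0 : 0 < u 0) (hlarge : 2 ≤ u 0 ^ (p - 1) * R ^ 2) :
    ∃ a ∈ Ioc 0 R, energy p β v y a ≤ -(α / 4 * (δ ^ (p - 1)⁻¹) ^ 2) := by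
  have hp1 : 0 < p - 1 := by linarith
  have key : ∀ X ∈ Ioc 0 R, (∀ x ∈ Ioo 0 X, 0 < u x ∧ v x ^ (p - 1) < δ) →
      0 < v X ∧ energy p β v y X ≤ -(α / 4 * v X ^ 2) ∧
        X ^ 2 * (v X ^ (p - 1))⁻¹ ≤ (u 0 ^ (p - 1))⁻¹ + (p - 1) * X ^ 2 / 2 := by
    intro X hX hsmall
    have hX1 : X < 1 := hX.2.trans_lt hR.2
    have hI : ∀ x ∈ Ioo 0 X, x ∈ Ioo (0 : ℝ) 1 := fun x hx => ⟨hx.1, hx.2.trans hX1⟩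
    have hsub : Icc 0 X ⊆ Icc 0 1 := Icc_subset_Icc_right hX1.le
    have hX0 : X ∈ Icc 0 X := right_mem_Icc.2 hX.1.le
    have h00 : (0 : ℝ) ∈ Icc 0 X := left_mem_Icc.2 hX.1.le
    have hv : ∀ x ∈ Ioo 0 X, 0 < v x := fun x hx => by
      rw [hvu x (Ioo_subset_Icc_self (hI x hx))]
      exact mul_pos (Real.rpow_pos_of_pos hx.1 _) (hsmall x hx).1
    have hslope := h.slope_ge_of_small hp hα hβ hX1.le hv fun x hx =>
      (mul_le_mul_of_nonneg_left (hsmall x hx).2.le (by linarith)).trans hδα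
    have hvp : ∀ x ∈ Ioo 0 X, v x ^ p = v x ^ (p - 1) * v x := fun x hx => by
      rw [Real.rpow_sub_one (hv x hx).ne', div_mul_cancel₀ _ (hv x hx).ne']
    have hslope' : ∀ x ∈ Ioo 0 X, α / 2 * v x ≤ y x := fun x hx => by
      have h1 := hslope x hx
      have h2 := mul_le_mul_of_nonneg_right ((hsmall x hx).2.le.trans hδα') (hv x hx).le
      rw [hvp x hx] at h1
      linarith
    have hmono : MonotoneOn v (Icc 0 X) := by
      refine monotoneOn_of_hasDerivWithinAt_nonneg (convex_Icc 0 X) (h.contv.mono hsub)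
        (f' := fun x => y x / x) ?_ ?_ <;> rw [interior_Icc] <;> intro x hx
      · exact (h.deriv_v x (hI x hx)).hasDerivWithinAt
      · have := hv x hx
        exact div_nonneg ((by positivity : 0 ≤ α / 2 * v x).trans (hslope' x hx)) hx.1.le
    have hvX : 0 < v X := by
      have hX2 : X / 2 ∈ Ioo 0 X := ⟨half_pos hX.1, half_lt_self hX.1⟩
      exact (hv _ hX2).trans_le (hmono (Ioo_subset_Icc_self hX2) hX0 hX2.2.le)
    refine ⟨hvX, ?_, ?_⟩
    · have hanti : AntitoneOn (fun x => energy p β v y x + α / 4 * v x ^ 2) (Icc 0 X) := by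
        refine antitoneOn_of_hasDerivWithinAt_nonpos (convex_Icc 0 X)
          (((h.continuousOn_energy hp).mono hsub).add
            (continuousOn_const.mul ((h.contv.mono hsub).pow 2)))
          (f' := fun x => -(y x / x * (y x - α / 2 * v x))) ?_ ?_ <;>
          rw [interior_Icc] <;> intro x hx
        · refine HasDerivAt.hasDerivWithinAt (((h.hasDerivAt_energy hp (hI x hx)).add
            (((h.deriv_v x (hI x hx)).pow 2).const_mul (α / 4))).congr_deriv ?_)
          have : x ≠ 0 := hx.1.ne'
          field_simp
          push_cast
          ring
        · have := hv x hx
          have h1 := hslope' x hx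
          have h2 : 0 ≤ y x / x :=
            div_nonneg ((by positivity : 0 ≤ α / 2 * v x).trans h1) hx.1.le
          exact neg_nonpos.2 (mul_nonneg h2 (by linarith))
      have := hanti h00 hX0 hX.1.le
      simp only [h.energy_zero hp, h.v_zero] at this
      linarith
    · have huX : ∀ x ∈ Ioc 0 X, 0 < u x := fun x hx => by
        rcases hx.2.eq_or_lt with rfl | hlt
        · rw [hvu x (hsub hX0)] at hvX
          exact pos_of_mul_pos_right hvX (Real.rpow_nonneg hX.1.le _)
        · exact (hsmall x ⟨hx.1, hlt⟩).1
      have huv : ∀ x ∈ Ioc 0 X, (u x ^ (p - 1))⁻¹ = x ^ 2 * (v x ^ (p - 1))⁻¹ := fun x hx => by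
        have h1 := Real.rpow_pos_of_pos (huX x hx) (p - 1)
        have hx0 := hx.1
        rw [hvu x (hsub (Ioc_subset_Icc_self hx)), Real.mul_rpow (Real.rpow_nonneg hx.1.le _)
          (huX x hx).le, ← Real.rpow_mul hx.1.le, hαp, Real.rpow_two]
        field_simp
      have hu_ne : ∀ x ∈ Icc 0 X, 0 < u x := fun x hx => by
        rcases hx.1.eq_or_lt with rfl | hlt
        · exact hu0
        · exact huX x ⟨hlt, hx.2⟩
      have hanti : AntitoneOn (fun x => (u x ^ (p - 1))⁻¹ - (p - 1) * x ^ 2 / 2) (Icc 0 X) := by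
        refine antitoneOn_of_hasDerivWithinAt_nonpos (convex_Icc 0 X)
          (ContinuousOn.sub (((hu.mono hsub).rpow_const fun x hx => Or.inr hp1.le).inv₀
            fun x hx => (Real.rpow_pos_of_pos (hu_ne x hx) _).ne') (by fun_prop))
          (f' := fun x => x * (2 * (v x ^ (p - 1))⁻¹ - (p - 1) * y x * (v x ^ p)⁻¹ - (p - 1)))
          ?_ ?_ <;> rw [interior_Icc] <;> intro x hx
        · refine HasDerivAt.hasDerivWithinAt ?_
          have hvx := hv x hx
          have h1 := (hasDerivAt_pow 2 x).mul (((h.deriv_v x (hI x hx)).rpow_const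
            (p := p - 1) (Or.inl hvx.ne')).inv (Real.rpow_pos_of_pos hvx _).ne')
          have h2 := h1.sub (((hasDerivAt_pow 2 x).const_mul (p - 1)).div_const 2)
          refine (h2.congr_of_eventuallyEq ?_).congr_deriv ?_
          · filter_upwards [isOpen_Ioo.mem_nhds hx] with s hs
            rw [huv s ⟨hs.1, hs.2.le⟩]
            rfl
          · have e1 : v x ^ (p - 1 - 1) = v x ^ (p - 1) / v x := Real.rpow_sub_one hvx.ne' _
            have hx0 := hx.1
            have hq0 := Real.rpow_pos_of_pos hvx (p - 1)
            simp only [Pi.inv_apply]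
            rw [e1, hvp x hx]
            field_simp
            push_cast
            ring
        · have hvx := hv x hx
          have hq0 := Real.rpow_pos_of_pos hvx (p - 1)
          refine mul_nonpos_of_nonneg_of_nonpos hx.1.le ?_
          have h1 := hslope x hx
          rw [hvp x hx] at h1 ⊢
          have h2 := mul_le_mul_of_nonneg_right h1
            (inv_nonneg.2 (mul_pos hq0 hvx).le)
          have h3 : (α * v x - v x ^ (p - 1) * v x) * (v x ^ (p - 1) * v x)⁻¹
              = α * (v x ^ (p - 1))⁻¹ - 1 := by field_simp
          rw [h3] at h2
          have h4 := mul_le_mul_of_nonneg_left h2 hp1.le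
          have h5 : (p - 1) * (α * (v x ^ (p - 1))⁻¹ - 1)
              = 2 * (v x ^ (p - 1))⁻¹ - (p - 1) := by
            rw [← hαp]
            ring
          rw [h5] at h4
          linarith
      have := hanti h00 hX0 hX.1.le
      simp only [huv X ⟨hX.1, le_rfl⟩] at this
      linarith
  have hsubR : Icc 0 R ⊆ Icc 0 1 := Icc_subset_Icc_right hR.2.le
  have hclosed : IsClosed (Icc 0 R ∩ {x | u x ≤ 0 ∨ δ ≤ v x ^ (p - 1)}) := by
    have h1 : IsClosed (Icc 0 R ∩ u ⁻¹' Iic 0) :=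
      (hu.mono hsubR).preimage_isClosed_of_isClosed isClosed_Icc isClosed_Iic
    have h2 : IsClosed (Icc 0 R ∩ (fun x => v x ^ (p - 1)) ⁻¹' Ici δ) :=
      ((h.contv.mono hsubR).rpow_const fun _ _ => Or.inr hp1.le).preimage_isClosed_of_isClosed
        isClosed_Icc isClosed_Ici
    convert h1.union h2 using 1
    rw [← inter_union_distrib_left]
    rfl
  rcases (Icc 0 R ∩ {x | u x ≤ 0 ∨ δ ≤ v x ^ (p - 1)}).eq_empty_or_nonempty with he | hne
  · exfalso
    have hgood : ∀ x ∈ Icc 0 R, 0 < u x ∧ v x ^ (p - 1) < δ := fun x hx => by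
      by_contra! hcon
      refine (he.subset ⟨hx, ?_⟩ : x ∈ (∅ : Set ℝ))
      by_cases hux : 0 < u x
      · exact Or.inr (hcon hux)
      · exact Or.inl (not_lt.1 hux)
    obtain ⟨hvR, -, hR3⟩ := key R ⟨hR.1, le_rfl⟩ fun x hx => hgood x (Ioo_subset_Icc_self hx)
    have hq := (hgood R (right_mem_Icc.2 hR.1.le)).2
    have hq0 := Real.rpow_pos_of_pos hvR (p - 1)
    have hu0p := Real.rpow_pos_of_pos hu0 (p - 1)
    have h1 : p ≤ (v R ^ (p - 1))⁻¹ := by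
      rw [le_inv_comm₀ (by linarith) hq0, ← one_div, le_div_iff₀ (by linarith)]
      nlinarith
    have h2 : (u 0 ^ (p - 1))⁻¹ ≤ R ^ 2 / 2 := by
      rw [inv_le_iff_one_le_mul₀ hu0p]
      linarith
    have hR2 : 0 < R ^ 2 := pow_pos hR.1 2
    have h3 := mul_le_mul_of_nonneg_left h1 hR2.le
    nlinarith
  · obtain ⟨X, ⟨hXI, hXb⟩, hXmin⟩ := (isCompact_Icc.of_isClosed_subset hclosed
      inter_subset_left).exists_isLeast hne
    have hX0 : 0 < X := by
      refine hXI.1.lt_of_ne fun h0 => ?_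
      subst h0
      rcases hXb with h1 | h1
      · linarith
      · rw [h.v_zero, Real.zero_rpow hp1.ne'] at h1
        linarith
    obtain ⟨hvX, hE, -⟩ := key X ⟨hX0, hXI.2⟩ fun x hx => by
      by_contra! hcon
      refine hx.2.not_ge (hXmin ⟨⟨hx.1.le, hx.2.le.trans hXI.2⟩, ?_⟩)
      by_cases hux : 0 < u x
      · exact Or.inr (hcon hux)
      · exact Or.inl (not_lt.1 hux)
    refine ⟨X, ⟨hX0, hXI.2⟩, hE.trans ?_⟩
    have hδX : δ ≤ v X ^ (p - 1) := by
      refine hXb.resolve_left fun hle => hvX.not_ge ?_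
      rw [hvu X (hsubR hXI)]
      exact mul_nonpos_of_nonneg_of_nonpos (Real.rpow_nonneg hX0.le _) hle
    have h1 : δ ^ (p - 1)⁻¹ ≤ v X := by
      rwa [Real.rpow_inv_le_iff_of_pos hδ.le hvX.le hp1]
    have h2 : 0 ≤ δ ^ (p - 1)⁻¹ := Real.rpow_nonneg hδ.le _
    gcongr

end ProfileOrbit

/-- The conformally rescaled slope at the endpoint is small if the value at the centre is large. -/
lemma exists_abs_slope_one_le {p α β b ε : ℝ} (hp : 1 < p) (hα : 0 < α) (hαp : α * (p - 1) = 2)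
    (hβ : β = α * (α + 1)) (hb : 0 < b) (hbβ : b ^ (p - 1) = β) (hε : 0 < ε) :
    ∃ A, ∀ v y u : ℝ → ℝ, ProfileOrbit p β b v y → ContinuousOn u (Icc 0 1) →
      (∀ x ∈ Icc (0 : ℝ) 1, v x = x ^ α * u x) → A ≤ u 0 → |y 1| ≤ ε := by
  have hp0 : 0 < p := by linarith
  have hp1 : 0 < p - 1 := by linarith
  have hβ0 : 0 < β := by rw [hβ]; positivity
  obtain ⟨δ, hδ⟩ : ∃ δ, δ = α / (p * (2 + α)) := ⟨_, rfl⟩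
  have hδ0 : 0 < δ := by rw [hδ]; positivity
  have hpδ : p * δ = α / (2 + α) := by rw [hδ]; field_simp
  have hc : 0 < α / 4 * (δ ^ (p - 1)⁻¹) ^ 2 := by
    have := Real.rpow_pos_of_pos hδ0 (p - 1)⁻¹
    positivity
  obtain ⟨m, B, hm, htrap⟩ := ProfileOrbit.exists_trapping hp hb hβ0 hc
  obtain ⟨K, hK0, hK⟩ := exists_abs_deriv_force_le p β B hm
  obtain ⟨r, hr⟩ : ∃ r, r = 1 - 1 / (8 * K + 4) := ⟨_, rfl⟩
  have hr_pos : 0 < 1 / (8 * K + 4) := by positivity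
  have hr_le : 1 / (8 * K + 4) ≤ 1 / 4 := one_div_le_one_div_of_le (by norm_num) (by linarith)
  have hr34 : 3 / 4 ≤ r := by linarith
  have hr1 : r < 1 := by linarith
  have hrK : 8 * K * (1 - r) ≤ 1 := by
    rw [hr, sub_sub_cancel, mul_one_div, div_le_one (by positivity)]
    linarith
  have hr2 : 0 < 1 - r ^ 2 := by nlinarith
  obtain ⟨R, hR, hRE⟩ := ProfileOrbit.exists_energy_le hp hb hbβ hc (by linarith) hr1
    (show 0 < (1 - r ^ 2) * ε ^ 2 / 8 by positivity)
  have hR0 := hR.1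
  refine ⟨(2 / R ^ 2) ^ (p - 1)⁻¹, fun v y u h hu hvu hA => ?_⟩
  have hA0 : 0 < (2 / R ^ 2) ^ (p - 1)⁻¹ := Real.rpow_pos_of_pos (by positivity) _
  have hu0 : 0 < u 0 := hA0.trans_le hA
  rw [Real.rpow_inv_le_iff_of_pos (by positivity) hu0.le hp1, div_le_iff₀ (by positivity)] at hA
  obtain ⟨a, ha, hEa⟩ := h.exists_energy_le_near_zero hp hα hαp hβ hδ0
    (by rw [hpδ]; exact div_le_self hα.le (by linarith))
    (by
      rw [hδ]
      exact div_le_div_of_nonneg_left hα.le two_pos (by nlinarith))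
    (by rw [hpδ, div_le_one (by positivity)]; linarith) ⟨hR0, hR.2.trans hr1⟩ hu hvu hu0 hA
  have har : a ≤ r := ha.2.trans hR.2.le
  have ha01 : a ∈ Icc (0 : ℝ) 1 := ⟨ha.1.le, har.trans hr1.le⟩
  have hvI := htrap v y h a ha01 hEa
  have hslope := h.abs_slope_one_le hb hbβ hm hK0.le hK hr34 hr1 hrK
    fun x hx => hvI x ⟨har.trans hx.1, hx.2⟩
  have hE := hRE v y h a ha hEa
  have hmin := pot_min hp hb hbβ (hm.trans_le (hvI r ⟨har, hr1.le⟩).1).le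
  rw [energy] at hE
  have hy : y r ^ 2 ≤ (ε / 2) ^ 2 := by
    refine le_of_mul_le_mul_left ?_ hr2
    linarith
  have := abs_le_of_sq_le_sq hy (by positivity)
  linarith

/-- The conformal change of variables at the exponent `N - 1 = 2 (α + 1)`. -/
lemma profileOrbit_of_isSolOn {N : ℕ} {p α b P : ℝ} {u : ℝ → ℝ} (hα : 0 < α) (hαp : α * (p - 1) = 2)
    (hαP : alphaP p = α) (hN : (N : ℝ) - 1 = 2 * (α + 1)) (hP : 1 < P)
    (hreg : ContDiffOn ℝ 2 u (Icc 0 P)) (hsol : IsSolOn N p u (Ioo 0 P)) (h1 : u 1 = b) :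
    ProfileOrbit p (α * (α + 1)) b (fun x => x ^ α * u x)
      (fun x => x ^ (α + 1) * derivWithin u (Icc 0 P) x + α * (x ^ α * u x)) := by
  have hsub : Icc (0 : ℝ) 1 ⊆ Icc 0 P := Icc_subset_Icc_right hP.le
  have hu : ContinuousOn u (Icc 0 1) := hreg.continuousOn.mono hsub
  have hdu : ContinuousOn (derivWithin u (Icc 0 P)) (Icc 0 1) :=
    (hreg.continuousOn_derivWithin (uniqueDiffOn_Icc (by linarith)) one_le_two).mono hsub
  have hpow : ∀ γ : ℝ, 0 < γ → ContinuousOn (fun x : ℝ => x ^ γ) (Icc 0 1) := fun γ hγ =>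
    continuousOn_id.rpow_const fun _ _ => Or.inr hγ.le
  have hD : ∀ x ∈ Ioo (0 : ℝ) 1, HasDerivAt u (deriv u x) x ∧
      HasDerivAt (derivWithin u (Icc 0 P)) (deriv (deriv u) x) x ∧
      derivWithin u (Icc 0 P) x = deriv u x := fun x hx => by
    have hxP : x ∈ Ioo 0 P := ⟨hx.1, hx.2.trans hP⟩
    have hreg' : ContDiffOn ℝ 2 u (Ioo 0 P) := hreg.mono Ioo_subset_Icc_self
    have hd1 := (hreg'.differentiableOn (by norm_num)).differentiableAt (isOpen_Ioo.mem_nhds hxP)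
    have hd2 := ((hreg'.deriv_of_isOpen isOpen_Ioo (m := 1) (by norm_num)).differentiableOn
      (by norm_num)).differentiableAt (isOpen_Ioo.mem_nhds hxP)
    refine ⟨hd1.hasDerivAt, hd2.hasDerivAt.congr_of_eventuallyEq ?_,
      derivWithin_of_mem_nhds (Icc_mem_nhds hxP.1 hxP.2)⟩
    filter_upwards [isOpen_Ioo.mem_nhds hxP] with s hs
    exact derivWithin_of_mem_nhds (Icc_mem_nhds hs.1 hs.2)
  refine ⟨(hpow α hα).mul hu, ((hpow _ (by linarith)).mul hdu).add
    (continuousOn_const.mul ((hpow α hα).mul hu)), by simp [Real.zero_rpow hα.ne'],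
    by simp [Real.zero_rpow hα.ne', Real.zero_rpow (show α + 1 ≠ 0 by linarith)], by simp [h1],
    fun x hx => ?_, fun x hx => ?_⟩
  · obtain ⟨hd1, -, hdw⟩ := hD x hx
    refine ((Real.hasDerivAt_rpow_const (p := α) (Or.inl hx.1.ne')).mul hd1).congr_deriv ?_
    have hx0 := hx.1
    simp only [hdw]
    rw [Real.rpow_sub_one hx.1.ne', Real.rpow_add_one hx.1.ne']
    field_simp
    ring
  · obtain ⟨hd1, hd2, hdw⟩ := hD x hx
    refine (((Real.hasDerivAt_rpow_const (p := α + 1) (Or.inl hx.1.ne')).mul hd2).add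
      (((Real.hasDerivAt_rpow_const (p := α) (Or.inl hx.1.ne')).mul hd1).const_mul α)).congr_deriv ?_
    have hx0 := hx.1
    have hx2 : 1 - x ^ 2 ≠ 0 := by nlinarith [hx.2]
    have hode := hsol x ⟨hx.1, hx.2.trans hP⟩
    have hvp : |x ^ α * u x| ^ (p - 1) = x ^ 2 * |u x| ^ (p - 1) := by
      rw [abs_mul, abs_of_pos (Real.rpow_pos_of_pos hx0 _),
        Real.mul_rpow (Real.rpow_nonneg hx0.le _) (abs_nonneg _), ← Real.rpow_mul hx0.le, hαp,
        Real.rpow_two]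
    rw [hαP, hN] at hode
    simp only [hdw, force, hvp]
    rw [add_sub_cancel_right, Real.rpow_sub_one hx.1.ne', Real.rpow_add_one hx.1.ne']
    generalize |u x| ^ (p - 1) = q at hode ⊢
    generalize x ^ α = z
    field_simp at hode ⊢
    linear_combination (z * x) * hode

theorem stmt16 (N : ℕ) (p : ℝ) (hN : 4 ≤ N) (hp : p = 1 + 4 / ((N : ℝ) - 3))
    (ρ : ℕ → ℝ) (u : ℕ → ℝ → ℝ)
    (hρ : ∀ n, 1 < ρ n)
    (hreg : ∀ n, ContDiffOn ℝ 2 (u n) (Icc 0 (ρ n)))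
    (hsol : ∀ n, IsSolOn N p (u n) (Ioo 0 (ρ n)))
    (h0 : Tendsto (fun n => u n 0) atTop atTop)
    (h1 : ∀ n, u n 1 = bInf N p) :
    Tendsto (fun n => deriv (u n) 1) atTop (nhds (-(alphaP p) * bInf N p)) := by
  have hN3 : (0 : ℝ) < (N : ℝ) - 3 := by
    have : (4 : ℝ) ≤ N := by exact_mod_cast hN
    linarith
  have hp1 : 0 < p - 1 := by
    rw [hp, add_sub_cancel_left]
    positivity
  have hαN : alphaP p = ((N : ℝ) - 3) / 2 := by
    rw [alphaP, hp, add_sub_cancel_left]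
    field_simp
    norm_num
  have hα : 0 < alphaP p := by
    rw [hαN]
    positivity
  have hαp : alphaP p * (p - 1) = 2 := div_mul_cancel₀ _ hp1.ne'
  have hN1 : (N : ℝ) - 1 = 2 * (alphaP p + 1) := by
    rw [hαN]
    ring
  have hβ : 0 < alphaP p * (alphaP p + 1) := by positivity
  have hbdef : bInf N p = (alphaP p * (alphaP p + 1)) ^ (alphaP p / 2) := by
    rw [bInf, show (N : ℝ) - 2 - alphaP p = alphaP p + 1 by linarith]
  have hb : 0 < bInf N p := hbdef ▸ Real.rpow_pos_of_pos hβ _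
  have hbβ : bInf N p ^ (p - 1) = alphaP p * (alphaP p + 1) := by
    rw [hbdef, ← Real.rpow_mul hβ.le, div_mul_eq_mul_div, hαp, div_self two_ne_zero, Real.rpow_one]
  rw [Metric.tendsto_nhds]
  intro ε hε
  obtain ⟨A, hA⟩ := exists_abs_slope_one_le (by linarith) hα hαp rfl hb hbβ (half_pos hε)
  filter_upwards [h0.eventually_ge_atTop A] with n hn
  have h := hA _ _ (u n) (profileOrbit_of_isSolOn hα hαp rfl hN1 (hρ n) (hreg n)
    (hsol n) (h1 n)) ((hreg n).continuousOn.mono (Icc_subset_Icc_right (hρ n).le))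
    (fun _ _ => rfl) hn
  rw [derivWithin_of_mem_nhds (Icc_mem_nhds one_pos (hρ n)), Real.one_rpow, Real.one_rpow, one_mul,
    one_mul, h1 n] at h
  rw [Real.dist_eq, neg_mul, sub_neg_eq_add]
  linarith
end

section
/- Assume N ≥ 3 and 1 + 4/(N−2) < p < 1 + 4/(N−3) (for N = 3 this means p > 5). There exists b_* ∈ [0, b_∞) with the following property. For b > 0 let U(ρ) = U(ρ,b) be the C² solution of (PDE) with U(1) = b and let [1, ρ₊) be its forward maximal interval of existence. Then: (i) if b > b₀ then ρ₊ < +∞ and U(ρ) > b₀ for all ρ ∈ (1, ρ₊); (ii) if b_* < b < b₀ then ρ₊ = +∞, 0 < U(ρ) < b₀ and U′(ρ) < 0 for all ρ > 1, and there exists L > 0 such that ρ^α U(ρ) → L and ρ^{α+1} U′(ρ) → −αL as ρ → +∞; moreover in case (ii), if b > b_∞ then L > b, and if b_* < b < b_∞ then L < b. If N = 3 one can take b_* = 0. -/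
open Set Filter

/-- The weighted average of `M` over the segment joining `1` to `x`. -/
noncomputable def avg (c : ℝ) (M : ℝ → ℝ) (x : ℝ) : ℝ :=
  ∫ t in (0 : ℝ)..1, M (1 + t ^ (1 / c) * (x - 1))

lemma rpow_mem_unit {c t : ℝ} (hc : 0 < c) (ht : t ∈ Icc (0 : ℝ) 1) :
    t ^ (1 / c) ∈ Icc (0 : ℝ) 1 :=
  ⟨Real.rpow_nonneg ht.1 _, Real.rpow_le_one ht.1 ht.2 (by positivity)⟩

lemma avg_arg_mem {c t : ℝ} (x : ℝ) (hc : 0 < c) (ht : t ∈ Icc (0 : ℝ) 1) :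
    1 + t ^ (1 / c) * (x - 1) ∈ uIcc 1 x := by
  obtain ⟨h0, h1⟩ := rpow_mem_unit hc ht
  rcases le_total 1 x with h | h
  · rw [uIcc_of_le h]; constructor <;> nlinarith
  · rw [uIcc_of_ge h]; constructor <;> nlinarith

lemma avg_one (c : ℝ) (M : ℝ → ℝ) : avg c M 1 = M 1 := by
  simp [avg]

lemma avg_congr {c x : ℝ} {M M' : ℝ → ℝ} (hc : 0 < c) (h : ∀ r ∈ uIcc 1 x, M r = M' r) :
    avg c M x = avg c M' x := by
  refine intervalIntegral.integral_congr fun t ht => ?_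
  rw [uIcc_of_le zero_le_one] at ht
  exact h _ (avg_arg_mem x hc ht)

lemma uIcc_one_subset {x : ℝ} (hx : 0 < x) : uIcc 1 x ⊆ Ioi 0 := fun _ hr =>
  lt_of_lt_of_le (lt_min one_pos hx) hr.1

lemma avg_integrable {c x : ℝ} {M : ℝ → ℝ} (hc : 0 < c) (hx : 0 < x)
    (hM : ContinuousOn M (Ioi 0)) :
    IntervalIntegrable (fun t : ℝ => M (1 + t ^ (1 / c) * (x - 1))) MeasureTheory.volume 0 1 := by
  apply ContinuousOn.intervalIntegrable
  rw [uIcc_of_le zero_le_one]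
  refine hM.comp ?_ fun t ht => uIcc_one_subset hx (avg_arg_mem x hc ht)
  have : Continuous fun t : ℝ => t ^ (1 / c) := Real.continuous_rpow_const (by positivity)
  fun_prop

lemma abs_avg_sub_le {c x C : ℝ} {M M' : ℝ → ℝ} (hc : 0 < c) (hx : 0 < x)
    (hM : ContinuousOn M (Ioi 0)) (hM' : ContinuousOn M' (Ioi 0))
    (h : ∀ r ∈ uIcc 1 x, |M r - M' r| ≤ C) : |avg c M x - avg c M' x| ≤ C := by
  unfold avg
  rw [← intervalIntegral.integral_sub (avg_integrable hc hx hM) (avg_integrable hc hx hM')]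
  have := intervalIntegral.norm_integral_le_of_norm_le_const (a := (0 : ℝ)) (b := 1) (C := C)
    (f := fun t => M (1 + t ^ (1 / c) * (x - 1)) - M' (1 + t ^ (1 / c) * (x - 1)))
    (fun t ht => by
      rw [uIoc_of_le zero_le_one] at ht
      exact h _ (avg_arg_mem x hc ⟨ht.1.le, ht.2⟩))
  simpa using this

/-- Freezing `M` to the left of a small positive number does not affect `avg` near `x`. -/
lemma avg_eventuallyEq {c x : ℝ} {M : ℝ → ℝ} (hc : 0 < c) (hx : 0 < x)
    (hM : ContinuousOn M (Ioi 0)) : ∃ M' : ℝ → ℝ, Continuous M' ∧ M' =ᶠ[nhds x] M ∧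
      avg c M' =ᶠ[nhds x] avg c M := by
  obtain ⟨e, he0, he⟩ := exists_between (lt_min one_pos hx)
  have he1 := he.trans_le (min_le_left _ _)
  have hex := he.trans_le (min_le_right _ _)
  refine ⟨fun r => M (max r e), ?_, ?_, ?_⟩
  · exact hM.comp_continuous (by fun_prop) fun r => lt_of_lt_of_le he0 (le_max_right _ _)
  · filter_upwards [lt_mem_nhds hex] with z hz
    simp [max_eq_left hz.le]
  · filter_upwards [lt_mem_nhds hex] with z hz
    refine avg_congr hc fun r hr => ?_
    have : e ≤ r := (le_min he1.le hz.le).trans hr.1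
    simp [max_eq_left this]

lemma continuousOn_avg {c : ℝ} {M : ℝ → ℝ} (hc : 0 < c) (hM : ContinuousOn M (Ioi 0)) :
    ContinuousOn (avg c M) (Ioi 0) := by
  intro x hx
  obtain ⟨M', hc', -, h⟩ := avg_eventuallyEq hc hx hM
  refine (ContinuousAt.congr ?_ h).continuousWithinAt
  apply Continuous.continuousAt
  have h2 : Continuous fun t : ℝ => t ^ (1 / c) := Real.continuous_rpow_const (by positivity)
  apply intervalIntegral.continuous_parametric_intervalIntegral_of_continuous'
  fun_prop

lemma hasDerivAt_avg_aux {c x s : ℝ} {M : ℝ → ℝ} (hc : 0 < c) (hM : Continuous M)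
    (hs : s * s = 1) (hx : 0 < s * (x - 1)) :
    HasDerivAt (avg c M) (c * (M x - avg c M x) / (x - 1)) x := by
  have hcont : Continuous fun t : ℝ => M (1 + s * t ^ (1 / c)) := by
    have h2 : Continuous fun t : ℝ => t ^ (1 / c) := Real.continuous_rpow_const (by positivity)
    fun_prop
  set I : ℝ → ℝ := fun h => ∫ t in (0 : ℝ)..h, M (1 + s * t ^ (1 / c)) with hI
  have hrep : ∀ z, 0 < s * (z - 1) → avg c M z = (s * (z - 1)) ^ (-c) * I ((s * (z - 1)) ^ c) := by
    intro z hz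
    have hd : 0 < (s * (z - 1)) ^ c := Real.rpow_pos_of_pos hz _
    have h1 := intervalIntegral.integral_comp_mul_left (a := 0) (b := 1)
      (fun t : ℝ => M (1 + s * t ^ (1 / c))) hd.ne'
    simp only [mul_zero, mul_one, smul_eq_mul] at h1
    rw [Real.rpow_neg hz.le, hI, ← h1]
    refine intervalIntegral.integral_congr fun t ht => ?_
    rw [uIcc_of_le zero_le_one] at ht
    rw [Real.mul_rpow hd.le ht.1, ← Real.rpow_mul hz.le, mul_one_div_cancel hc.ne', Real.rpow_one]
    congr 1
    linear_combination (-(z - 1) * t ^ (1 / c)) * hs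
  have hne : x - 1 ≠ 0 := by rintro h; simp [h] at hx
  have hev : avg c M =ᶠ[nhds x]
      fun z => (s * (z - 1)) ^ (-c) * I ((s * (z - 1)) ^ c) := by
    have : ContinuousAt (fun z => s * (z - 1)) x := by fun_prop
    filter_upwards [this.eventually (lt_mem_nhds hx)] with z hz using hrep z hz
  have hlin : HasDerivAt (fun z => s * (z - 1)) s x := by
    simpa using ((hasDerivAt_id x).sub_const 1).const_mul s
  have hp := hlin.rpow_const (p := c) (Or.inl hx.ne')
  have hn := hlin.rpow_const (p := -c) (Or.inl hx.ne')
  have hFTC : HasDerivAt I (M (1 + s * ((s * (x - 1)) ^ c) ^ (1 / c))) ((s * (x - 1)) ^ c) :=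
    intervalIntegral.integral_hasDerivAt_right (hcont.intervalIntegrable _ _)
      (hcont.stronglyMeasurableAtFilter _ _) hcont.continuousAt
  have hcomp := hn.mul (hFTC.comp x hp)
  refine (hcomp.congr_of_eventuallyEq hev).congr_deriv ?_
  rw [hrep x hx, ← Real.rpow_mul hx.le, mul_one_div_cancel hc.ne', Real.rpow_one]
  have e1 : 1 + s * (s * (x - 1)) = x := by linear_combination (x - 1) * hs
  rw [e1, Real.rpow_sub hx, Real.rpow_sub hx, Real.rpow_one, Real.rpow_neg hx.le]
  have hd : (s * (x - 1)) ^ c ≠ 0 := (Real.rpow_pos_of_pos hx _).ne'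
  have hs0 : s ≠ 0 := by rintro h; simp [h] at hs
  simp only [Function.comp]
  field_simp
  ring

lemma hasDerivAt_avg {c x : ℝ} {M : ℝ → ℝ} (hc : 0 < c) (hM : ContinuousOn M (Ioi 0))
    (hx : 0 < x) (hx1 : x ≠ 1) :
    HasDerivAt (avg c M) (c * (M x - avg c M x) / (x - 1)) x := by
  obtain ⟨M', hc', h1, h2⟩ := avg_eventuallyEq hc hx hM
  rw [← h1.eq_of_nhds, ← h2.eq_of_nhds]
  refine HasDerivAt.congr_of_eventuallyEq ?_ h2.symm
  rcases lt_or_gt_of_ne hx1 with h | h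
  · exact hasDerivAt_avg_aux (s := -1) hc hc' (by norm_num) (by linarith)
  · exact hasDerivAt_avg_aux (s := 1) hc hc' (by norm_num) (by linarith)

lemma hasDerivAt_avg_one {c m : ℝ} {M : ℝ → ℝ} (hc : 0 < c) (hM : ContinuousOn M (Ioi 0))
    (hm : HasDerivAt M m 1) : HasDerivAt (avg c M) (m * c / (1 + c)) 1 := by
  rw [hasDerivAt_iff_isLittleO, Asymptotics.isLittleO_iff] at hm ⊢
  intro e he
  obtain ⟨d, hd, hd'⟩ := Metric.eventually_nhds_iff.1 (hm he)
  filter_upwards [Metric.ball_mem_nhds (1 : ℝ) hd, lt_mem_nhds (zero_lt_one' ℝ)] with x hx hx0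
  have hlin : avg c (fun r => M 1 + (r - 1) * m) x = M 1 + (x - 1) * (m * c / (1 + c)) := by
    have hp : -1 < 1 / c := by have : 0 < 1 / c := by positivity
                               linarith
    have hi : IntervalIntegrable (fun t : ℝ => t ^ (1 / c)) MeasureTheory.volume 0 1 :=
      intervalIntegral.intervalIntegrable_rpow' hp
    have : avg c (fun r => M 1 + (r - 1) * m) x
        = ∫ t in (0 : ℝ)..1, (M 1 + ((x - 1) * m) * t ^ (1 / c)) := by
      refine intervalIntegral.integral_congr fun t _ => ?_
      simp only; ring
    rw [this, intervalIntegral.integral_add (by simp) (hi.const_mul _),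
      intervalIntegral.integral_const_mul, integral_rpow (Or.inl hp)]
    have h1 : (1 / c + 1) ≠ 0 := by positivity
    rw [Real.one_rpow, Real.zero_rpow h1]
    simp
    field_simp
  have hb := abs_avg_sub_le (C := e * |x - 1|) hc hx0 hM
    (M' := fun r => M 1 + (r - 1) * m) (by fun_prop) (fun r hr => by
      have hr' : |r - 1| ≤ |x - 1| := by
        have := abs_sub_left_of_mem_uIcc hr
        exact this
      have := @hd' r (by
        rw [Real.dist_eq]
        rw [Metric.mem_ball, Real.dist_eq] at hx
        exact hr'.trans_lt hx)
      simp only [smul_eq_mul, Real.norm_eq_abs] at this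
      rw [← sub_sub]
      exact this.trans (mul_le_mul_of_nonneg_left hr' he.le))
  rw [hlin, ← sub_sub] at hb
  simpa [avg_one] using hb

/-- If `M` is differentiable at `1` then `avg c M` is `C¹` on `(0, ∞)`. -/
lemma exists_deriv_avg {c m : ℝ} {M : ℝ → ℝ} (hc : 0 < c) (hM : ContinuousOn M (Ioi 0))
    (hm : HasDerivAt M m 1) : ∃ D : ℝ → ℝ, ContinuousOn D (Ioi 0) ∧
      ∀ x, 0 < x → HasDerivAt (avg c M) (D x) x := by
  set q : ℝ → ℝ := fun x => M x - avg c M x with hq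
  have hq' : HasDerivAt q (m - m * c / (1 + c)) 1 := hm.sub (hasDerivAt_avg_one hc hM hm)
  have hqc : ContinuousOn q (Ioi 0) := hM.sub (continuousOn_avg hc hM)
  refine ⟨fun x => c * dslope q 1 x, ?_, ?_⟩
  · apply ContinuousOn.const_mul
    rw [continuousOn_dslope (Ioi_mem_nhds one_pos)]
    exact ⟨hqc, hq'.differentiableAt⟩
  · intro x hx
    by_cases h1 : x = 1
    · subst h1
      refine (hasDerivAt_avg_one hc hM hm).congr_deriv ?_
      simp only
      rw [dslope_same, hq'.deriv]
      field_simp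
      ring
    · refine (hasDerivAt_avg hc hM hx h1).congr_deriv ?_
      simp only
      rw [dslope_of_ne _ h1, slope_def_field]
      have : q 1 = 0 := by simp [hq, avg_one]
      rw [this, sub_zero, mul_div_assoc]

lemma abs_mul_abs_avg_sub_le {c x A C : ℝ} {M M' : ℝ → ℝ} (hc : 0 < c) (hx : 0 < x)
    (hM : ContinuousOn M (Ioi 0)) (hM' : ContinuousOn M' (Ioi 0))
    (h : ∀ r ∈ uIcc 1 x, |A| * |M r - M' r| ≤ C) : |A| * |avg c M x - avg c M' x| ≤ C := by
  have hs : ∀ M : ℝ → ℝ, avg c (fun r => A * M r) x = A * avg c M x := fun M => by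
    simp [avg, intervalIntegral.integral_const_mul]
  have := abs_avg_sub_le (C := C) hc hx (hM.const_mul A) (hM'.const_mul A) (fun r hr => by
    rw [← mul_sub, abs_mul]; exact h r hr)
  rwa [hs, hs, ← mul_sub, abs_mul] at this

lemma hasDerivAt_integral_one {g : ℝ → ℝ} (hg : ContinuousOn g (Ioi 0)) {x : ℝ} (hx : 0 < x) :
    HasDerivAt (fun z => ∫ t in (1 : ℝ)..z, g t) (g x) x := by
  refine intervalIntegral.integral_hasDerivAt_right
    ((hg.mono (uIcc_one_subset hx)).intervalIntegrable) ?_ (hg.continuousAt (Ioi_mem_nhds hx))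
  exact hg.stronglyMeasurableAtFilter isOpen_Ioi x hx

/-- Global solvability of the singular Volterra equation `v' = a · avg (F(·, v))`, `v 1 = b`. -/
theorem exists_avg_solution {c b : ℝ} (hc : 0 < c) {a k : ℝ → ℝ} {F : ℝ → ℝ → ℝ}
    (ha : ContinuousOn a (Ioi 0)) (hk : ContinuousOn k (Ioi 0))
    (hF : ∀ v, ContinuousOn v (Ioi 0) → ContinuousOn (fun r => F r (v r)) (Ioi 0))
    (hLip : ∀ t, 0 < t → ∀ r ∈ uIcc 1 t, ∀ x y, |a t| * |F r x - F r y| ≤ k t * |x - y|)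
    (hb : ∀ t, 0 < t → ∀ r ∈ uIcc 1 t, |a t| * |F r b| ≤ k t) :
    ∃ v : ℝ → ℝ, v 1 = b ∧
      ∀ x, 0 < x → HasDerivAt v (a x * avg c (fun r => F r (v r)) x) x := by
  have hk0 : ∀ t, 0 < t → 0 ≤ k t := fun t ht =>
    (mul_nonneg (abs_nonneg _) (abs_nonneg _)).trans (hb t ht 1 left_mem_uIcc)
  set Φ : ℝ → ℝ := fun x => ∫ t in (1 : ℝ)..x, 2 * k t with hΦ
  have hΦd : ∀ x, 0 < x → HasDerivAt Φ (2 * k x) x := fun x hx =>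
    hasDerivAt_integral_one (hk.const_mul 2) hx
  have hΦc : ContinuousOn Φ (Ioi 0) := fun x hx => (hΦd x hx).continuousAt.continuousWithinAt
  set W : ℝ → ℝ := fun x => Real.cosh (Φ x) with hW
  have hWc : ContinuousOn W (Ioi 0) := Real.continuous_cosh.comp_continuousOn hΦc
  have hW0 : ∀ x, 0 < W x := fun x => Real.cosh_pos _
  have hΦmono : ∀ x y, 0 < x → x ≤ y → Φ x ≤ Φ y := by
    intro x y hx hxy
    have hm : MonotoneOn Φ (Ioi 0) := by
      refine monotoneOn_of_deriv_nonneg (convex_Ioi 0) hΦc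
        (fun z hz => ?_) (fun z hz => ?_) <;> rw [interior_Ioi] at hz
      · exact (hΦd z hz).differentiableAt.differentiableWithinAt
      · rw [(hΦd z hz).deriv]; have := hk0 z hz; positivity
    exact hm hx (hx.trans_le hxy) hxy
  have hΦ1 : Φ 1 = 0 := by simp [hΦ]
  have hWmono : ∀ t, 0 < t → ∀ r ∈ uIcc 1 t, W r ≤ W t := by
    intro t ht r hr
    rw [hW, Real.cosh_le_cosh]
    rcases le_total 1 t with h | h
    · rw [uIcc_of_le h] at hr
      have h1 := hΦmono 1 r one_pos hr.1
      have h2 := hΦmono r t (one_pos.trans_le hr.1) hr.2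
      rw [hΦ1] at h1
      rw [abs_of_nonneg h1, abs_of_nonneg (h1.trans h2)]; exact h2
    · rw [uIcc_of_ge h] at hr
      have h1 := hΦmono r 1 (ht.trans_le hr.1) hr.2
      have h2 := hΦmono t r ht hr.1
      rw [hΦ1] at h1
      rw [abs_of_nonpos h1, abs_of_nonpos (h2.trans h1)]; linarith
  have hint : ∀ (D : ℝ) (P : ℝ → ℝ) (x : ℝ), 0 < x → ContinuousOn P (Ioi 0) →
      (∀ t, 0 < t → |P t| ≤ k t * (W t * D)) → 0 ≤ D →
      |∫ t in (1 : ℝ)..x, P t| ≤ D / 2 * W x := by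
    intro D P x hx hP hPb hD
    have hc2 : ContinuousOn (fun t => k t * (W t * D)) (Ioi 0) := hk.mul (hWc.mul_const D)
    have h1 : |∫ t in (1 : ℝ)..x, P t| ≤ |∫ t in (1 : ℝ)..x, k t * (W t * D)| := by
      rw [← Real.norm_eq_abs (∫ t in (1 : ℝ)..x, P t)]
      apply intervalIntegral.norm_integral_le_abs_of_norm_le
      · refine (MeasureTheory.ae_restrict_iff' measurableSet_uIoc).2 (Eventually.of_forall ?_)
        intro t ht
        exact hPb t (uIcc_one_subset hx (uIoc_subset_uIcc ht))
      · exact (hc2.mono (uIcc_one_subset hx)).intervalIntegrable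
    have h2 : ∫ t in (1 : ℝ)..x, k t * (W t * D) = D / 2 * Real.sinh (Φ x) := by
      have := intervalIntegral.integral_eq_sub_of_hasDerivAt (a := 1) (b := x)
        (f := fun t => D / 2 * Real.sinh (Φ t)) (f' := fun t => k t * (W t * D))
        (fun t ht => by
          refine ((hΦd t (uIcc_one_subset hx ht)).sinh.const_mul (D / 2)).congr_deriv ?_
          simp only [hW]; ring)
        ((hc2.mono (uIcc_one_subset hx)).intervalIntegrable)
      simpa [hΦ1] using this
    rw [h2, abs_mul, abs_of_nonneg (by positivity : 0 ≤ D / 2)] at h1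
    refine h1.trans (mul_le_mul_of_nonneg_left ?_ (by positivity))
    rw [abs_le]
    constructor
    · have := Real.sinh_lt_cosh (-Φ x)
      rw [Real.sinh_neg, Real.cosh_neg] at this
      simp only [hW]; linarith
    · exact (Real.sinh_lt_cosh _).le
  set V : BoundedContinuousFunction ℝ ℝ → ℝ → ℝ := fun φ x => b + W x * φ (Real.log x) with hV
  have hVc : ∀ φ, ContinuousOn (V φ) (Ioi 0) := fun φ =>
    continuousOn_const.add (hWc.mul (φ.continuous.comp_continuousOn
      (Real.continuousOn_log.mono fun x hx => (ne_of_gt hx : x ≠ 0))))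
  set P : BoundedContinuousFunction ℝ ℝ → ℝ → ℝ :=
    fun φ x => a x * avg c (fun r => F r (V φ r)) x with hP
  have hPc : ∀ φ, ContinuousOn (P φ) (Ioi 0) := fun φ =>
    ha.mul (continuousOn_avg hc (hF _ (hVc φ)))
  have hPsub : ∀ φ ψ t, 0 < t → |P φ t - P ψ t| ≤ k t * (W t * dist φ ψ) := by
    intro φ ψ t ht
    simp only [hP]
    rw [← mul_sub, abs_mul]
    refine abs_mul_abs_avg_sub_le hc ht (hF _ (hVc φ)) (hF _ (hVc ψ)) fun r hr => ?_
    refine (hLip t ht r hr _ _).trans (mul_le_mul_of_nonneg_left ?_ (hk0 t ht))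
    simp only [hV]
    rw [add_sub_add_left_eq_sub, ← mul_sub, abs_mul, abs_of_pos (hW0 r)]
    have hd := BoundedContinuousFunction.dist_coe_le_dist (f := φ) (g := ψ) (Real.log r)
    rw [Real.dist_eq] at hd
    exact mul_le_mul (hWmono t ht r hr) hd (abs_nonneg _) (hW0 t).le
  have hPb : ∀ φ t, 0 < t → |P φ t| ≤ k t * (W t * (1 + dist φ 0)) := by
    intro φ t ht
    have h1 := hPsub φ 0 t ht
    have h2 : |P 0 t| ≤ k t := by
      have := abs_mul_abs_avg_sub_le (c := c) (A := a t) (C := k t) (M := fun r => F r (V 0 r))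
        (M' := fun _ => 0) hc ht (hF _ (hVc 0)) continuousOn_const (fun r hr => by
          simpa [hV] using hb t ht r hr)
      have h0 : avg c (fun _ => (0 : ℝ)) t = 0 := by simp [avg]
      rw [h0, sub_zero, ← abs_mul] at this
      exact this
    have h3 : k t ≤ k t * W t := le_mul_of_one_le_right (hk0 t ht) (Real.one_le_cosh _)
    have h4 : |P φ t| ≤ |P φ t - P 0 t| + |P 0 t| := by
      have := abs_add_le (P φ t - P 0 t) (P 0 t)
      simpa using this
    nlinarith
  have hTc : ∀ φ, Continuous fun s => (∫ t in (1 : ℝ)..Real.exp s, P φ t) / W (Real.exp s) := by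
    intro φ
    have hI : ContinuousOn (fun z => ∫ t in (1 : ℝ)..z, P φ t) (Ioi 0) := fun x hx =>
      (hasDerivAt_integral_one (hPc φ) hx).continuousAt.continuousWithinAt
    have h := hI.div hWc fun x _ => (hW0 x).ne'
    exact h.comp_continuous Real.continuous_exp fun s => Real.exp_pos s
  set T : BoundedContinuousFunction ℝ ℝ → BoundedContinuousFunction ℝ ℝ := fun φ =>
    BoundedContinuousFunction.ofNormedAddCommGroup _ (hTc φ) ((1 + dist φ 0) / 2) (fun s => by
      rw [Real.norm_eq_abs, abs_div, abs_of_pos (hW0 _), div_le_iff₀ (hW0 _)]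
      exact hint _ _ _ (Real.exp_pos s) (hPc φ) (hPb φ) (by positivity)) with hT
  have hcontr : ContractingWith (1 / 2) T := by
    refine ⟨by rw [← NNReal.coe_lt_coe]; norm_num, LipschitzWith.of_dist_le_mul fun φ ψ => ?_⟩
    rw [BoundedContinuousFunction.dist_le (by positivity)]
    intro s
    have hs := Real.exp_pos s
    have hi : ∀ φ, IntervalIntegrable (P φ) MeasureTheory.volume 1 (Real.exp s) := fun φ =>
      ((hPc φ).mono (uIcc_one_subset hs)).intervalIntegrable
    simp only [hT, BoundedContinuousFunction.coe_ofNormedAddCommGroup]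
    rw [Real.dist_eq, ← sub_div, ← intervalIntegral.integral_sub (hi φ) (hi ψ), abs_div,
      abs_of_pos (hW0 _), div_le_iff₀ (hW0 _)]
    have := hint (dist φ ψ) (fun t => P φ t - P ψ t) _ hs ((hPc φ).sub (hPc ψ)) (hPsub φ ψ)
      dist_nonneg
    refine this.trans (le_of_eq ?_)
    push_cast
    ring
  obtain ⟨φ, hφ⟩ : ∃ φ, T φ = φ := ⟨_, hcontr.fixedPoint_isFixedPt⟩
  have hrep : ∀ x, 0 < x → V φ x = b + ∫ t in (1 : ℝ)..x, P φ t := by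
    intro x hx
    have h1 : T φ (Real.log x) = φ (Real.log x) := by rw [hφ]
    simp only [hT, BoundedContinuousFunction.coe_ofNormedAddCommGroup, Real.exp_log hx] at h1
    simp only [hV]
    rw [← h1, mul_div_cancel₀ _ (hW0 x).ne']
  refine ⟨V φ, by rw [hrep 1 one_pos]; simp, fun x hx => ?_⟩
  refine ((hasDerivAt_integral_one (hPc φ) hx).const_add b).congr_of_eventuallyEq ?_
  filter_upwards [Ioi_mem_nhds hx] with z hz using hrep z hz

/-! ### The profile equation in self-similar variables -/

/-- The nonlinearity `|v|^{p-1} v - β v`. -/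
noncomputable def nl (p β v : ℝ) : ℝ := |v| ^ (p - 1) * v - β * v

lemma nl_of_pos {p β v : ℝ} (hv : 0 < v) : nl p β v = v * (v ^ (p - 1) - β) := by
  rw [nl, abs_of_pos hv]; ring

lemma hasDerivAt_abs_rpow_mul {p : ℝ} (hp : 1 < p) (v : ℝ) :
    HasDerivAt (fun v : ℝ => |v| ^ (p - 1) * v) (p * |v| ^ (p - 1)) v := by
  rcases lt_trichotomy v 0 with h | h | h
  · have h1 : HasDerivAt (fun v : ℝ => (-v) ^ (p - 1) * v) (p * |v| ^ (p - 1)) v := by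
      have := ((hasDerivAt_id v).neg.rpow_const (p := p - 1) (Or.inl (by simpa using h.ne))).mul
        (hasDerivAt_id v)
      refine this.congr_deriv ?_
      have hv : 0 < -v := by linarith
      have hv0 : v ≠ 0 := h.ne
      simp only [id, Pi.neg_apply]
      rw [abs_of_neg h, Real.rpow_sub_one hv.ne' (p - 1), div_neg]
      field_simp
      ring
    refine h1.congr_of_eventuallyEq ?_
    filter_upwards [gt_mem_nhds h] with z hz
    rw [abs_of_neg hz]
  · subst h
    have h1 : Tendsto (fun t : ℝ => |t| ^ (p - 1)) (nhds 0) (nhds 0) := by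
      have : Continuous fun t : ℝ => |t| ^ (p - 1) :=
        (Real.continuous_rpow_const (by linarith)).comp continuous_abs
      have h2 := this.tendsto 0
      rwa [abs_zero, Real.zero_rpow (by linarith)] at h2
    rw [abs_zero, Real.zero_rpow (by linarith), mul_zero, hasDerivAt_iff_tendsto_slope]
    refine (h1.mono_left nhdsWithin_le_nhds).congr' ?_
    filter_upwards [self_mem_nhdsWithin] with z hz
    rw [slope_def_field]
    have : z ≠ 0 := hz
    field_simp
    simp
  · have h1 : HasDerivAt (fun v : ℝ => v ^ (p - 1) * v) (p * |v| ^ (p - 1)) v := by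
      refine ((hasDerivAt_id v).rpow_const (p := p - 1) (Or.inl h.ne')).mul
        (hasDerivAt_id v) |>.congr_deriv ?_
      simp only [id]
      rw [abs_of_pos h, Real.rpow_sub_one h.ne' (p - 1)]
      field_simp
      ring
    refine h1.congr_of_eventuallyEq ?_
    filter_upwards [lt_mem_nhds h] with z hz
    rw [abs_of_pos hz]

lemma hasDerivAt_nl {p : ℝ} (hp : 1 < p) (β v : ℝ) :
    HasDerivAt (nl p β) (p * |v| ^ (p - 1) - β) v := by
  have h := (hasDerivAt_abs_rpow_mul hp v).sub ((hasDerivAt_id v).const_mul β)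
  exact h.congr_deriv (by ring)

lemma continuous_nl {p : ℝ} (hp : 1 < p) (β : ℝ) : Continuous (nl p β) :=
  continuous_iff_continuousAt.2 fun v => (hasDerivAt_nl hp β v).continuousAt

lemma abs_nl_sub_le {p β R x y : ℝ} (hp : 1 < p) (hβ : 0 ≤ β) (hx : x ∈ Icc (-R) R)
    (hy : y ∈ Icc (-R) R) : |nl p β x - nl p β y| ≤ (β + p * R ^ (p - 1)) * |x - y| := by
  refine (convex_Icc (-R) R).norm_image_sub_le_of_norm_hasDerivWithin_le
    (fun v _ => (hasDerivAt_nl hp β v).hasDerivWithinAt) (fun v hv => ?_) hy hx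
  have h1 : |v| ^ (p - 1) ≤ R ^ (p - 1) :=
    Real.rpow_le_rpow (abs_nonneg _) (abs_le.2 hv) (by linarith)
  have h2 : 0 ≤ |v| ^ (p - 1) := Real.rpow_nonneg (abs_nonneg _) _
  rw [Real.norm_eq_abs, abs_le]
  constructor <;> nlinarith

/-- `v(x)`, `y = 2 x v'` and `D = y'` solve the profile equation, in the variable `x = ρ²` and for
`v = ρ^α U`, wherever `|v| ≤ B`. -/
structure IsProfile (γ β p b : ℝ) (B v y D : ℝ → ℝ) : Prop where
  v_one : v 1 = b
  hv : ∀ x, 0 < x → HasDerivAt v (y x / (2 * x)) x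
  hy : ∀ x, 0 < x → HasDerivAt y (D x) x
  hD : ContinuousOn D (Ioi 0)
  eq : ∀ x, 0 < x → |v x| ≤ B x → 2 * x * (x - 1) * D x + (x - γ) * y x = nl p β (v x)

/-- Truncation to `[-R, R]`. -/
noncomputable def clamp (R x : ℝ) : ℝ := max (-R) (min x R)

lemma clamp_mem {R : ℝ} (hR : 0 ≤ R) (x : ℝ) : clamp R x ∈ Icc (-R) R :=
  ⟨le_max_left _ _, max_le (by linarith) (min_le_right _ _)⟩

lemma clamp_eq {R x : ℝ} (h : |x| ≤ R) : clamp R x = x := by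
  rw [abs_le] at h
  rw [clamp, min_eq_left h.2, max_eq_right h.1]

lemma abs_clamp_sub_le (R x y : ℝ) : |clamp R x - clamp R y| ≤ |x - y| := by
  have h : LipschitzWith 1 (clamp R) := (LipschitzWith.id.min_const R).const_max (-R)
  simpa [Real.dist_eq] using h.dist_le_mul x y

/-- The truncation level. -/
noncomputable def level (R q x : ℝ) : ℝ := R * (x + 1 / x) ^ q

lemma add_inv_mono {r t : ℝ} (ht : 0 < t) (hr : r ∈ uIcc 1 t) : r + 1 / r ≤ t + 1 / t := by
  have hr0 := uIcc_one_subset ht hr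
  have hr0' : 0 < r := hr0
  have key : 0 ≤ (t - r) * (r * t - 1) := by
    rcases le_total 1 t with h | h
    · rw [uIcc_of_le h] at hr
      have : 1 ≤ r * t := by nlinarith [hr.1]
      exact mul_nonneg (by linarith [hr.2]) (by linarith)
    · rw [uIcc_of_ge h] at hr
      have : r * t ≤ 1 := by nlinarith [hr.2]
      exact mul_nonneg_of_nonpos_of_nonpos (by linarith [hr.1]) (by linarith)
  have : t + 1 / t - (r + 1 / r) = (t - r) * (r * t - 1) / (r * t) := by
    field_simp; ring
  have h2 : 0 ≤ (t - r) * (r * t - 1) / (r * t) := div_nonneg key (by positivity)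
  linarith

lemma one_le_add_inv {t : ℝ} (ht : 0 < t) : 1 ≤ t + 1 / t := by
  have := add_inv_mono ht (left_mem_uIcc (a := 1) (b := t))
  norm_num at this
  simp
  linarith

lemma level_mono {R q r t : ℝ} (hR : 0 ≤ R) (hq : 0 ≤ q) (ht : 0 < t) (hr : r ∈ uIcc 1 t) :
    level R q r ≤ level R q t := by
  have hr0 : 0 < r := uIcc_one_subset ht hr
  exact mul_le_mul_of_nonneg_left
    (Real.rpow_le_rpow (by positivity) (add_inv_mono ht hr) hq) hR

lemma le_level {R q x : ℝ} (hR : 0 ≤ R) (hq : 0 ≤ q) (hx : 0 < x) : R ≤ level R q x :=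
  le_mul_of_one_le_right hR (Real.one_le_rpow (one_le_add_inv hx) hq)

lemma continuousOn_level (R q : ℝ) : ContinuousOn (level R q) (Ioi 0) := by
  have h : ContinuousOn (fun x : ℝ => x + 1 / x) (Ioi 0) :=
    continuousOn_id.add (continuousOn_const.div continuousOn_id fun x hx => (ne_of_gt hx : x ≠ 0))
  refine continuousOn_const.mul (h.rpow_const fun x hx => Or.inl ?_)
  have := one_le_add_inv hx
  linarith

theorem exists_profile {γ β p b R q : ℝ} (hγ0 : 0 < γ) (hγ1 : γ < 1) (hβ : 0 < β) (hp : 1 < p)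
    (hb : 0 < b) (hR : b < R) (hq : 0 ≤ q) :
    ∃ v y D : ℝ → ℝ, IsProfile γ β p b (level R q) v y D := by
  set c : ℝ := (1 - γ) / 2 with hc_def
  have hc : 0 < c := by rw [hc_def]; linarith
  have hR0 : 0 < R := hb.trans hR
  set a : ℝ → ℝ := fun t => t ^ (-γ / 2 - 1) / (4 * c) with ha
  set F : ℝ → ℝ → ℝ := fun r x => r ^ (γ / 2 - 1) * nl p β (clamp (level R q r) x) with hF
  set k : ℝ → ℝ := fun t => (t + 1 / t) ^ 2 / (4 * c) *
    ((t + 1 / t) * ((β + p * level R q t ^ (p - 1)) * (1 + b))) with hk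
  have hlev : ∀ x, 0 < x → 0 < level R q x := fun x hx => hR0.trans_le (le_level hR0.le hq hx)
  have hpow : ∀ s : ℝ, ContinuousOn (fun t : ℝ => t ^ s) (Ioi 0) := fun s =>
    continuousOn_id.rpow_const fun x hx => Or.inl (ne_of_gt hx)
  have hFc : ∀ v, ContinuousOn v (Ioi 0) → ContinuousOn (fun r => F r (v r)) (Ioi 0) := by
    intro v hv
    have hl := continuousOn_level R q
    have hcl : Continuous fun z : ℝ × ℝ => clamp z.1 z.2 := by unfold clamp; fun_prop
    exact (hpow _).mul ((continuous_nl hp β).comp_continuousOn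
      (hcl.comp_continuousOn (hl.prodMk hv)))
  have ha_le : ∀ t, 0 < t → |a t| ≤ (t + 1 / t) ^ 2 / (4 * c) := by
    intro t ht
    have h1 : |a t| = (1 / t) ^ (γ / 2 + 1) / (4 * c) := by
      rw [ha]
      simp only
      rw [abs_of_nonneg (by positivity), one_div, Real.inv_rpow ht.le, ← Real.rpow_neg ht.le]
      congr 2; ring
    rw [h1]
    have h2 : (1 / t) ^ (γ / 2 + 1) ≤ (t + 1 / t) ^ (γ / 2 + 1) :=
      Real.rpow_le_rpow (by positivity) (by linarith) (by linarith)
    have h3 : (t + 1 / t) ^ (γ / 2 + 1) ≤ (t + 1 / t) ^ (2 : ℝ) :=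
      Real.rpow_le_rpow_of_exponent_le (one_le_add_inv ht) (by linarith)
    rw [Real.rpow_two] at h3
    gcongr
    exact h2.trans h3
  have hr_le : ∀ t : ℝ, 0 < t → ∀ r : ℝ, r ∈ uIcc 1 t → |r ^ (γ / 2 - 1)| ≤ t + 1 / t := by
    intro t ht r hr
    have hr0 : 0 < r := uIcc_one_subset ht hr
    refine le_trans ?_ (add_inv_mono ht hr)
    have h1 : |r ^ (γ / 2 - 1)| = (1 / r) ^ (1 - γ / 2) := by
      rw [abs_of_nonneg (by positivity), one_div, Real.inv_rpow hr0.le, ← Real.rpow_neg hr0.le]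
      congr 1; ring
    rw [h1]
    have h2 : (1 / r) ^ (1 - γ / 2) ≤ (r + 1 / r) ^ (1 - γ / 2) :=
      Real.rpow_le_rpow (by positivity) (by linarith) (by linarith)
    have h3 : (r + 1 / r) ^ (1 - γ / 2) ≤ (r + 1 / r) ^ (1 : ℝ) :=
      Real.rpow_le_rpow_of_exponent_le (one_le_add_inv hr0) (by linarith)
    rw [Real.rpow_one] at h3
    exact h2.trans h3
  have hnl : ∀ t, 0 < t → ∀ r ∈ uIcc 1 t, ∀ x y,
      |nl p β (clamp (level R q r) x) - nl p β (clamp (level R q r) y)| ≤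
        (β + p * level R q t ^ (p - 1)) * |x - y| := by
    intro t ht r hr x y
    have hr0 : 0 < r := uIcc_one_subset ht hr
    have hl := hlev r hr0
    refine (abs_nl_sub_le hp hβ.le (clamp_mem hl.le x) (clamp_mem hl.le y)).trans ?_
    have h1 := level_mono hR0.le hq ht hr
    have h2 : level R q r ^ (p - 1) ≤ level R q t ^ (p - 1) :=
      Real.rpow_le_rpow hl.le h1 (by linarith)
    have h3 : 0 ≤ level R q r ^ (p - 1) := by positivity
    have h4 := abs_clamp_sub_le (level R q r) x y
    have h5 : 0 ≤ level R q t ^ (p - 1) := h3.trans h2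
    gcongr
  have hk1 : ∀ t, 0 < t → 0 ≤ β + p * level R q t ^ (p - 1) := by
    intro t ht
    have := hlev t ht
    positivity
  have hw : ∀ t : ℝ, 0 < t → 0 ≤ t + 1 / t := fun t ht => by positivity
  have hFb : ∀ t : ℝ, 0 < t → ∀ r : ℝ, r ∈ uIcc 1 t → ∀ z Z : ℝ, |z| ≤ (β + p * level R q t ^ (p - 1)) * Z →
      0 ≤ Z → |a t| * |r ^ (γ / 2 - 1) * z| ≤ (t + 1 / t) ^ 2 / (4 * c) *
        ((t + 1 / t) * ((β + p * level R q t ^ (p - 1)) * Z)) := by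
    intro t ht r hr z Z hz hZ
    have h1 := ha_le t ht
    have h2 := hr_le t ht r hr
    have h3 := hw t ht
    rw [abs_mul]
    gcongr
  obtain ⟨v, hv1, hv⟩ := exists_avg_solution (b := b) hc (a := a) (k := k) (F := F)
    ((hpow _).div_const _)
    (by
      have hl := continuousOn_level R q
      have h : ContinuousOn (fun x : ℝ => x + 1 / x) (Ioi 0) :=
        continuousOn_id.add
          (continuousOn_const.div continuousOn_id fun x hx => (ne_of_gt hx : x ≠ 0))
      exact ((h.pow 2).div_const _).mul (h.mul ((continuousOn_const.add
        (continuousOn_const.mul (hl.rpow_const fun x hx => Or.inl (hlev x hx).ne'))).mul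
          continuousOn_const)))
    hFc
    (by
      intro t ht r hr x y
      have h1 := hFb t ht r hr _ |x - y| (hnl t ht r hr x y) (abs_nonneg _)
      rw [mul_sub] at h1
      refine h1.trans ?_
      have h2 := hk1 t ht
      have h3 := hw t ht
      have h4 : |x - y| ≤ (1 + b) * |x - y| := by nlinarith [abs_nonneg (x - y)]
      rw [hk]
      simp only
      calc _ ≤ (t + 1 / t) ^ 2 / (4 * c) * ((t + 1 / t) *
            ((β + p * level R q t ^ (p - 1)) * ((1 + b) * |x - y|))) := by gcongr
        _ = _ := by ring)
    (by
      intro t ht r hr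
      have h0 : |nl p β (clamp (level R q r) b)| ≤ (β + p * level R q t ^ (p - 1)) * (1 + b) := by
        have := hnl t ht r hr b 0
        have hr0 : 0 < r := uIcc_one_subset ht hr
        rw [clamp_eq (x := 0) (by simpa using (hlev r hr0).le)] at this
        simp only [nl, mul_zero, sub_zero, abs_of_pos hb] at this
        refine this.trans (mul_le_mul_of_nonneg_left (by linarith) (hk1 t ht))
      exact hFb t ht r hr _ _ h0 (by linarith))
  set M : ℝ → ℝ := fun r => F r (v r) with hM
  have hvc : ContinuousOn v (Ioi 0) := fun x hx => (hv x hx).continuousAt.continuousWithinAt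
  have hMc : ContinuousOn M (Ioi 0) := hFc v hvc
  have hMd : ∃ m, HasDerivAt M m 1 := by
    have h1 := (Real.hasDerivAt_rpow_const (x := 1) (p := γ / 2 - 1) (Or.inl one_ne_zero)).mul
      ((hasDerivAt_nl hp β (v 1)).comp 1 (hv 1 one_pos))
    refine ⟨_, h1.congr_of_eventuallyEq ?_⟩
    have hl1 : |v 1| < level R q 1 := by
      rw [hv1, abs_of_pos hb]; exact hR.trans_le (le_level hR0.le hq one_pos)
    have hc1 := (hv 1 one_pos).continuousAt.abs
    have hc2 := (continuousOn_level R q).continuousAt (Ioi_mem_nhds one_pos)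
    filter_upwards [hc1.eventually_lt hc2 hl1] with z hz
    simp only [hM, hF, Pi.mul_apply, Function.comp]
    rw [clamp_eq hz.le]
  obtain ⟨m, hm⟩ := hMd
  obtain ⟨D, hDc, hD⟩ := exists_deriv_avg hc hMc hm
  have hJD : ∀ x, 0 < x → (x - 1) * D x = c * (M x - avg c M x) := by
    intro x hx
    by_cases h : x = 1
    · subst h; simp [avg_one]
    · have := (hD x hx).unique (hasDerivAt_avg hc hMc hx h)
      rw [this]
      field_simp [sub_ne_zero.2 h]
  refine ⟨v, fun x => x ^ (-γ / 2) * avg c M x / (2 * c),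
    fun x => ((-γ / 2) * x ^ (-γ / 2 - 1) * avg c M x + x ^ (-γ / 2) * D x) / (2 * c),
    hv1, ?_, ?_, ?_, ?_⟩
  · intro x hx
    refine (hv x hx).congr_deriv ?_
    simp only [ha, Real.rpow_sub_one hx.ne']
    field_simp
    ring
  · intro x hx
    exact ((Real.hasDerivAt_rpow_const (Or.inl hx.ne')).mul (hD x hx)).div_const _
  · exact (((continuousOn_const.mul (hpow _)).mul (continuousOn_avg hc hMc)).add
      ((hpow _).mul hDc)).div_const _
  · intro x hx hvx
    have h1 := hJD x hx
    have h2 : M x = x ^ (γ / 2 - 1) * nl p β (v x) := by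
      simp only [hM, hF]; rw [clamp_eq hvx]
    have h3 : x ^ (-γ / 2) * x ^ (γ / 2 - 1) * x = 1 := by
      rw [← Real.rpow_add hx, show -γ / 2 + (γ / 2 - 1) = -1 by ring, Real.rpow_neg_one,
        inv_mul_cancel₀ hx.ne']
    have h4 : γ = 1 - 2 * c := by rw [hc_def]; ring
    have hne : c ≠ 0 := hc.ne'
    rw [Real.rpow_sub_one hx.ne']
    set X := x ^ (-γ / 2) with hX
    clear_value X c
    have h5 : X * (avg c M x) * 0 = 0 := by ring
    have e : 2 * x * (x - 1) * ((-γ / 2 * (X / x) * avg c M x + X * D x) / (2 * c)) +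
        (x - γ) * (X * avg c M x / (2 * c)) =
        (X / (2 * c)) * (-γ * (x - 1) * avg c M x + 2 * x * ((x - 1) * D x)
          + (x - γ) * avg c M x) := by
      field_simp
    rw [e, h1, h2]
    have e2 : X / (2 * c) * (-γ * (x - 1) * avg c M x +
        2 * x * (c * (x ^ (γ / 2 - 1) * nl p β (v x) - avg c M x)) + (x - γ) * avg c M x) =
        (X * x ^ (γ / 2 - 1) * x) * nl p β (v x) +
          X / (2 * c) * avg c M x * (x * (1 - 2 * c - γ)) := by
      field_simp
      ring
    rw [e2, h3, h4]
    ring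

/-! ### Barrier arguments -/

/-- Real induction for open conditions. -/
lemma forall_of_step {a c : ℝ} {P : ℝ → Prop} (ha : P a)
    (hopen : ∀ x ∈ Ico a c, P x → ∀ᶠ z in nhds x, P z)
    (hstep : ∀ x ∈ Ioc a c, (∀ z ∈ Ico a x, P z) → P x) : ∀ x ∈ Icc a c, P x := by
  by_contra hcon
  push Not at hcon
  obtain ⟨w, hw, hPw⟩ := hcon
  set S : Set ℝ := {x | x ∈ Icc a c ∧ ¬ P x} with hS
  have hwS : w ∈ S := ⟨hw, hPw⟩
  have hbd : BddBelow S := ⟨a, fun x hx => hx.1.1⟩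
  have hlow : ∀ z ∈ Ico a (sInf S), P z := by
    intro z hz
    by_contra hPz
    have hzw : sInf S ≤ w := csInf_le hbd hwS
    exact absurd (csInf_le hbd (show z ∈ S from ⟨⟨hz.1, by linarith [hz.2, hw.2]⟩, hPz⟩))
      (not_le.2 hz.2)
  have ha' : a ≤ sInf S := le_csInf ⟨w, hwS⟩ fun x hx => hx.1.1
  have hw' : sInf S ≤ w := csInf_le hbd hwS
  have hP : P (sInf S) := by
    rcases ha'.eq_or_lt with h | h
    · rwa [← h]
    · exact hstep _ ⟨h, hw'.trans hw.2⟩ hlow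
  rcases (hw'.trans hw.2).eq_or_lt with h | h
  · have : w = sInf S := le_antisymm (h ▸ hw.2) hw'
    exact hPw (this ▸ hP)
  · obtain ⟨e, he, hball⟩ := Metric.eventually_nhds_iff.1 (hopen _ ⟨ha', h⟩ hP)
    obtain ⟨s, hs, hse⟩ := exists_lt_of_csInf_lt ⟨w, hwS⟩ (lt_add_of_pos_right (sInf S) he)
    refine hs.2 (hball ?_)
    have := csInf_le hbd hs
    rw [Real.dist_eq, abs_lt]
    constructor <;> linarith

lemma pos_of_barrier {h : ℝ → ℝ} {a x d : ℝ} (hax : a < x) (hpos : ∀ z ∈ Ico a x, 0 < h z)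
    (hd : HasDerivAt h d x) (H : h x = 0 → 0 < d) : 0 < h x := by
  have hev : ∀ᶠ z in nhdsWithin x (Iio x), 0 < h z := by
    filter_upwards [Ico_mem_nhdsLT hax] with z hz using hpos z hz
  have h0 : 0 ≤ h x :=
    ge_of_tendsto (hd.continuousAt.tendsto.mono_left nhdsWithin_le_nhds) (hev.mono fun _ h => h.le)
  rcases h0.eq_or_lt with h1 | h1
  · exfalso
    have hs := (hasDerivAt_iff_tendsto_slope.1 hd).mono_left
      (nhdsWithin_mono x (fun z (hz : z < x) => hz.ne) : nhdsWithin x (Iio x) ≤ _)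
    have : d ≤ 0 := by
      refine le_of_tendsto hs ?_
      filter_upwards [hev, self_mem_nhdsWithin] with z hz hzx
      rw [slope_def_field, ← h1, sub_zero]
      exact div_nonpos_of_nonneg_of_nonpos hz.le (by linarith [show z < x from hzx])
    linarith [H h1.symm]
  · exact h1

lemma le_of_hasDerivAt_nonneg {f f' : ℝ → ℝ} {a X : ℝ} (haX : a ≤ X)
    (hf : ∀ x ∈ Icc a X, HasDerivAt f (f' x) x) (h : ∀ x ∈ Ioo a X, 0 ≤ f' x) : f a ≤ f X := by
  refine monotoneOn_of_deriv_nonneg (convex_Icc a X)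
    (fun x hx => (hf x hx).continuousAt.continuousWithinAt) (fun x hx => ?_) (fun x hx => ?_)
    (left_mem_Icc.2 haX) (right_mem_Icc.2 haX) haX <;> rw [interior_Icc] at hx
  · exact (hf x (Ioo_subset_Icc_self hx)).differentiableAt.differentiableWithinAt
  · rw [(hf x (Ioo_subset_Icc_self hx)).deriv]; exact h x hx

/-- A Grönwall inequality with integrable coefficient `k x^{-μ-1}`. -/
lemma mul_exp_le_of_deriv_le {f f' : ℝ → ℝ} {k μ X : ℝ} (hμ : 0 < μ) (hX : 1 ≤ X)
    (hf : ∀ x ∈ Icc 1 X, HasDerivAt f (f' x) x)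
    (h : ∀ x ∈ Ioo 1 X, f' x ≤ k * (x ^ (-μ) / x) * f x) :
    f X * Real.exp (k / μ * X ^ (-μ)) ≤ f 1 * Real.exp (k / μ) := by
  have := le_of_hasDerivAt_nonneg hX
    (f := fun x => -(f x * Real.exp (k / μ * x ^ (-μ))))
    (f' := fun x => (k * (x ^ (-μ) / x) * f x - f' x) * Real.exp (k / μ * x ^ (-μ)))
    (fun x hx => by
      have hx0 : 0 < x := one_pos.trans_le hx.1
      have he := ((Real.hasDerivAt_rpow_const (p := -μ) (Or.inl hx0.ne')).const_mul (k / μ)).exp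
      refine ((hf x hx).mul he).neg.congr_deriv ?_
      rw [Real.rpow_sub_one hx0.ne']
      field_simp
      ring)
    (fun x hx => mul_nonneg (sub_nonneg.2 (h x hx)) (Real.exp_pos _).le)
  simp only [Real.one_rpow, mul_one] at this
  linarith

lemma le_mul_rpow_of_deriv_le {f f' : ℝ → ℝ} {k X : ℝ} (hX : 1 ≤ X)
    (hf : ∀ x ∈ Icc 1 X, HasDerivAt f (f' x) x)
    (h : ∀ x ∈ Ioo 1 X, f' x ≤ k / x * f x) : f X ≤ f 1 * X ^ k := by
  have := le_of_hasDerivAt_nonneg hX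
    (f := fun x => -(f x * x ^ (-k)))
    (f' := fun x => (k / x * f x - f' x) * x ^ (-k))
    (fun x hx => by
      have hx0 : 0 < x := one_pos.trans_le hx.1
      refine ((hf x hx).mul
        (Real.hasDerivAt_rpow_const (p := -k) (Or.inl hx0.ne'))).neg.congr_deriv ?_
      rw [Real.rpow_sub_one hx0.ne']
      field_simp
      ring)
    (fun x hx => mul_nonneg (sub_nonneg.2 (h x hx))
      (Real.rpow_nonneg (one_pos.trans hx.1).le _))
  simp only [Real.one_rpow, mul_one] at this
  have hX0 : 0 < X := one_pos.trans_le hX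
  rw [Real.rpow_neg hX0.le, ← div_eq_mul_inv] at this
  rw [← div_le_iff₀ (Real.rpow_pos_of_pos hX0 _)]
  linarith

lemma tendsto_of_monotone_of_bdd {v : ℝ → ℝ} {C : ℝ} (hm : MonotoneOn v (Ici 1))
    (hC : ∀ x, 1 ≤ x → v x ≤ C) :
    ∃ L, Tendsto v atTop (nhds L) ∧ ∀ x, 1 ≤ x → v x ≤ L := by
  have hm' : Monotone fun x => v (max 1 x) := fun x z hxz =>
    hm (mem_Ici.2 (le_max_left _ _)) (mem_Ici.2 (le_max_left _ _)) (max_le_max le_rfl hxz)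
  have hb : BddAbove (range fun x => v (max 1 x)) := by
    refine ⟨C, ?_⟩
    rintro _ ⟨x, rfl⟩
    exact hC _ (le_max_left _ _)
  refine ⟨_, (tendsto_atTop_ciSup hm' hb).congr' ?_, fun x hx => ?_⟩
  · filter_upwards [eventually_ge_atTop 1] with x hx
    rw [max_eq_right hx]
  · have := le_ciSup hb x
    simpa [max_eq_right hx] using this

namespace IsProfile

variable {γ β p b : ℝ} {B v y D : ℝ → ℝ}

lemma monotoneOn_of_nonneg (H : IsProfile γ β p b B v y D) (hy : ∀ x, 1 ≤ x → 0 ≤ y x) :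
    MonotoneOn v (Ici 1) := fun x hx z _ hxz => by
  have hx1 : 1 ≤ x := hx
  refine le_of_hasDerivAt_nonneg hxz (fun t ht => H.hv t (by linarith [ht.1])) fun t ht => ?_
  have : 0 < t := by linarith [ht.1]
  exact div_nonneg (hy t (by linarith [ht.1])) (by positivity)

end IsProfile

namespace IsProfile

variable {γ β p b : ℝ} {B v y D : ℝ → ℝ}

lemma y_one (H : IsProfile γ β p b B v y D) (hb : |b| ≤ B 1) : (1 - γ) * y 1 = nl p β b := by
  have := H.eq 1 one_pos (by rw [H.v_one]; exact hb)
  rw [H.v_one] at this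
  linarith

/-- Barriers for data above the singular constant solution. -/
lemma forward_high (H : IsProfile γ β p b B v y D) {α e : ℝ} (hα : 0 < α)
    (hγ1 : γ < 1) (hβ : β = α * (γ + α)) (hp : (p - 1) * α = 2) (hp1 : 1 < p)
    (hb : 0 < b) (hB : ∀ x, 1 ≤ x → b * x ^ (α / 2) ≤ B x) (hγ0 : 0 < γ)
    (hlo : β < b ^ (p - 1)) (he : 0 < e) (heα : e < α)
    (hhi : e * (1 + 2 * α) < α * (α + 1) - b ^ (p - 1)) :
    ∀ x, 1 ≤ x → 0 < y x ∧ y x < (α - e) * v x ∧ b ≤ v x ∧ v x ≤ b * x ^ ((α - e) / 2) := by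
  have hcons : ∀ X, 1 ≤ X → (∀ z ∈ Ico 1 X, 0 < y z ∧ 0 < (α - e) * v z - y z) →
      b ≤ v X ∧ v X ≤ b * X ^ ((α - e) / 2) := by
    intro X hX hP
    have hv : ∀ x ∈ Icc 1 X, HasDerivAt v (y x / (2 * x)) x := fun x hx =>
      H.hv x (by linarith [hx.1])
    constructor
    · rw [← H.v_one]
      refine le_of_hasDerivAt_nonneg hX hv fun x hx => ?_
      have h1 := (hP x ⟨hx.1.le, hx.2⟩).1
      have : 0 < x := by linarith [hx.1]
      positivity
    · have := le_mul_rpow_of_deriv_le (k := (α - e) / 2) hX hv fun x hx => by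
        have h1 := (hP x ⟨hx.1.le, hx.2⟩).2
        have : 0 < x := by linarith [hx.1]
        rw [show (α - e) / 2 / x * v x = (α - e) * v x / (2 * x) by field_simp]
        gcongr
        linarith
      rwa [H.v_one] at this
  have hpb : ∀ X, 1 ≤ X → b ≤ v X → v X ≤ b * X ^ ((α - e) / 2) →
      |v X| ≤ B X ∧ v X ^ (p - 1) ≤ b ^ (p - 1) * X ∧ b ^ (p - 1) ≤ v X ^ (p - 1) := by
    intro X hX h1 h2
    have hX0 : 0 < X := by linarith
    have h3 : v X ≤ b * X ^ (α / 2) := h2.trans (mul_le_mul_of_nonneg_left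
      (Real.rpow_le_rpow_of_exponent_le hX (by linarith)) hb.le)
    have h0 : 0 < v X := by linarith
    refine ⟨by rw [abs_of_pos h0]; exact h3.trans (hB X hX), ?_, ?_⟩
    · have := Real.rpow_le_rpow h0.le h3 (by linarith : 0 ≤ p - 1)
      rwa [Real.mul_rpow hb.le (by positivity), ← Real.rpow_mul hX0.le,
        show α / 2 * (p - 1) = 1 by linarith, Real.rpow_one] at this
    · exact Real.rpow_le_rpow hb.le h1 (by linarith)
  have hbB : |b| ≤ B 1 := by
    have := hB 1 le_rfl
    simpa [abs_of_pos hb] using this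
  have hy1 := H.y_one hbB
  rw [nl_of_pos hb] at hy1
  have hmain : ∀ X, 1 ≤ X → ∀ x ∈ Icc 1 X, 0 < y x ∧ 0 < (α - e) * v x - y x := by
    intro X hX
    refine forall_of_step ?_ ?_ ?_
    · have h1 : 0 < b * (b ^ (p - 1) - β) := mul_pos hb (by linarith)
      constructor
      · rw [← hy1] at h1
        exact pos_of_mul_pos_right h1 (by linarith)
      · rw [H.v_one]
        have h2 : 0 < (1 - γ) * ((α - e) * b - y 1) := by
          have : (1 - γ) * ((α - e) * b - y 1) = b * (α * (α + 1) - b ^ (p - 1) - (1 - γ) * e) := by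
            rw [mul_sub, hy1, hβ]; ring
          rw [this]
          refine mul_pos hb ?_
          nlinarith [mul_pos he hγ0, mul_pos he hα]
        exact pos_of_mul_pos_right h2 (by linarith)
    · intro x hx hPx
      have hx0 : 0 < x := by linarith [hx.1]
      have c1 := (H.hy x hx0).continuousAt
      have c2 := (H.hv x hx0).continuousAt
      have c3 : ContinuousAt (fun x => (α - e) * v x - y x) x := by fun_prop
      exact (c1.eventually (lt_mem_nhds hPx.1)).and (c3.eventually (lt_mem_nhds hPx.2))
    · intro x hx hP
      have hx1 : 1 < x := hx.1
      have hx0 : 0 < x := by linarith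
      obtain ⟨h1, h2⟩ := hcons x hx1.le hP
      obtain ⟨h3, h4, h5⟩ := hpb x hx1.le h1 h2
      have hv0 : 0 < v x := by linarith
      have heq := H.eq x hx0 h3
      rw [nl_of_pos hv0] at heq
      have hpp : 0 < 2 * x * (x - 1) := mul_pos (by positivity) (by linarith)
      constructor
      · refine pos_of_barrier (h := y) hx1 (fun z hz => (hP z hz).1) (H.hy x hx0) fun h => ?_
        rw [h, mul_zero, add_zero] at heq
        refine pos_of_mul_pos_right (a := 2 * x * (x - 1)) ?_ hpp.le
        rw [heq]
        exact mul_pos hv0 (by linarith)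
      · refine pos_of_barrier (h := fun z => (α - e) * v z - y z) hx1 (fun z hz => (hP z hz).2)
          (((H.hv x hx0).const_mul (α - e)).sub (H.hy x hx0)) fun h => ?_
        refine pos_of_mul_pos_right (a := 2 * x * (x - 1)) ?_ hpp.le
        have hy : y x = (α - e) * v x := by linarith
        have e1 : 2 * x * (x - 1) * ((α - e) * (y x / (2 * x)) - D x) =
            v x * ((α - e) ^ 2 * (x - 1) + (x - γ) * (α - e) + β - v x ^ (p - 1)) := by
          have : 2 * x * (x - 1) * ((α - e) * (y x / (2 * x))) = (x - 1) * (α - e) * y x := by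
            field_simp
          rw [mul_sub, this]
          rw [hy] at heq ⊢
          linear_combination -heq
        rw [e1]
        refine mul_pos hv0 ?_
        have h6 : 0 < x * ((α - e) ^ 2 + (α - e) - b ^ (p - 1)) := by
          refine mul_pos hx0 ?_
          nlinarith
        have h7 : 0 ≤ β - (α - e) ^ 2 - γ * (α - e) := by rw [hβ]; nlinarith
        nlinarith
  intro x hx
  obtain ⟨h1, h2⟩ := hmain x hx x (right_mem_Icc.2 hx)
  obtain ⟨h3, h4⟩ := hcons x hx fun z hz => hmain x hx z ⟨hz.1, hz.2.le⟩
  exact ⟨h1, by linarith, h3, h4⟩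

/-- Algebraic decay of `y / v` for data above the singular constant solution. -/
lemma forward_high_decay (H : IsProfile γ β p b B v y D) {α e : ℝ} (hα : 0 < α)
    (hγ1 : γ < 1) (hβ0 : 0 < β) (hp : (p - 1) * α = 2) (hp1 : 1 < p)
    (hb : 0 < b) (hB : ∀ x, 1 ≤ x → b * x ^ (α / 2) ≤ B x) (hγ0 : 0 < γ)
    (he : 0 < e)
    (hF : ∀ x, 1 ≤ x → 0 < y x ∧ y x < (α - e) * v x ∧ b ≤ v x ∧ v x ≤ b * x ^ ((α - e) / 2)) :
    ∃ K μ : ℝ, 0 < K ∧ 0 < μ ∧ ∀ x, 1 ≤ x → y x ≤ K * x ^ (-μ) * v x := by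
  set μ := min (1 / 4) (e / α) with hμ_def
  have hμ0 : 0 < μ := lt_min (by norm_num) (by positivity)
  have hμ1 : μ ≤ 1 / 4 := min_le_left _ _
  have hμ2 : μ ≤ e / α := min_le_right _ _
  have hQ : 0 < b ^ (p - 1) := by positivity
  set K := 2 * b ^ (p - 1) / (1 - γ) with hK_def
  have hκ : 0 < 1 - γ := by linarith
  have hK : 0 < K := by positivity
  have hKκ : K * (1 - γ) = 2 * b ^ (p - 1) := by rw [hK_def]; field_simp
  have hbB : |b| ≤ B 1 := by
    have := hB 1 le_rfl
    simpa [abs_of_pos hb] using this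
  have hy1 := H.y_one hbB
  rw [nl_of_pos hb] at hy1
  refine ⟨K, μ, hK, hμ0, fun X hX => ?_⟩
  have hmain : ∀ x ∈ Icc 1 X, 0 < K * x ^ (-μ) * v x - y x := by
    refine forall_of_step ?_ ?_ ?_
    · rw [Real.one_rpow, H.v_one]
      refine pos_of_mul_pos_right (a := 1 - γ) ?_ hκ.le
      rw [mul_sub, hy1]
      have : (1 - γ) * (K * 1 * b) = b * (K * (1 - γ)) := by ring
      rw [this, hKκ, ← mul_sub]
      exact mul_pos hb (by linarith)
    · intro x hx hPx
      have hx0 : 0 < x := by linarith [hx.1]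
      have c1 := (H.hy x hx0).continuousAt
      have c2 := (H.hv x hx0).continuousAt
      have c4 := (Real.hasDerivAt_rpow_const (x := x) (p := -μ) (Or.inl hx0.ne')).continuousAt
      have c3 : ContinuousAt (fun x => K * x ^ (-μ) * v x - y x) x := by fun_prop
      exact c3.eventually (lt_mem_nhds hPx)
    · intro x hx hP
      have hx1 : 1 < x := hx.1
      have hx0 : 0 < x := by linarith
      obtain ⟨h0, -, h1, h2⟩ := hF x hx1.le
      have hv0 : 0 < v x := by linarith
      have h3 : |v x| ≤ B x := by
        rw [abs_of_pos hv0]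
        exact (h2.trans (mul_le_mul_of_nonneg_left
          (Real.rpow_le_rpow_of_exponent_le hx1.le (by linarith)) hb.le)).trans (hB x hx1.le)
      have heq := H.eq x hx0 h3
      rw [nl_of_pos hv0] at heq
      have hpp : 0 < 2 * x * (x - 1) := mul_pos (by positivity) (by linarith)
      refine pos_of_barrier (h := fun x => K * x ^ (-μ) * v x - y x) hx1 hP (((((Real.hasDerivAt_rpow_const (p := -μ)
        (Or.inl hx0.ne')).const_mul K)).mul (H.hv x hx0)).sub (H.hy x hx0)) fun h => ?_
      refine pos_of_mul_pos_right (a := 2 * x * (x - 1)) ?_ hpp.le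
      have hpow : v x ^ (p - 1) ≤ b ^ (p - 1) * (x ^ (-μ) * x) := by
        have h4 := Real.rpow_le_rpow hv0.le h2 (by linarith : 0 ≤ p - 1)
        rw [Real.mul_rpow hb.le (by positivity), ← Real.rpow_mul hx0.le] at h4
        refine h4.trans (mul_le_mul_of_nonneg_left ?_ hQ.le)
        have h5 : x ^ (-μ) * x = x ^ (-μ + 1) := by rw [Real.rpow_add hx0, Real.rpow_one]
        rw [h5]
        refine Real.rpow_le_rpow_of_exponent_le hx1.le ?_
        have h6 : (α - e) / 2 * (p - 1) = 1 - e / α := by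
          field_simp
          linear_combination (α - e) * hp
        rw [h6]; linarith
      rw [Real.rpow_sub_one hx0.ne']
      have hX0 : 0 < x ^ (-μ) := by positivity
      set Z := x ^ (-μ) with hZ
      clear_value Z
      have hy : y x = K * Z * v x := by linarith
      have e1 : 2 * x * (x - 1) * (K * (-μ * (Z / x)) * v x + K * Z * (y x / (2 * x)) - D x) =
          v x * (K * Z * ((1 - 2 * μ) * (x - 1) + (1 - γ) + (x - 1) * (K * Z)) + β
            - v x ^ (p - 1)) := by
        have : 2 * x * (x - 1) * (K * (-μ * (Z / x)) * v x + K * Z * (y x / (2 * x)) - D x) =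
          -2 * μ * (x - 1) * (K * Z) * v x + (x - 1) * (K * Z) * y x - 2 * x * (x - 1) * D x := by
          field_simp
        rw [this]
        rw [hy] at heq ⊢
        linear_combination -heq
      rw [e1]
      refine mul_pos hv0 ?_
      have h7 : (1 - γ) / 2 * x ≤ (1 - 2 * μ) * (x - 1) + (1 - γ) + (x - 1) * (K * Z) := by
        have : 0 ≤ (x - 1) * (K * Z) := mul_nonneg (by linarith) (by positivity)
        nlinarith
      have h8 := mul_le_mul_of_nonneg_left h7 (by positivity : 0 ≤ K * Z)
      have h9 : K * Z * ((1 - γ) / 2 * x) = b ^ (p - 1) * (Z * x) := by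
        linear_combination (Z * x / 2) * hKκ
      linarith
  linarith [hmain X (right_mem_Icc.2 hX)]

end IsProfile

lemma nl_neg {p β c v : ℝ} (hp : 1 < p) (hc : c ^ (p - 1) = β) (hv : 0 < v) (hvc : v < c) :
    nl p β v < 0 := by
  rw [nl_of_pos hv]
  have := Real.rpow_lt_rpow hv.le hvc (by linarith : 0 < p - 1)
  exact mul_neg_of_pos_of_neg hv (by linarith)

lemma neg_mul_le_nl {p β c v : ℝ} (hp : 1 < p) (hc : c ^ (p - 1) = β) (hv : 0 < v) (hvc : v ≤ c) :
    -((p - 1) * β * (c - v)) ≤ nl p β v := by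
  have hc0 : 0 < c := hv.trans_le hvc
  have hβ : 0 < β := by rw [← hc]; positivity
  set t := v / c with ht
  have hvt : v = c * t := by rw [ht]; field_simp
  have ht0 : 0 < t := by positivity
  have h := one_add_mul_self_le_rpow_one_add (s := t - 1) (by linarith) hp.le
  have h1 : (1 + (t - 1)) ^ p = t ^ (p - 1) * t := by
    rw [show 1 + (t - 1) = t by ring, Real.rpow_sub_one ht0.ne']
    field_simp
  rw [h1] at h
  rw [nl_of_pos hv, hvt, Real.mul_rpow hc0.le ht0.le, hc]
  have : 0 ≤ c * β * (t ^ (p - 1) * t - (1 + p * (t - 1))) :=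
    mul_nonneg (by positivity) (by linarith)
  linarith

namespace IsProfile

variable {γ β p b : ℝ} {B v y D : ℝ → ℝ}

/-- Barriers for data below the singular constant solution, given a positive lower bound. -/
lemma forward_low (H : IsProfile γ β p b B v y D) {c K l : ℝ} (hγ0 : 0 < γ) (hγ1 : γ < 1)
    (hp1 : 1 < p) (hc : c ^ (p - 1) = β) (hb : 0 < b) (hbc : b < c) (hK : 1 ≤ K)
    (hB : ∀ x, 1 ≤ x → b ≤ B x) (hKC : 2 * ((p - 1) * β) < K * (1 - γ)) (hl : 0 < l)
    (hlow : ∀ X, 1 < X → (∀ x ∈ Ico 1 X, y x < 0 ∧ 0 < K * x ^ (-(1 / 8) : ℝ) * (c - v x) + y x ∧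
      0 < v x) → l ≤ v X) :
    ∀ x, 1 ≤ x → y x < 0 ∧ 0 < K * x ^ (-(1 / 8) : ℝ) * (c - v x) + y x ∧ 0 < v x := by
  intro X hX
  have hy1 := H.y_one (by rw [abs_of_pos hb]; exact hB 1 le_rfl)
  have hβ : 0 < β := by
    rw [← hc]; have : 0 < c := hb.trans hbc
    positivity
  have hκ : 0 < 1 - γ := by linarith
  refine forall_of_step (P := fun x => y x < 0 ∧ 0 < K * x ^ (-(1 / 8) : ℝ) * (c - v x) + y x ∧
      0 < v x) ?_ ?_ ?_ X (right_mem_Icc.2 hX)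
  · refine ⟨?_, ?_, by rw [H.v_one]; exact hb⟩
    · have := nl_neg hp1 hc hb hbc
      rw [← hy1] at this
      exact neg_of_mul_neg_right this hκ.le
    · have := neg_mul_le_nl hp1 hc hb hbc.le
      rw [← hy1] at this
      rw [Real.one_rpow, H.v_one]
      refine pos_of_mul_pos_right (a := 1 - γ) ?_ hκ.le
      have h1 : 0 < (c - b) * (K * (1 - γ) - (p - 1) * β) := by
        have : 0 < (p - 1) * β := mul_pos (by linarith) hβ
        exact mul_pos (by linarith) (by linarith)
      linarith
  · intro x hx hPx
    have hx0 : 0 < x := by linarith [hx.1]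
    have c1 := (H.hy x hx0).continuousAt
    have c2 := (H.hv x hx0).continuousAt
    have c4 := (Real.hasDerivAt_rpow_const (x := x) (p := (-(1 / 8) : ℝ))
      (Or.inl hx0.ne')).continuousAt
    have c3 : ContinuousAt (fun x => K * x ^ (-(1 / 8) : ℝ) * (c - v x) + y x) x := by fun_prop
    exact (c1.eventually (gt_mem_nhds hPx.1)).and
      ((c3.eventually (lt_mem_nhds hPx.2.1)).and (c2.eventually (lt_mem_nhds hPx.2.2)))
  · intro x hx hP
    have hx1 : 1 < x := hx.1
    have hx0 : 0 < x := by linarith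
    have hv0 : 0 < v x := hl.trans_le (hlow x hx1 hP)
    have hvb : v x ≤ b := by
      have := le_of_hasDerivAt_nonneg (f := fun x => -v x) hx1.le
        (fun t ht => (H.hv t (by linarith [ht.1])).neg) fun t ht => by
          have h1 := (hP t ⟨ht.1.le, ht.2⟩).1
          have : 0 < t := by linarith [ht.1]
          rw [← neg_div]
          exact div_nonneg (by linarith) (by positivity)
      simp only [H.v_one] at this
      linarith
    have hz : 0 < c - v x := by linarith
    have heq := H.eq x hx0 (by rw [abs_of_pos hv0]; exact hvb.trans (hB x hx1.le))
    have hpp : 0 < 2 * x * (x - 1) := mul_pos (by positivity) (by linarith)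
    refine ⟨?_, ?_, hv0⟩
    · have := pos_of_barrier (h := fun x => -y x) hx1
        (fun z hz => by linarith [(hP z hz).1]) (H.hy x hx0).neg fun h => by
          have h : -y x = 0 := h
          rw [show y x = 0 by linarith, mul_zero, add_zero] at heq
          have hn := nl_neg hp1 hc hv0 (hvb.trans_lt hbc)
          rw [← heq] at hn
          linarith [neg_of_mul_neg_right hn hpp.le]
      linarith
    · refine pos_of_barrier (h := fun x => K * x ^ (-(1 / 8) : ℝ) * (c - v x) + y x) hx1
        (fun z hz => (hP z hz).2.1) ((((Real.hasDerivAt_rpow_const (p := (-(1 / 8) : ℝ))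
        (Or.inl hx0.ne')).const_mul K).mul ((H.hv x hx0).const_sub c)).add (H.hy x hx0))
        fun h => ?_
      refine pos_of_mul_pos_right (a := 2 * x * (x - 1)) ?_ hpp.le
      have hX1 : 1 ≤ x ^ (-(1 / 8) : ℝ) * x := by
        have h5 : x ^ (-(1 / 8) : ℝ) * x = x ^ (-(1 / 8) + 1 : ℝ) := by
          rw [Real.rpow_add hx0, Real.rpow_one]
        rw [h5]
        exact Real.one_le_rpow hx1.le (by norm_num)
      have hn := neg_mul_le_nl hp1 hc hv0 (hvb.trans hbc.le)
      rw [← heq] at hn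
      rw [Real.rpow_sub_one hx0.ne']
      have hX0 : 0 < x ^ (-(1 / 8) : ℝ) := by positivity
      set Z := x ^ (-(1 / 8) : ℝ) with hZ
      clear_value Z
      have hy : y x = -(K * Z * (c - v x)) := by linarith
      have e1 : 2 * x * (x - 1) * (K * (-(1 / 8) * (Z / x)) * (c - v x)
          + K * Z * -(y x / (2 * x)) + D x) =
          (2 * x * (x - 1) * D x + (x - γ) * y x) +
          (c - v x) * (K * Z * (3 / 4 * (x - 1) + (1 - γ) + (x - 1) * (K * Z))) := by
        have : 2 * x * (x - 1) * (K * (-(1 / 8) * (Z / x)) * (c - v x)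
          + K * Z * -(y x / (2 * x)) + D x) = -(1 / 4) * (x - 1) * (K * Z) * (c - v x)
          - (x - 1) * (K * Z) * y x + 2 * x * (x - 1) * D x := by
          field_simp
          ring
        rw [this, hy]
        ring
      rw [e1]
      have h7 : (1 - γ) / 2 * x ≤ 3 / 4 * (x - 1) + (1 - γ) + (x - 1) * (K * Z) := by
        have : 0 ≤ (x - 1) * (K * Z) := mul_nonneg (by linarith) (by positivity)
        nlinarith
      have h8 := mul_le_mul_of_nonneg_left h7 (by positivity : 0 ≤ K * Z)
      have h9 : (p - 1) * β < K * Z * ((1 - γ) / 2 * x) := by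
        have : K * (1 - γ) / 2 * 1 ≤ K * (1 - γ) / 2 * (Z * x) :=
          mul_le_mul_of_nonneg_left hX1 (by positivity)
        linarith
      have := mul_lt_mul_of_pos_left (h9.trans_le h8) hz
      linarith

end IsProfile

namespace IsProfile

variable {γ β p b : ℝ} {B v y D : ℝ → ℝ}

lemma lower_bound_exp (H : IsProfile γ β p b B v y D) {c K X : ℝ} (hX : 1 < X) (hbc : b < c)
    (hK : 0 ≤ K)
    (hP : ∀ x ∈ Ico 1 X, 0 < K * x ^ (-(1 / 8) : ℝ) * (c - v x) + y x) :
    c - (c - b) * Real.exp (4 * K) ≤ v X := by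
  have := mul_exp_le_of_deriv_le (f := fun x => c - v x) (k := K / 2) (μ := 1 / 8) (by norm_num)
    hX.le (fun t ht => (H.hv t (by linarith [ht.1])).const_sub c) fun t ht => by
      have h1 := hP t ⟨ht.1.le, ht.2⟩
      have : 0 < t := by linarith [ht.1]
      rw [show K / 2 * (t ^ (-(1 / 8) : ℝ) / t) * (c - v t) =
        K * t ^ (-(1 / 8) : ℝ) * (c - v t) / (2 * t) by field_simp, ← neg_div]
      gcongr
      linarith
  simp only [H.v_one] at this
  rw [show K / 2 / (1 / 8) = 4 * K by ring] at this
  rcases le_total (c - v X) 0 with h | h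
  · have : 0 < (c - b) * Real.exp (4 * K) := mul_pos (by linarith) (Real.exp_pos _)
    linarith
  · have h1 : 1 ≤ Real.exp (4 * K * X ^ (-(1 / 8) : ℝ)) :=
      Real.one_le_exp (by have := hX.le; positivity)
    nlinarith

/-- The lower bound in the critical three-dimensional situation `γ = 1 - 2α`. -/
lemma lower_bound_three (H : IsProfile γ β p b B v y D) {α X : ℝ} (hα0 : 0 < α) (hα1 : α < 1)
    (hγ : γ = 1 - 2 * α) (hβ : β = α * (1 - α)) (hX : 1 < X)
    (hb : 0 < b) (hB : ∀ x, 1 ≤ x → b ≤ B x)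
    (hP : ∀ x ∈ Ico 1 X, y x < 0 ∧ 0 < v x) :
    b * Real.exp (-(2 * (1 - α))) ≤ v X := by
  set A := (1 - α) / 2 with hA
  have hA0 : 0 < A := by rw [hA]; linarith
  have hy1 := H.y_one (by rw [abs_of_pos hb]; exact hB 1 le_rfl)
  rw [nl_of_pos hb] at hy1
  have hbp : 0 < b ^ (p - 1) := by positivity
  have hanti : ∀ x ∈ Ico 1 X, v x ≤ b := by
    intro x hx
    have := le_of_hasDerivAt_nonneg (f := fun x => -v x) hx.1
        (fun t ht => (H.hv t (by linarith [ht.1])).neg) fun t ht => by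
          have h1 := (hP t ⟨ht.1.le, ht.2.trans hx.2⟩).1
          have : 0 < t := by linarith [ht.1]
          rw [← neg_div]
          exact div_nonneg (by linarith) (by positivity)
    simp only [H.v_one] at this
    linarith
  have hmain : ∀ X' ∈ Ico 1 X, ∀ x ∈ Icc 1 X', 0 < A * x ^ (-(1 / 8) : ℝ) * v x + y x := by
    intro X' hX'
    refine forall_of_step ?_ ?_ ?_
    · rw [Real.one_rpow, H.v_one]
      refine pos_of_mul_pos_right (a := 1 - γ) ?_ (by linarith)
      rw [mul_add, hy1, hγ, hβ, hA]
      have := mul_pos hb hbp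
      linarith
    · intro x hx hPx
      have hx0 : 0 < x := by linarith [hx.1]
      have c1 := (H.hy x hx0).continuousAt
      have c2 := (H.hv x hx0).continuousAt
      have c4 := (Real.hasDerivAt_rpow_const (x := x) (p := (-(1 / 8) : ℝ))
        (Or.inl hx0.ne')).continuousAt
      have c3 : ContinuousAt (fun x => A * x ^ (-(1 / 8) : ℝ) * v x + y x) x := by fun_prop
      exact c3.eventually (lt_mem_nhds hPx)
    · intro x hx hP'
      have hx1 : 1 < x := hx.1
      have hx0 : 0 < x := by linarith
      have hxX : x ∈ Ico 1 X := ⟨hx1.le, hx.2.trans_lt hX'.2⟩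
      have hv0 := (hP x hxX).2
      have heq := H.eq x hx0 (by rw [abs_of_pos hv0]; exact (hanti x hxX).trans (hB x hx1.le))
      rw [nl_of_pos hv0] at heq
      have hpp : 0 < 2 * x * (x - 1) := mul_pos (by positivity) (by linarith)
      refine pos_of_barrier (h := fun x => A * x ^ (-(1 / 8) : ℝ) * v x + y x) hx1
        hP' ((((Real.hasDerivAt_rpow_const (p := (-(1 / 8) : ℝ))
        (Or.inl hx0.ne')).const_mul A).mul (H.hv x hx0)).add (H.hy x hx0))
        fun h => ?_
      refine pos_of_mul_pos_right (a := 2 * x * (x - 1)) ?_ hpp.le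
      have hZ1 : x ^ (-(1 / 8) : ℝ) ≤ 1 :=
        Real.rpow_le_one_of_one_le_of_nonpos hx1.le (by norm_num)
      have hZ2 : 1 ≤ x ^ (-(1 / 8) : ℝ) * (1 + (x - 1) / 8) := by
        have h1 := rpow_one_add_le_one_add_mul_self (s := x - 1) (p := 1 / 8) (by linarith)
          (by norm_num) (by norm_num)
        rw [show 1 + (x - 1) = x by ring] at h1
        have h2 : x ^ (-(1 / 8) : ℝ) * x ^ (1 / 8 : ℝ) = 1 := by
          rw [← Real.rpow_add hx0]; norm_num
        exact h2.symm.le.trans (mul_le_mul_of_nonneg_left (by linarith) (by positivity))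
      have hvp : 0 < v x ^ (p - 1) := by positivity
      rw [Real.rpow_sub_one hx0.ne']
      have hX0 : 0 < x ^ (-(1 / 8) : ℝ) := by positivity
      set Z := x ^ (-(1 / 8) : ℝ) with hZ
      clear_value Z
      have hy : y x = -(A * Z * v x) := by linarith
      have e1 : 2 * x * (x - 1) * (A * (-(1 / 8) * (Z / x)) * v x
          + A * Z * (y x / (2 * x)) + D x) =
          (2 * x * (x - 1) * D x + (x - γ) * y x) +
          v x * (A * Z * (3 / 4 * (x - 1) + (1 - γ) - (x - 1) * (A * Z))) := by
        have : 2 * x * (x - 1) * (A * (-(1 / 8) * (Z / x)) * v x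
          + A * Z * (y x / (2 * x)) + D x) = -(1 / 4) * (x - 1) * (A * Z) * v x
          + (x - 1) * (A * Z) * y x + 2 * x * (x - 1) * D x := by
          field_simp
          ring
        rw [this, hy]
        ring
      rw [e1, heq, ← mul_add]
      refine mul_pos hv0 ?_
      have h1 : A * Z ≤ 1 / 2 := by
        rw [hA]; nlinarith
      have h2 : 2 * α * (1 + (x - 1) / 8) ≤ 3 / 4 * (x - 1) + (1 - γ) - (x - 1) * (A * Z) := by
        rw [hγ]; nlinarith
      have h3 := mul_le_mul_of_nonneg_left h2 (by positivity : 0 ≤ A * Z)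
      have h4 : β ≤ A * Z * (2 * α * (1 + (x - 1) / 8)) := by
        have : β = A * (2 * α) * 1 := by rw [hβ, hA]; ring
        rw [this]
        have := mul_le_mul_of_nonneg_left hZ2 (by positivity : 0 ≤ A * (2 * α))
        linarith
      linarith
  have := mul_exp_le_of_deriv_le (f := fun x => -v x) (k := -(A / 2)) (μ := 1 / 8) (by norm_num)
    hX.le (fun t ht => (H.hv t (by linarith [ht.1])).neg) fun t ht => by
      have h1 := hmain t ⟨ht.1.le, ht.2⟩ t ⟨ht.1.le, le_rfl⟩
      have : 0 < t := by linarith [ht.1]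
      rw [show -(A / 2) * (t ^ (-(1 / 8) : ℝ) / t) * (-v t) =
        A * t ^ (-(1 / 8) : ℝ) * v t / (2 * t) by field_simp, ← neg_div]
      gcongr
      linarith
  simp only [H.v_one] at this
  rw [show -(A / 2) / (1 / 8) = -(2 * (1 - α)) by rw [hA]; ring] at this
  have h1 : Real.exp (-(2 * (1 - α)) * X ^ (-(1 / 8) : ℝ)) ≤ 1 := by
    refine Real.exp_le_one_iff.2 ?_
    have : 0 ≤ (1 - α) * X ^ (-(1 / 8) : ℝ) := mul_nonneg (by linarith) (by positivity)
    linarith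
  have h2 := Real.exp_pos (-(2 * (1 - α)) * X ^ (-(1 / 8) : ℝ))
  have h3 := Real.exp_pos (-(2 * (1 - α)))
  have h4 : 0 < b * Real.exp (-(2 * (1 - α))) := mul_pos hb h3
  by_contra hcon
  push Not at hcon
  rcases le_total (v X) 0 with h | h
  · nlinarith
  · nlinarith

end IsProfile

/-- The behaviour of a global profile to the right of `1`. -/
structure ForwardGlobal (α b c : ℝ) (B v y : ℝ → ℝ) : Prop where
  pos : ∀ x, 1 ≤ x → 0 < v x
  abs_le : ∀ x, 1 ≤ x → |v x| ≤ B x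
  le : ∀ x, 1 ≤ x → v x ≤ b * x ^ (α / 2)
  y_lt : ∀ x, 1 ≤ x → y x < α * v x
  lim : ∃ L > 0, Tendsto v atTop (nhds L) ∧ Tendsto y atTop (nhds 0) ∧
    (c < b → b < L) ∧ (b < c → L < b)

lemma tendsto_zero_of_le_rpow {f : ℝ → ℝ} {C μ : ℝ} (hμ : 0 < μ)
    (h : ∀ x, 1 ≤ x → |f x| ≤ C * x ^ (-μ)) : Tendsto f atTop (nhds 0) := by
  refine squeeze_zero_norm' (a := fun x => C * x ^ (-μ)) ?_ ?_
  · filter_upwards [eventually_ge_atTop 1] with x hx using h x hx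
  · simpa using (tendsto_rpow_neg_atTop hμ).const_mul C

namespace IsProfile

variable {γ β p b : ℝ} {B v y D : ℝ → ℝ}

lemma exists_slope (H : IsProfile γ β p b B v y D) :
    ∃ t, 1 < t ∧ v 2 - b = y t / (2 * t) := by
  obtain ⟨t, ht, h⟩ := exists_hasDerivAt_eq_slope v (fun x => y x / (2 * x)) one_lt_two
    (fun x hx => (H.hv x (by linarith [hx.1])).continuousAt.continuousWithinAt)
    (fun x hx => H.hv x (by linarith [hx.1]))
  rw [H.v_one] at h
  norm_num at h
  exact ⟨t, ht.1, h.symm⟩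

lemma forwardGlobal_high (H : IsProfile γ β p b B v y D) {α c : ℝ} (hγ0 : 0 < γ) (hγ1 : γ < 1)
    (hα : 0 < α) (hβ : β = α * (γ + α)) (hp : (p - 1) * α = 2) (hp1 : 1 < p) (hb : 0 < b)
    (hB : ∀ x, 1 ≤ x → b * x ^ (α / 2) ≤ B x) (hc0 : 0 < c) (hc : c ^ (p - 1) = β)
    (hb0 : b ^ (p - 1) < α * (α + 1)) (hcb : c < b) : ForwardGlobal α b c B v y := by
  have hβ0 : 0 < β := by rw [hβ]; positivity
  have hlo : β < b ^ (p - 1) := by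
    rw [← hc]; exact Real.rpow_lt_rpow hc0.le hcb (by linarith)
  set e := min (α / 2) ((α * (α + 1) - b ^ (p - 1)) / (2 * (1 + 2 * α))) with he_def
  have he : 0 < e := lt_min (by linarith) (div_pos (by linarith) (by linarith))
  have he1 : e ≤ α / 2 := min_le_left _ _
  have he2 : e * (2 * (1 + 2 * α)) ≤ α * (α + 1) - b ^ (p - 1) :=
    (le_div_iff₀ (by linarith)).1 (min_le_right _ _)
  have hF := H.forward_high hα hγ1 hβ hp hp1 hb hB hγ0 hlo he (by linarith) (by nlinarith)
  obtain ⟨K, μ, hK, hμ, hdec⟩ := H.forward_high_decay hα hγ1 hβ0 hp hp1 hb hB hγ0 he hF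
  have hv0 : ∀ x, 1 ≤ x → 0 < v x := fun x hx => hb.trans_le (hF x hx).2.2.1
  have hle : ∀ x, 1 ≤ x → v x ≤ b * x ^ (α / 2) := fun x hx =>
    (hF x hx).2.2.2.trans (mul_le_mul_of_nonneg_left
      (Real.rpow_le_rpow_of_exponent_le hx (by linarith)) hb.le)
  have hbd : ∀ x, 1 ≤ x → v x ≤ b * Real.exp (K / 2 / μ) := by
    intro X hX
    have := mul_exp_le_of_deriv_le (f := v) (k := K / 2) hμ hX
      (fun t ht => H.hv t (by linarith [ht.1])) fun t ht => by
        have h1 := hdec t ht.1.le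
        have : 0 < t := by linarith [ht.1]
        rw [show K / 2 * (t ^ (-μ) / t) * v t = K * t ^ (-μ) * v t / (2 * t) by field_simp]
        gcongr
    rw [H.v_one] at this
    refine le_trans (le_mul_of_one_le_right (hv0 X hX).le (Real.one_le_exp ?_)) this
    have : 0 ≤ X := by linarith
    positivity
  obtain ⟨L, hL, hvL⟩ := tendsto_of_monotone_of_bdd
    (H.monotoneOn_of_nonneg fun x hx => (hF x hx).1.le) hbd
  have hbL : b < L := by
    obtain ⟨t, ht, h⟩ := H.exists_slope
    have h1 : 0 < y t / (2 * t) := div_pos (hF t ht.le).1 (by linarith)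
    linarith [hvL 2 one_le_two]
  refine ⟨hv0, fun x hx => ?_, hle, fun x hx => ?_, L, hb.trans hbL, hL, ?_, fun _ => hbL,
    fun h => absurd h hcb.not_gt⟩
  · rw [abs_of_pos (hv0 x hx)]
    exact (hle x hx).trans (hB x hx)
  · have := (hF x hx).2.1
    nlinarith [mul_pos he (hv0 x hx)]
  · refine tendsto_zero_of_le_rpow (C := K * (b * Real.exp (K / 2 / μ))) hμ fun x hx => ?_
    rw [abs_of_pos (hF x hx).1]
    have hx0 : 0 < x := by linarith
    have := mul_le_mul_of_nonneg_left (hbd x hx) (by positivity : 0 ≤ K * x ^ (-μ))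
    linarith [hdec x hx]

lemma forwardGlobal_low (H : IsProfile γ β p b B v y D) {α c K : ℝ} (hγ0 : 0 < γ) (hγ1 : γ < 1)
    (hα : 0 < α) (hβ : β = α * (γ + α)) (hp1 : 1 < p) (hb : 0 < b)
    (hB : ∀ x, 1 ≤ x → b * x ^ (α / 2) ≤ B x) (hc : c ^ (p - 1) = β)
    (hbc : b < c) (hK : K = 2 * ((p - 1) * β) / (1 - γ) + 1)
    (hcase : γ = 1 - 2 * α ∨ (c - b) * Real.exp (4 * K) < c) : ForwardGlobal α b c B v y := by
  have hβ0 : 0 < β := by rw [hβ]; positivity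
  have hκ : 0 < 1 - γ := by linarith
  have hpow : ∀ x : ℝ, 1 ≤ x → b ≤ b * x ^ (α / 2) := fun x hx =>
    le_mul_of_one_le_right hb.le (Real.one_le_rpow hx (by linarith))
  have hB' : ∀ x, 1 ≤ x → b ≤ B x := fun x hx => (hpow x hx).trans (hB x hx)
  have hK1 : 1 ≤ K := by
    rw [hK]
    have : 0 ≤ 2 * ((p - 1) * β) / (1 - γ) :=
      div_nonneg (mul_nonneg two_pos.le (mul_nonneg (by linarith) hβ0.le)) hκ.le
    linarith
  have hKC : 2 * ((p - 1) * β) < K * (1 - γ) := by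
    rw [hK, add_mul, div_mul_cancel₀ _ hκ.ne']; linarith
  obtain ⟨l, hl, hlow⟩ : ∃ l > 0, ∀ X, 1 < X → (∀ x ∈ Ico 1 X, y x < 0 ∧
      0 < K * x ^ (-(1 / 8) : ℝ) * (c - v x) + y x ∧ 0 < v x) → l ≤ v X := by
    rcases hcase with h | h
    · exact ⟨_, mul_pos hb (Real.exp_pos _), fun X hX hP =>
        H.lower_bound_three hα (by linarith) h (by rw [hβ, h]; ring) hX hb hB'
          fun x hx => ⟨(hP x hx).1, (hP x hx).2.2⟩⟩
    · exact ⟨c - (c - b) * Real.exp (4 * K), by linarith, fun X hX hP =>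
        H.lower_bound_exp hX hbc (by linarith) fun x hx => (hP x hx).2.1⟩
  have hF := H.forward_low hγ0 hγ1 hp1 hc hb hbc hK1 hB' hKC hl hlow
  have hlv : ∀ x, 1 < x → l ≤ v x := fun x hx => hlow x hx fun t ht => hF t ht.1
  have hm : MonotoneOn (fun x => -v x) (Ici 1) := fun x hx z _ hxz => by
    have hx1 : 1 ≤ x := hx
    refine le_of_hasDerivAt_nonneg (f := fun x => -v x) hxz
      (fun t ht => (H.hv t (by linarith [ht.1])).neg)
      fun t ht => ?_
    have : 0 < t := by linarith [ht.1]
    rw [← neg_div]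
    exact div_nonneg (by linarith [(hF t (by linarith [ht.1])).1]) (by positivity)
  have hvb : ∀ x, 1 ≤ x → v x ≤ b := fun x hx => by
    have := hm (mem_Ici.2 le_rfl) (mem_Ici.2 hx) hx
    simp only [H.v_one] at this
    linarith
  obtain ⟨L, hL, hvL⟩ := tendsto_of_monotone_of_bdd hm (C := 0) fun x hx => by
    linarith [(hF x hx).2.2]
  have hL' : Tendsto v atTop (nhds (-L)) := by simpa using hL.neg
  have hLl : l ≤ -L := by
    refine ge_of_tendsto hL' ?_
    filter_upwards [eventually_gt_atTop 1] with x hx using hlv x hx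
  have hbL : -L < b := by
    obtain ⟨t, ht, h⟩ := H.exists_slope
    have h1 : y t / (2 * t) < 0 := div_neg_of_neg_of_pos (hF t ht.le).1 (by linarith)
    linarith [hvL 2 one_le_two]
  refine ⟨fun x hx => (hF x hx).2.2, fun x hx => ?_, fun x hx => (hvb x hx).trans (hpow x hx),
    fun x hx => ?_, -L, hl.trans_le hLl, hL', ?_, fun h => absurd h hbc.not_gt, fun _ => hbL⟩
  · rw [abs_of_pos (hF x hx).2.2]
    exact (hvb x hx).trans (hB' x hx)
  · exact (hF x hx).1.trans (mul_pos hα (hF x hx).2.2)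
  · refine tendsto_zero_of_le_rpow (C := K * c) (μ := 1 / 8) (by norm_num) fun x hx => ?_
    obtain ⟨h1, h2, h3⟩ := hF x hx
    rw [abs_of_neg h1]
    have hx0 : 0 < x := by linarith
    have : K * x ^ (-(1 / 8) : ℝ) * (c - v x) ≤ K * x ^ (-(1 / 8) : ℝ) * c :=
      mul_le_mul_of_nonneg_left (by linarith) (by positivity)
    linarith

end IsProfile

/-- The antiderivative of `nl`. -/
noncomputable def nlPot (p β v : ℝ) : ℝ := |v| ^ (p + 1) / (p + 1) - β * v ^ 2 / 2

lemma hasDerivAt_nlPot {p : ℝ} (hp : 1 < p) (β v : ℝ) : HasDerivAt (nlPot p β) (nl p β v) v := by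
  refine (((hasDerivAt_abs_rpow v (by linarith : 1 < p + 1)).div_const (p + 1)).sub
    (((hasDerivAt_pow 2 v).const_mul β).div_const 2)).congr_deriv ?_
  rw [nl, show p + 1 - 2 = p - 1 by ring]
  have : p + 1 ≠ 0 := by linarith
  field_simp
  push_cast
  ring

lemma exists_abs_le_nlPot_add {p β : ℝ} (hp : 1 < p) (hβ : 0 < β) :
    ∃ G, ∀ v, |v| ≤ nlPot p β v + G := by
  set T := ((p + 1) * (β / 2 + 1)) ^ (1 / (p - 1)) with hT
  have hbase : 1 ≤ (p + 1) * (β / 2 + 1) := by nlinarith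
  have hT1 : 1 ≤ T := Real.one_le_rpow hbase (by
    have : 0 < p - 1 := by linarith
    positivity)
  have hTp : T ^ (p - 1) = (p + 1) * (β / 2 + 1) := by
    rw [hT, ← Real.rpow_mul (by linarith), one_div_mul_cancel (by linarith), Real.rpow_one]
  refine ⟨β * T ^ 2 / 2 + T, fun v => ?_⟩
  rw [nlPot, ← sq_abs v]
  have hv := abs_nonneg v
  set t := |v| with ht
  clear_value t
  rcases le_total T t with h | h
  · have h1 : (p + 1) * (β / 2 + 1) ≤ t ^ (p - 1) := by
      rw [← hTp]; exact Real.rpow_le_rpow (by linarith) h (by linarith)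
    have ht0 : 0 < t := by linarith
    have h2 : t ^ (p + 1) = t ^ (p - 1) * t ^ 2 := by
      rw [← Real.rpow_natCast, ← Real.rpow_add ht0]; congr 1; push_cast; ring
    have h3 : (β / 2 + 1) * t ^ 2 ≤ t ^ (p + 1) / (p + 1) := by
      rw [le_div_iff₀ (by linarith), h2]
      nlinarith [mul_le_mul_of_nonneg_right h1 (sq_nonneg t)]
    nlinarith [mul_pos hβ (by positivity : 0 < T ^ 2)]
  · have h1 : 0 ≤ t ^ (p + 1) / (p + 1) := div_nonneg (Real.rpow_nonneg hv _) (by linarith)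
    nlinarith [mul_le_mul_of_nonneg_left (pow_le_pow_left₀ hv h 2) hβ.le]

lemma exists_bound_near {f : ℝ → ℝ} (hf : Continuous f) (b : ℝ) :
    ∃ M, 0 ≤ M ∧ ∀ v, |v - b| ≤ 1 → |f v| ≤ M := by
  obtain ⟨M, hM⟩ := (isCompact_Icc (a := b - 1) (b := b + 1)).exists_bound_of_continuousOn
    hf.continuousOn
  refine ⟨max M 0, le_max_right _ _, fun v hv => (hM v ?_).trans (le_max_left _ _)⟩
  rw [abs_le] at hv
  constructor <;> linarith

namespace IsProfile

variable {γ β p b : ℝ}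

/-- Control slightly to the left of `1`. -/
lemma near_one_bound (hγ0 : 0 < γ) (hγ1 : γ < 1) (hp : 1 < p) :
    ∃ δ Y : ℝ, 0 < δ ∧ δ < 1 ∧ 0 < Y ∧ ∀ B v y D : ℝ → ℝ, IsProfile γ β p b B v y D →
      (∀ x, 0 < x → x ≤ 1 → |b| + 1 ≤ B x) →
      ∀ x ∈ Icc (1 - δ) 1, |y x| < Y ∧ |v x - b| < 1 := by
  obtain ⟨M, hM0, hM⟩ := exists_bound_near (continuous_nl hp β) b
  have hκ : 0 < 1 - γ := by linarith
  set Y := 4 * (M + 1) / (1 - γ) with hY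
  have hY0 : 0 < Y := by positivity
  have hYκ : Y * (1 - γ) = 4 * (M + 1) := by rw [hY]; field_simp
  set δ := min ((1 - γ) / 2) (1 / (4 * Y)) with hδ
  have hδ0 : 0 < δ := lt_min (by linarith) (by positivity)
  have hδ1 : δ ≤ (1 - γ) / 2 := min_le_left _ _
  have hδY : δ * (4 * Y) ≤ 1 := (le_div_iff₀ (by positivity)).1 (min_le_right _ _)
  refine ⟨δ, Y, hδ0, by linarith, hY0, fun B v y D H hB => ?_⟩
  have hnl : ∀ x, 0 < x → x ≤ 1 → |v x - b| < 1 →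
      |2 * x * (x - 1) * D x + (x - γ) * y x| ≤ M := by
    intro x hx hx1 hv
    rw [H.eq x hx]
    · exact hM _ hv.le
    · have := abs_sub_abs_le_abs_sub (v x) b
      linarith [hB x hx hx1]
  have hmain : ∀ s ∈ Icc 1 (1 + δ), (0 < Y - y (2 - s) ∧ 0 < Y + y (2 - s)) ∧
      |v (2 - s) - b| < 1 := by
    refine forall_of_step ?_ ?_ ?_
    · have h1 := hnl 1 one_pos le_rfl (by rw [H.v_one]; simp)
      rw [abs_le] at h1
      rw [show (2 : ℝ) - 1 = 1 by norm_num, H.v_one]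
      refine ⟨⟨?_, ?_⟩, by simp⟩
      · refine pos_of_mul_pos_right (a := 1 - γ) ?_ hκ.le
        linarith
      · refine pos_of_mul_pos_right (a := 1 - γ) ?_ hκ.le
        linarith
    · intro s hs hP
      have hs0 : 0 < 2 - s := by linarith [hs.2]
      have c1 := ((H.hy _ hs0).comp_const_sub 2 s).continuousAt
      have c2 := ((H.hv _ hs0).comp_const_sub 2 s).continuousAt
      have c3 : ContinuousAt (fun s => Y - y (2 - s)) s := continuousAt_const.sub c1
      have c4 : ContinuousAt (fun s => Y + y (2 - s)) s := continuousAt_const.add c1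
      have c5 : ContinuousAt (fun s => |v (2 - s) - b|) s := (c2.sub continuousAt_const).abs
      exact ((c3.eventually (lt_mem_nhds hP.1.1)).and (c4.eventually (lt_mem_nhds hP.1.2))).and
        (c5.eventually (gt_mem_nhds hP.2))
    · intro s hs hP
      obtain ⟨x, rfl⟩ : ∃ x, s = 2 - x := ⟨2 - s, by ring⟩
      rw [show 2 - (2 - x) = x by ring]
      have hx1 : x < 1 := by linarith [hs.1]
      have hxδ : 1 - δ ≤ x := by linarith [hs.2]
      have hxh : 1 / 2 < x := by linarith
      have hx0 : 0 < x := by linarith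
      have hP' : ∀ t ∈ Ioo x 1, |y t| < Y := by
        intro t ht
        have := (hP (2 - t) ⟨by linarith [ht.2], by linarith [ht.1]⟩).1
        rw [show 2 - (2 - t) = t by ring] at this
        rw [abs_lt]; constructor <;> linarith
      have hyt : ∀ t ∈ Ioo x 1, |y t / (2 * t)| ≤ Y := by
        intro t ht
        have h2 : 1 < 2 * t := by linarith [ht.1]
        rw [abs_div, abs_of_pos (by linarith : 0 < 2 * t)]
        refine (div_le_self (abs_nonneg _) h2.le).trans (hP' t ht).le
      have hvx : |v x - b| < 1 := by
        have hder : ∀ t ∈ Icc x 1, HasDerivAt v (y t / (2 * t)) t := fun t ht =>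
          H.hv t (by linarith [ht.1])
        have h1 := le_of_hasDerivAt_nonneg (f := fun t => t * Y - v t) hx1.le
          (fun t ht => ((hasDerivAt_id t).mul_const Y).sub (hder t ht))
          fun t ht => by linarith [(abs_le.1 (hyt t ht)).2]
        have h2 := le_of_hasDerivAt_nonneg (f := fun t => t * Y + v t) hx1.le
          (fun t ht => ((hasDerivAt_id t).mul_const Y).add (hder t ht))
          fun t ht => by linarith [(abs_le.1 (hyt t ht)).1]
        simp only [H.v_one] at h1 h2
        have h3 : (1 - x) * Y ≤ 1 / 4 := by nlinarith
        rw [abs_lt]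
        constructor <;> linarith
      have hq := hnl x hx0 hx1.le hvx
      have hpp : 0 < 2 * x * (1 - x) := mul_pos (by linarith) (by linarith)
      have hYx : M < (x - γ) * Y := by
        have : (1 - γ) / 2 * Y ≤ (x - γ) * Y := mul_le_mul_of_nonneg_right (by linarith) hY0.le
        linarith
      rw [abs_le] at hq
      have hx2 : 2 - (2 - x) = x := by ring
      refine ⟨⟨?_, ?_⟩, hvx⟩
      · have := pos_of_barrier (h := fun s => Y - y (2 - s)) (x := 2 - x) hs.1
          (fun z hz => (hP z hz).1.1)
          (((H.hy (2 - (2 - x)) (by linarith)).comp_const_sub 2 (2 - x)).const_sub Y) fun h => by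
            rw [hx2] at h ⊢
            refine pos_of_mul_pos_right (a := 2 * x * (1 - x)) ?_ hpp.le
            rw [show y x = Y by linarith] at hq
            linarith
        simpa only [hx2] using this
      · have := pos_of_barrier (h := fun s => Y + y (2 - s)) (x := 2 - x) hs.1
          (fun z hz => (hP z hz).1.2)
          (((H.hy (2 - (2 - x)) (by linarith)).comp_const_sub 2 (2 - x)).const_add Y) fun h => by
            rw [hx2] at h ⊢
            refine pos_of_mul_pos_right (a := 2 * x * (1 - x)) ?_ hpp.le
            rw [show y x = -Y by linarith] at hq
            linarith
        simpa only [hx2] using this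
  intro x hx
  have := hmain (2 - x) ⟨by linarith [hx.2], by linarith [hx.1]⟩
  rw [show 2 - (2 - x) = x by ring] at this
  refine ⟨?_, this.2⟩
  rw [abs_lt]; constructor <;> linarith [this.1.1, this.1.2]

/-- A priori bound on `(0, 1]`, by monotonicity of a weighted energy. -/
lemma backward_bound (hγ0 : 0 < γ) (hγ1 : γ < 1) (hβ : 0 < β) (hp : 1 < p) :
    ∃ C : ℝ, ∀ B v y D : ℝ → ℝ, IsProfile γ β p b B v y D → ContinuousOn B (Ioi 0) →
      (∀ x, 0 < x → x ≤ 1 → |b| + 1 ≤ B x) → (∀ x, 0 < x → x < 1 → C / x < B x) →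
      ∀ x, 0 < x → x ≤ 1 → |v x| ≤ B x := by
  obtain ⟨δ, Y, hδ0, hδ1, hY0, hnear⟩ := near_one_bound (β := β) (b := b) hγ0 hγ1 hp
  obtain ⟨G, hG⟩ := exists_abs_le_nlPot_add hp hβ
  obtain ⟨M, hM0, hM⟩ := exists_bound_near (f := nlPot p β)
    (continuous_iff_continuousAt.2 fun v => (hasDerivAt_nlPot hp β v).continuousAt) b
  set w : ℝ → ℝ := fun x => (x / (1 - x)) ^ γ with hw
  set C := w (1 - δ) * (Y ^ 2 / 2 + M + G) with hC
  refine ⟨C, fun B v y D H hBc hB1 hB2 => ?_⟩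
  have hn := hnear B v y D H hB1
  have hclose : ∀ x ∈ Icc (1 - δ) 1, |v x| < B x := by
    intro x hx
    have h1 := (hn x hx).2
    have := abs_sub_abs_le_abs_sub (v x) b
    linarith [hB1 x (by linarith [hx.1]) hx.2]
  set Q : ℝ → ℝ := fun x => w x * ((1 - x) * y x ^ 2 / 2 + nlPot p β (v x) + G) with hQ
  have hwpos : ∀ x, 0 < x → x < 1 → 0 < w x := fun x h0 h1 =>
    Real.rpow_pos_of_pos (div_pos h0 (by linarith)) _
  have hQd : ∀ x, 0 < x → x < 1 → HasDerivAt Q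
      (γ * (w x / (x * (1 - x))) * ((1 - x) * y x ^ 2 / 2 + nlPot p β (v x) + G) +
        w x * (-(y x ^ 2) / 2 + (1 - x) * y x * D x + nl p β (v x) * (y x / (2 * x)))) x := by
    intro x h0 h1
    have hx1 : 1 - x ≠ 0 := by linarith
    have hdiv : x / (1 - x) ≠ 0 := div_ne_zero h0.ne' hx1
    have hwd : HasDerivAt w (γ * (w x / (x * (1 - x)))) x := by
      refine (((hasDerivAt_id x).div ((hasDerivAt_id x).const_sub 1) hx1).rpow_const
        (p := γ) (Or.inl hdiv)).congr_deriv ?_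
      simp only [id, Pi.div_apply]
      rw [Real.rpow_sub_one hdiv]
      simp only [hw]
      field_simp
      ring
    refine (hwd.mul ((((((hasDerivAt_id x).const_sub 1).mul ((H.hy x h0).pow 2)).div_const
      2).add ((hasDerivAt_nlPot hp β (v x)).comp x (H.hv x h0))).add_const G)).congr_deriv ?_
    simp
    left
    ring
  have hQle : ∀ x, 0 < x → x < 1 → w x * |v x| ≤ Q x := by
    intro x h0 h1
    refine mul_le_mul_of_nonneg_left ?_ (hwpos x h0 h1).le
    have : 0 ≤ (1 - x) * y x ^ 2 / 2 := by
      have : 0 < 1 - x := by linarith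
      positivity
    linarith [hG (v x)]
  have hx0 : Q (1 - δ) ≤ C := by
    refine mul_le_mul_of_nonneg_left ?_ (hwpos _ (by linarith) (by linarith)).le
    obtain ⟨h1, h2⟩ := hn (1 - δ) ⟨le_rfl, by linarith⟩
    have h3 := (abs_le.1 (hM _ h2.le)).2
    have h4 : y (1 - δ) ^ 2 ≤ Y ^ 2 := by
      rw [← sq_abs]; exact pow_le_pow_left₀ (abs_nonneg _) h1.le 2
    have h5 : (1 - (1 - δ)) * y (1 - δ) ^ 2 ≤ 1 * Y ^ 2 :=
      mul_le_mul (by linarith) h4 (sq_nonneg _) zero_le_one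
    linarith
  have hmain : ∀ x1, 0 < x1 → x1 < 1 - δ → ∀ s ∈ Icc (-(1 - δ)) (-x1), |v (-s)| < B (-s) := by
    intro x1 hx1 hx1δ
    refine forall_of_step ?_ ?_ ?_
    · rw [neg_neg]; exact hclose _ ⟨le_rfl, by linarith⟩
    · intro s hs hP
      have hs0 : 0 < -s := by linarith [hs.2]
      have c1 : ContinuousAt (fun s => |v (-s)|) s :=
        (ContinuousAt.comp (f := Neg.neg) (g := v) (x := s) (H.hv (-s) hs0).continuousAt
          continuous_neg.continuousAt).abs
      have c2 : ContinuousAt (fun s => B (-s)) s :=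
        ContinuousAt.comp (f := Neg.neg) (g := B) (x := s)
          (hBc.continuousAt (Ioi_mem_nhds hs0)) continuous_neg.continuousAt
      exact c1.eventually_lt c2 hP
    · intro s hs hP
      obtain ⟨x, rfl⟩ : ∃ x, s = -x := ⟨-s, by ring⟩
      rw [neg_neg]
      have hx0' : 0 < x := by linarith [hs.2]
      have hxδ : x < 1 - δ := by linarith [hs.1]
      have hx1' : x < 1 := by linarith
      have hle := le_of_hasDerivAt_nonneg (f := Q) hxδ.le
        (fun t ht => hQd t (by linarith [ht.1]) (by linarith [ht.2])) fun t ht => by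
          have ht0 : 0 < t := by linarith [ht.1]
          have ht1 : 0 < 1 - t := by linarith [ht.2]
          have hv := hP (-t) ⟨by linarith [ht.2], by linarith [ht.1]⟩
          rw [neg_neg] at hv
          have heq := H.eq t ht0 hv.le
          rw [← heq]
          have e : γ * (w t / (t * (1 - t))) * ((1 - t) * y t ^ 2 / 2 + nlPot p β (v t) + G) +
              w t * (-(y t ^ 2) / 2 + (1 - t) * y t * D t +
                (2 * t * (t - 1) * D t + (t - γ) * y t) * (y t / (2 * t))) =
              γ * (w t / (t * (1 - t))) * (nlPot p β (v t) + G) := by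
            field_simp
            ring
          rw [e]
          have h1 := hwpos t ht0 (by linarith)
          have h2 := (abs_nonneg (v t)).trans (hG (v t))
          positivity
      have h1 := (hQle x hx0' hx1').trans (hle.trans hx0)
      refine lt_of_le_of_lt ?_ (hB2 x hx0' hx1')
      have h2 : x ≤ w x := by
        have h3 : x ≤ x / (1 - x) := le_div_self hx0'.le (by linarith) (by linarith)
        calc x = x ^ (1 : ℝ) := (Real.rpow_one x).symm
          _ ≤ x ^ γ := Real.rpow_le_rpow_of_exponent_ge hx0' hx1'.le hγ1.le
          _ ≤ w x := Real.rpow_le_rpow hx0'.le h3 hγ0.le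
      rw [le_div_iff₀ hx0']
      nlinarith [abs_nonneg (v x)]
  intro x h0 h1
  rcases le_or_gt (1 - δ) x with h | h
  · exact (hclose x ⟨h, h1⟩).le
  · have := hmain x h0 h (-x) ⟨by linarith, le_rfl⟩
    rw [neg_neg] at this
    exact this.le

end IsProfile

lemma mul_rpow_le_level {b R q s x : ℝ} (hb : 0 ≤ b) (hbR : b ≤ R) (hs : 0 ≤ s) (hsq : s ≤ q)
    (hx : 1 ≤ x) : b * x ^ s ≤ level R q x := by
  have hx0 : 0 < x := by linarith
  have h1 : x ≤ x + 1 / x := by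
    have : 0 < 1 / x := by positivity
    linarith
  refine mul_le_mul hbR ?_ (by positivity) (hb.trans hbR)
  exact (Real.rpow_le_rpow hx0.le h1 hs).trans
    (Real.rpow_le_rpow_of_exponent_le (one_le_add_inv hx0) hsq)

lemma div_lt_level {C R q x : ℝ} (hCR : C < R) (hR : 0 ≤ R) (hq : 1 ≤ q) (hx : 0 < x) :
    C / x < level R q x := by
  have h1 : 1 / x ≤ x + 1 / x := by linarith
  calc C / x < R / x := by gcongr
    _ = R * (1 / x) := by ring
    _ ≤ R * (x + 1 / x) := by gcongr
    _ = R * (x + 1 / x) ^ (1 : ℝ) := by rw [Real.rpow_one]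
    _ ≤ level R q x := mul_le_mul_of_nonneg_left
      (Real.rpow_le_rpow_of_exponent_le (one_le_add_inv hx) hq) hR

/-- Global existence of profiles for data strictly between the threshold and `b₀`. -/
theorem exists_global_profile {γ β p α b c K : ℝ} (hγ0 : 0 < γ) (hγ1 : γ < 1)
    (hα : 0 < α) (hβ : β = α * (γ + α)) (hp : (p - 1) * α = 2) (hp1 : 1 < p) (hb : 0 < b)
    (hc0 : 0 < c) (hc : c ^ (p - 1) = β) (hb0 : b ^ (p - 1) < α * (α + 1))
    (hK : K = 2 * ((p - 1) * β) / (1 - γ) + 1)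
    (hcase : b < c → γ = 1 - 2 * α ∨ (c - b) * Real.exp (4 * K) < c) :
    ∃ B v y D : ℝ → ℝ, IsProfile γ β p b B v y D ∧ (∀ x, 0 < x → |v x| ≤ B x) ∧
      ForwardGlobal α b c B v y := by
  have hβ0 : 0 < β := by rw [hβ]; positivity
  rcases eq_or_ne b c with rfl | hne
  · have hnl : nl p β b = 0 := by rw [nl_of_pos hb, hc]; ring
    refine ⟨fun _ => b, fun _ => b, fun _ => 0, fun _ => 0,
      ⟨rfl, fun x _ => by simpa using hasDerivAt_const x b, fun x _ => hasDerivAt_const x 0,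
        continuousOn_const, fun x _ _ => by simp [hnl]⟩,
      fun x _ => (abs_of_pos hb).le, ⟨fun _ _ => hb, fun x _ => (abs_of_pos hb).le,
        fun x hx => le_mul_of_one_le_right hb.le (Real.one_le_rpow hx (by linarith)),
        fun x _ => mul_pos hα hb, b, hb, tendsto_const_nhds, tendsto_const_nhds,
        fun h => absurd h (lt_irrefl _), fun h => absurd h (lt_irrefl _)⟩⟩
  · obtain ⟨C, hC⟩ := IsProfile.backward_bound (b := b) hγ0 hγ1 hβ0 hp1
    set q := max (α / 2) 1 with hq
    have hq1 : 1 ≤ q := le_max_right _ _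
    have hqα : α / 2 ≤ q := le_max_left _ _
    set R := max (b + 1) (C + 1) with hR
    have hRb : b + 1 ≤ R := le_max_left _ _
    have hRC : C + 1 ≤ R := le_max_right _ _
    have hR0 : 0 ≤ R := by linarith
    obtain ⟨v, y, D, H⟩ := exists_profile hγ0 hγ1 hβ0 hp1 hb (by linarith : b < R)
      (by linarith : 0 ≤ q)
    have hB : ∀ x, 1 ≤ x → b * x ^ (α / 2) ≤ level R q x := fun x hx =>
      mul_rpow_le_level hb.le (by linarith) (by linarith) hqα hx
    have hF : ForwardGlobal α b c (level R q) v y := by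
      rcases hne.lt_or_gt with h | h
      · exact H.forwardGlobal_low hγ0 hγ1 hα hβ hp1 hb hB hc h hK (hcase h)
      · exact H.forwardGlobal_high hγ0 hγ1 hα hβ hp hp1 hb hB hc0 hc hb0 h
    refine ⟨_, v, y, D, H, fun x hx => ?_, hF⟩
    rcases le_total x 1 with h | h
    · refine hC _ v y D H (continuousOn_level R q) (fun t ht _ => ?_) (fun t ht _ => ?_) x hx h
      · rw [abs_of_pos hb]
        exact hRb.trans (le_level hR0 (by linarith) ht)
      · exact div_lt_level (by linarith) hR0 hq1 ht
    · exact hF.abs_le x h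

lemma contDiffOn_two_of_hasDerivAt {f f1 f2 : ℝ → ℝ} {s : Set ℝ} (hs : IsOpen s)
    (h1 : ∀ x ∈ s, HasDerivAt f (f1 x) x) (h2 : ∀ x ∈ s, HasDerivAt f1 (f2 x) x)
    (hc : ContinuousOn f2 s) : ContDiffOn ℝ 2 f s := by
  have e1 : EqOn (deriv f) f1 s := fun x hx => (h1 x hx).deriv
  have e2 : EqOn (deriv f1) f2 s := fun x hx => (h2 x hx).deriv
  have c0 : ContDiffOn ℝ 0 (deriv f1) s := contDiffOn_zero.2 (hc.congr e2)
  have c1 : ContDiffOn ℝ (0 + 1) f1 s := (contDiffOn_succ_iff_deriv_of_isOpen hs).2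
    ⟨fun x hx => (h2 x hx).differentiableAt.differentiableWithinAt, by simp, c0⟩
  have c2 : ContDiffOn ℝ (0 + 1 + 1) f s := (contDiffOn_succ_iff_deriv_of_isOpen hs).2
    ⟨fun x hx => (h1 x hx).differentiableAt.differentiableWithinAt, by simp, c1.congr e1⟩
  have : (0 + 1 + 1 : WithTop ℕ∞) = 2 := by norm_num
  rwa [this] at c2

namespace IsProfile

variable {γ β p b : ℝ} {B v y D : ℝ → ℝ}

lemma hasDerivAt_comp_sq {f : ℝ → ℝ} {d x : ℝ} (hf : HasDerivAt f d (x ^ 2)) :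
    HasDerivAt (fun x => f (x ^ 2)) (d * (2 * x)) x := by
  have h : HasDerivAt (fun x : ℝ => x ^ 2) (2 * x) x := by simpa using hasDerivAt_pow 2 x
  exact HasDerivAt.comp x hf h

lemma hasDerivAt_sol (H : IsProfile γ β p b B v y D) (α : ℝ) {x : ℝ} (hx : 0 < x) :
    HasDerivAt (fun x => x ^ (-α) * v (x ^ 2))
      (x ^ (-α - 1) * (y (x ^ 2) - α * v (x ^ 2))) x := by
  have h2 : 0 < x ^ 2 := by positivity
  refine ((Real.hasDerivAt_rpow_const (p := -α) (Or.inl hx.ne')).mul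
    (hasDerivAt_comp_sq (H.hv _ h2))).congr_deriv ?_
  rw [Real.rpow_sub_one hx.ne']
  field_simp
  ring

lemma hasDerivAt_deriv_sol (H : IsProfile γ β p b B v y D) (α : ℝ) {x : ℝ} (hx : 0 < x) :
    HasDerivAt (fun x => x ^ (-α - 1) * (y (x ^ 2) - α * v (x ^ 2)))
      (x ^ (-α - 1 - 1) * ((-α - 1) * (y (x ^ 2) - α * v (x ^ 2)) +
        2 * x ^ 2 * D (x ^ 2) - α * y (x ^ 2))) x := by
  have h2 : 0 < x ^ 2 := by positivity
  refine ((Real.hasDerivAt_rpow_const (p := -α - 1) (Or.inl hx.ne')).mul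
    ((hasDerivAt_comp_sq (H.hy _ h2)).sub
      ((hasDerivAt_comp_sq (H.hv _ h2)).const_mul α))).congr_deriv ?_
  rw [Real.rpow_sub_one hx.ne' (-α - 1)]
  simp only [Pi.sub_apply]
  field_simp
  ring

lemma contDiffOn_sol (H : IsProfile γ β p b B v y D) (α : ℝ) :
    ContDiffOn ℝ 2 (fun x => x ^ (-α) * v (x ^ 2)) (Ioi 0) := by
  refine contDiffOn_two_of_hasDerivAt isOpen_Ioi (fun x hx => H.hasDerivAt_sol α hx)
    (fun x hx => H.hasDerivAt_deriv_sol α hx) ?_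
  have hpow : ContinuousOn (fun x : ℝ => x ^ (-α - 1 - 1)) (Ioi 0) :=
    continuousOn_id.rpow_const fun x hx => Or.inl (ne_of_gt hx)
  have hm : MapsTo (fun x : ℝ => x ^ 2) (Ioi 0) (Ioi 0) := fun x hx => by
    have : (0 : ℝ) < x := hx
    exact mem_Ioi.2 (by positivity)
  have hsq : ContinuousOn (fun x : ℝ => x ^ 2) (Ioi 0) := (continuous_pow 2).continuousOn
  have cv : ContinuousOn (fun x => v (x ^ 2)) (Ioi 0) := ContinuousOn.comp (g := v)
    (fun x hx => (H.hv x hx).continuousAt.continuousWithinAt) hsq hm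
  have cy : ContinuousOn (fun x => y (x ^ 2)) (Ioi 0) := ContinuousOn.comp (g := y)
    (fun x hx => (H.hy x hx).continuousAt.continuousWithinAt) hsq hm
  have cD : ContinuousOn (fun x => D (x ^ 2)) (Ioi 0) := H.hD.comp hsq hm
  exact hpow.mul (((continuousOn_const.mul (cy.sub (continuousOn_const.mul cv))).add
    ((continuousOn_const.mul hsq).mul cD)).sub (continuousOn_const.mul cy))

lemma isSolOn_sol {N : ℕ} (hβ : β = alphaP p * (γ + alphaP p))
    (hγ : γ = N - 2 - 2 * alphaP p) (hp1 : 1 < p)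
    (H : IsProfile γ β p b B v y D) (hB : ∀ x, 0 < x → |v x| ≤ B x) :
    IsSolOn N p (fun x => x ^ (-alphaP p) * v (x ^ 2)) (Ioi 0) := by
  have hα : (p - 1) * alphaP p = 2 := by
    rw [alphaP]; have : p - 1 ≠ 0 := by linarith
    field_simp
  unfold IsSolOn
  set α := alphaP p with hαdef
  clear_value α
  intro x hx
  beta_reduce
  have hx0 : 0 < x := hx
  have h1 := (H.hasDerivAt_sol α hx0).deriv
  have h2 : deriv (deriv fun x => x ^ (-α) * v (x ^ 2)) x = x ^ (-α - 1 - 1) *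
      ((-α - 1) * (y (x ^ 2) - α * v (x ^ 2)) + 2 * x ^ 2 * D (x ^ 2) - α * y (x ^ 2)) := by
    refine ((H.hasDerivAt_deriv_sol α hx0).congr_of_eventuallyEq ?_).deriv
    filter_upwards [Ioi_mem_nhds hx0] with t ht using (H.hasDerivAt_sol α ht).deriv
  rw [h1, h2]
  have h3 : |x ^ (-α) * v (x ^ 2)| ^ (p - 1) = |v (x ^ 2)| ^ (p - 1) / x ^ 2 := by
    rw [abs_mul, abs_of_pos (by positivity : 0 < x ^ (-α)),
      Real.mul_rpow (by positivity) (abs_nonneg _), ← Real.rpow_mul hx0.le,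
      show -α * (p - 1) = -(2 : ℕ) by push_cast; linarith, Real.rpow_neg hx0.le,
      Real.rpow_natCast]
    field_simp
  have h4 : 0 < x ^ 2 := by positivity
  have heq := H.eq _ h4 (hB _ h4)
  rw [nl] at heq
  rw [h3, Real.rpow_sub_one hx0.ne', Real.rpow_sub_one hx0.ne']
  have hX : 0 < x ^ (-α) := by positivity
  set X := x ^ (-α)
  clear_value X
  generalize |v (x ^ 2)| ^ (p - 1) = W at heq ⊢
  generalize v (x ^ 2) = V at heq ⊢
  generalize y (x ^ 2) = Y at heq ⊢
  generalize D (x ^ 2) = Z at heq ⊢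
  have hN : (N : ℝ) = γ + 2 + 2 * α := by linarith
  rw [hN]
  subst hβ
  field_simp
  linear_combination (-1) * X * heq

end IsProfile

lemma tendsto_sol {L : ℝ} {v y : ℝ → ℝ} {U : ℝ → ℝ} {α : ℝ}
    (hU : ∀ x, 0 < x → U x = x ^ (-α) * v (x ^ 2))
    (hU' : ∀ x, 0 < x → deriv U x = x ^ (-α - 1) * (y (x ^ 2) - α * v (x ^ 2)))
    (hv : Tendsto v atTop (nhds L)) (hy : Tendsto y atTop (nhds 0)) :
    Tendsto (fun x => x ^ α * U x) atTop (nhds L) ∧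
      Tendsto (fun x => x ^ (α + 1) * deriv U x) atTop (nhds (-α * L)) := by
  have hsq : Tendsto (fun x : ℝ => x ^ 2) atTop atTop := tendsto_pow_atTop two_ne_zero
  constructor
  · refine (hv.comp hsq).congr' ?_
    filter_upwards [eventually_gt_atTop 0] with x hx
    rw [hU x hx, ← mul_assoc, ← Real.rpow_add hx]
    simp
  · have h := (hy.comp hsq).sub ((hv.comp hsq).const_mul α)
    rw [show 0 - α * L = -α * L by ring] at h
    refine h.congr' ?_
    filter_upwards [eventually_gt_atTop 0] with x hx
    rw [hU' x hx, ← mul_assoc, ← Real.rpow_add hx]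
    simp

/-- Finite-time blow-up above the constant solution: a quantitative version in which the maximal
existence time is controlled by the initial value only. -/
lemma blowup {n α p b : ℝ} (hp1 : 1 < p) (hα : 0 < α) (hn : 1 ≤ n) (hn2 : n < 2 * α + 3)
    (hn3 : 2 * α + 2 < n) (hb : 0 < b) (hbp : α * (α + 1) < b ^ (p - 1)) :
    ∃ T : ℝ, ∀ (σ : ℝ) (u w w' : ℝ → ℝ), 1 < σ →
      (∀ x ∈ Ico 1 σ, HasDerivAt u (w x) x) → (∀ x ∈ Ico 1 σ, HasDerivAt w (w' x) x) →
      (∀ x ∈ Ico 1 σ, (1 - x ^ 2) * w' x + ((n - 1) / x - 2 * (α + 1) * x) * w x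
        - α * (α + 1) * u x + |u x| ^ (p - 1) * u x = 0) → u 1 = b →
      σ ≤ T ∧ ∀ x ∈ Ico 1 σ, b ≤ u x := by
  set q := (p + 1) / 2 with hq
  have hq1 : 1 < q := by rw [hq]; linarith
  set m := b ^ (q - p) with hm
  have hm0 : 0 < m := by positivity
  set θ := 1 - α * (α + 1) / b ^ (p - 1) with hθ
  have hbp0 : 0 < b ^ (p - 1) := by positivity
  have hθ0 : 0 < θ := by
    have := (div_lt_one hbp0).2 hbp
    rw [hθ]; linarith
  set A := 2 * (α + 1) * m + q with hA
  have hA0 : 0 < A := by positivity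
  set ε := min 1 (θ / (2 * A)) with hε
  have hε0 : 0 < ε := lt_min one_pos (by positivity)
  have hε1 : ε ≤ 1 := min_le_left _ _
  have hεA : ε * A < θ := by
    have : ε * (2 * A) ≤ θ := (le_div_iff₀ (by positivity)).1 (min_le_right _ _)
    linarith
  have hsmall : 2 * (α + 1) * (ε * m) + ε ^ 2 * q < θ := by
    have h1 : ε ^ 2 * q ≤ ε * q := by
      refine mul_le_mul_of_nonneg_right ?_ (by linarith)
      nlinarith
    have h2 : ε * A = 2 * (α + 1) * (ε * m) + ε * q := by rw [hA]; ring
    linarith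
  have hug : ∀ u : ℝ, b ≤ u → θ * (u ^ (p - 1) * u) ≤ u ^ (p - 1) * u - α * (α + 1) * u ∧
      u ^ q ≤ m * (u ^ (p - 1) * u) := by
    intro u hu
    have hu0 : 0 < u := hb.trans_le hu
    constructor
    · have h1 : b ^ (p - 1) ≤ u ^ (p - 1) := Real.rpow_le_rpow hb.le hu (by linarith)
      have h2 : α * (α + 1) ≤ α * (α + 1) / b ^ (p - 1) * u ^ (p - 1) := by
        rw [div_mul_eq_mul_div, le_div_iff₀ hbp0]
        exact mul_le_mul_of_nonneg_left h1 (by positivity)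
      rw [hθ]
      nlinarith [mul_le_mul_of_nonneg_right h2 hu0.le]
    · have h1 : u ^ (q - p) ≤ m :=
        Real.rpow_le_rpow_of_nonpos hb hu (by rw [hq]; linarith)
      have h2 : u ^ q = u ^ (q - p) * (u ^ (p - 1) * u) := by
        rw [← Real.rpow_add_one hu0.ne', ← Real.rpow_add hu0]
        congr 1; ring
      rw [h2]
      exact mul_le_mul_of_nonneg_right h1 (by positivity)
  refine ⟨Real.exp (b ^ (1 - q) / ((q - 1) * ε)), fun σ u w w' hσ hu hw heq hu1 => ?_⟩
  have hmono : ∀ X ∈ Ico 1 σ, (∀ z ∈ Ico 1 X, 0 < w z) → b ≤ u X := by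
    intro X hX hP
    rw [← hu1]
    exact le_of_hasDerivAt_nonneg hX.1 (fun t ht => hu t ⟨ht.1, ht.2.trans_lt hX.2⟩)
      fun t ht => (hP t ⟨ht.1.le, ht.2⟩).le
  have hmain : ∀ X ∈ Ico 1 σ, ∀ x ∈ Icc 1 X, 0 < w x ∧ 0 < x * w x - ε * u x ^ q := by
    intro X hX
    refine forall_of_step ?_ ?_ ?_
    · have h1 := heq 1 ⟨le_rfl, hσ⟩
      rw [hu1, abs_of_pos hb] at h1
      obtain ⟨h2, h3⟩ := hug b le_rfl
      have hpos : 0 < b ^ (p - 1) * b := by positivity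
      have h4 : 0 < 1 * w 1 - ε * u 1 ^ q := by
        rw [hu1]
        refine pos_of_mul_pos_right (a := 2 * α + 3 - n) ?_ (by linarith)
        have h5 : (2 * α + 3 - n) * w 1 = b ^ (p - 1) * b - α * (α + 1) * b := by
          linear_combination (-1) * h1
        have h6 : (2 * α + 3 - n) * (ε * b ^ q) ≤ 1 * (ε * b ^ q) :=
          mul_le_mul_of_nonneg_right (by linarith) (by positivity)
        have h7 := mul_le_mul_of_nonneg_left h3 hε0.le
        have h8 : ε * m < θ := by
          have k1 : 0 < ε * m * α := by positivity
          have k2 : 0 < ε * m := by positivity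
          have k3 : 0 < ε ^ 2 * q := by positivity
          linarith
        have h9 := mul_lt_mul_of_pos_right h8 hpos
        linarith
      have : 0 < ε * u 1 ^ q := by rw [hu1]; positivity
      exact ⟨by linarith, h4⟩
    · intro x hx hPx
      have hxσ : x ∈ Ico 1 σ := ⟨hx.1, hx.2.trans hX.2⟩
      have c1 := (hw x hxσ).continuousAt
      have c2 := (hu x hxσ).continuousAt
      have c4 : ContinuousAt (fun x => u x ^ q) x := c2.rpow_const (Or.inr (by linarith))
      have c3 : ContinuousAt (fun x => x * w x - ε * u x ^ q) x := by fun_prop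
      exact (c1.eventually (lt_mem_nhds hPx.1)).and (c3.eventually (lt_mem_nhds hPx.2))
    · intro x hx hP
      have hxσ : x ∈ Ico 1 σ := ⟨hx.1.le, hx.2.trans_lt hX.2⟩
      have hx1 : 1 < x := hx.1
      have hx0 : 0 < x := by linarith
      have hbu := hmono x hxσ fun z hz => (hP z hz).1
      have hu0 : 0 < u x := hb.trans_le hbu
      have hpos : 0 < x * w x - ε * u x ^ q := by
        refine pos_of_barrier (h := fun x => x * w x - ε * u x ^ q) hx1
          (fun z hz => (hP z hz).2) (((hasDerivAt_id x).mul (hw x hxσ)).sub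
            (((hu x hxσ).rpow_const (p := q) (Or.inl hu0.ne')).const_mul ε)) fun h => ?_
        have h0 := heq x hxσ
        rw [abs_of_pos hu0] at h0
        obtain ⟨h2, h3⟩ := hug (u x) hbu
        have hx2 : 0 < x ^ 2 - 1 := by nlinarith
        refine pos_of_mul_pos_right (a := x ^ 2 - 1) ?_ hx2.le
        have hUp : 0 < u x ^ (p - 1) * u x := by positivity
        have hqq : u x ^ (q - 1) * u x ^ q = u x ^ (p - 1) * u x := by
          rw [← Real.rpow_add hu0, ← Real.rpow_add_one hu0.ne']
          congr 1; rw [hq]; ring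
        have hS : 0 < u x ^ q := by positivity
        set S := u x ^ q
        set S' := u x ^ (q - 1)
        set P := u x ^ (p - 1) * u x
        clear_value S S' P
        have hwS : w x = ε * S / x := by
          rw [eq_div_iff hx0.ne']; linarith
        have e1 : (x ^ 2 - 1) * (1 * w x + id x * w' x - ε * (w x * q * S')) =
            x * (P - α * (α + 1) * u x - 2 * (α + 1) * (ε * S) - ε ^ 2 * q * P)
              + (x ^ 2 - 1 + (n - 1)) * (ε * S / x) + ε ^ 2 * q * P / x := by
          have h4 : (x ^ 2 - 1) * w' x = ((n - 1) / x - 2 * (α + 1) * x) * w x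
              - α * (α + 1) * u x + P := by linarith
          have h5 : (x ^ 2 - 1) * (1 * w x + id x * w' x - ε * (w x * q * S')) =
            (x ^ 2 - 1) * w x + x * ((x ^ 2 - 1) * w' x)
              - (x ^ 2 - 1) * ε * q * S' * w x := by simp only [id]; ring
          rw [h5, h4, hwS, ← hqq]
          field_simp
          ring
        rw [e1]
        have h6 : 0 < P - α * (α + 1) * u x - 2 * (α + 1) * (ε * S) - ε ^ 2 * q * P := by
          have h7 : 2 * (α + 1) * (ε * S) ≤ 2 * (α + 1) * (ε * (m * P)) := by gcongr
          have h8 := mul_lt_mul_of_pos_right hsmall hUp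
          linarith
        have h9 : 0 ≤ x ^ 2 - 1 + (n - 1) := by linarith
        positivity
      refine ⟨?_, hpos⟩
      have : 0 < ε * u x ^ q := by positivity
      exact pos_of_mul_pos_right (a := x) (by linarith) hx0.le
  have hub : ∀ x ∈ Ico 1 σ, b ≤ u x := fun x hx =>
    hmono x hx fun z hz => (hmain x hx z ⟨hz.1, hz.2.le⟩).1
  refine ⟨?_, hub⟩
  refine le_of_forall_lt fun z hz => ?_
  rcases lt_or_ge z 1 with h | h
  · exact h.trans_le (Real.one_le_exp (by
      have : 0 < q - 1 := by linarith
      positivity))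
  have hlog := le_of_hasDerivAt_nonneg
    (f := fun x => -(u x ^ (1 - q) + (q - 1) * ε * Real.log x)) h
    (fun t ht => by
      have htσ : t ∈ Ico 1 σ := ⟨ht.1, ht.2.trans_lt hz⟩
      have hu0 : 0 < u t := hb.trans_le (hub t htσ)
      exact (((hu t htσ).rpow_const (p := 1 - q) (Or.inl hu0.ne')).add
        ((Real.hasDerivAt_log (by linarith [ht.1] : t ≠ 0)).const_mul _)).neg)
    (fun t ht => by
      have htσ : t ∈ Ico 1 σ := ⟨ht.1.le, ht.2.trans hz⟩
      have hu0 : 0 < u t := hb.trans_le (hub t htσ)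
      have ht0 : 0 < t := by linarith [ht.1]
      have h1 := (hmain t htσ t ⟨ht.1.le, le_rfl⟩).2
      have h2 : u t ^ (1 - q - 1) * u t ^ q = 1 := by
        rw [← Real.rpow_add hu0]; simp
      have h3 : 0 < u t ^ (1 - q - 1) := by positivity
      have h4 : -(w t * (1 - q) * u t ^ (1 - q - 1) + (q - 1) * ε * t⁻¹) =
          (q - 1) * u t ^ (1 - q - 1) / t * (t * w t - ε * u t ^ q) := by
        field_simp
        linear_combination ((q - 1) * ε) * h2
      rw [h4]
      have h5 : 0 < q - 1 := by linarith
      positivity)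
  simp only [hu1, Real.log_one, mul_zero, add_zero] at hlog
  have hz0 : 0 < z := by linarith
  rw [← Real.log_lt_iff_lt_exp hz0, lt_div_iff₀ (mul_pos (by linarith) hε0)]
  have : 0 < u z ^ (1 - q) := by
    have hu0 : 0 < u z := hb.trans_le (hub z ⟨h, hz⟩)
    positivity
  linarith

/-- The admissible range of exponents, expressed through `alphaP p`. -/
lemma alphaP_bounds {N : ℕ} {p : ℝ} (hNp : (N = 3 ∧ 5 < p) ∨
      (4 ≤ N ∧ 1 + 4 / ((N : ℝ) - 2) < p ∧ p < 1 + 4 / ((N : ℝ) - 3))) :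
    1 < p ∧ 0 < alphaP p ∧ 2 * alphaP p + 2 < N ∧ (N : ℝ) < 2 * alphaP p + 3 := by
  rcases hNp with ⟨rfl, hp⟩ | ⟨hN, h1, h2⟩
  · have hp0 : 0 < p - 1 := by linarith
    have hα0 : 0 < alphaP p := div_pos two_pos hp0
    have h : alphaP p < 1 / 2 := by
      rw [alphaP, div_lt_div_iff₀ hp0 two_pos]; linarith
    refine ⟨by linarith, hα0, ?_, ?_⟩ <;> push_cast <;> linarith
  · have hN' : (4 : ℝ) ≤ N := by exact_mod_cast hN
    have hp0 : 0 < p - 1 := by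
      have : 0 < 4 / ((N : ℝ) - 2) := div_pos (by norm_num) (by linarith)
      linarith
    have hα0 : 0 < alphaP p := div_pos two_pos hp0
    have hα : (p - 1) * alphaP p = 2 := mul_div_cancel₀ _ hp0.ne'
    have h3 : 4 < (p - 1) * ((N : ℝ) - 2) :=
      (div_lt_iff₀ (by linarith)).1 (by linarith)
    have h4 : (p - 1) * ((N : ℝ) - 3) < 4 :=
      (lt_div_iff₀ (by linarith)).1 (by linarith)
    refine ⟨by linarith, hα0, ?_, ?_⟩
    · exact lt_of_mul_lt_mul_left (by linarith : (p - 1) * (2 * alphaP p + 2) < (p - 1) * N) hp0.le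
    · exact lt_of_mul_lt_mul_left (by linarith : (p - 1) * N < (p - 1) * (2 * alphaP p + 3)) hp0.le

lemma b0_pos {p : ℝ} (hp : 1 < p) : 0 < b0 p := by
  have : 0 < p - 1 := by linarith
  unfold b0
  positivity

lemma b0_rpow {p : ℝ} (hp : 1 < p) : b0 p ^ (p - 1) = alphaP p * (alphaP p + 1) := by
  have hp0 : 0 < p - 1 := by linarith
  rw [b0, ← Real.rpow_mul (by positivity), one_div, inv_mul_cancel₀ hp0.ne', Real.rpow_one, alphaP]
  field_simp
  ring

theorem stmt17 (N : ℕ) (p : ℝ)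
    (hNp : (N = 3 ∧ 5 < p) ∨
      (4 ≤ N ∧ 1 + 4 / ((N : ℝ) - 2) < p ∧ p < 1 + 4 / ((N : ℝ) - 3))) :
    ∃ bstar : ℝ, 0 ≤ bstar ∧ bstar < bInf N p ∧ (N = 3 → bstar = 0) ∧
      ∀ b : ℝ, 0 < b →
        -- (i) if `b > b₀`: every solution with `U(1) = b` blows up in finite
        -- time and stays above `b₀` to the right of `1`
        ((b0 p < b →
          (∃ T : ℝ, ∀ (τ σ : ℝ) (U : ℝ → ℝ), τ < 1 → 1 < σ →
            ContDiffOn ℝ 2 U (Ioo τ σ) → IsSolOn N p U (Ioo τ σ) →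
            U 1 = b → σ ≤ T) ∧
          (∀ (τ σ : ℝ) (U : ℝ → ℝ), τ < 1 → 1 < σ →
            ContDiffOn ℝ 2 U (Ioo τ σ) → IsSolOn N p U (Ioo τ σ) →
            U 1 = b → ∀ x ∈ Ioo (1 : ℝ) σ, b0 p < U x)) ∧
        -- (ii) if `b_* < b < b₀`: the solution with `U(1) = b` is global
        (bstar < b → b < b0 p →
          ∃ U : ℝ → ℝ,
            ContDiffOn ℝ 2 U (Ioi 0) ∧ IsSolOn N p U (Ioi 0) ∧ U 1 = b ∧
            (∀ x : ℝ, 1 < x → 0 < U x ∧ U x < b0 p ∧ deriv U x < 0) ∧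
            ∃ L > 0,
              Tendsto (fun x => x ^ alphaP p * U x) atTop (nhds L) ∧
              Tendsto (fun x => x ^ (alphaP p + 1) * deriv U x) atTop
                (nhds (-(alphaP p) * L)) ∧
              (bInf N p < b → b < L) ∧ (b < bInf N p → L < b))) := by
  obtain ⟨hp1, hα0, hγ0, hγ1⟩ := alphaP_bounds hNp
  have hp0 : 0 < p - 1 := by linarith
  have hpα : (p - 1) * alphaP p = 2 := mul_div_cancel₀ _ hp0.ne'
  have hb0 := b0_pos hp1
  have hb0' := b0_rpow hp1
  set α := alphaP p with hα
  set γ := (N : ℝ) - 2 - 2 * α with hγ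
  set β := α * (γ + α) with hβ
  have hβ0 : 0 < β := mul_pos hα0 (by linarith)
  have hc : bInf N p = β ^ (α / 2) := by
    rw [bInf, ← hα, hβ, hγ]; congr 2; ring
  have hc0 : 0 < bInf N p := by rw [hc]; positivity
  have hcβ : bInf N p ^ (p - 1) = β := by
    rw [hc, ← Real.rpow_mul hβ0.le, show α / 2 * (p - 1) = 1 by linarith, Real.rpow_one]
  set K := 2 * ((p - 1) * β) / (1 - γ) + 1 with hK
  have hK0 : 0 < K := by
    have : 0 < 1 - γ := by linarith
    positivity
  have hE : 0 < Real.exp (-(4 * K)) := Real.exp_pos _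
  have hE1 : Real.exp (-(4 * K)) < 1 := Real.exp_lt_one_iff.2 (by linarith)
  refine ⟨if N = 3 then 0 else bInf N p * (1 - Real.exp (-(4 * K))), ?_, ?_, fun h => if_pos h,
    fun b hb => ⟨fun hbb => ?_, fun hbs hbb => ?_⟩⟩
  · split_ifs
    · exact le_rfl
    · exact mul_nonneg hc0.le (by linarith)
  · split_ifs
    · exact hc0
    · exact mul_lt_of_lt_one_right hc0 (by linarith)
  · have hbp : α * (α + 1) < b ^ (p - 1) := by
      rw [← hb0']; exact Real.rpow_lt_rpow hb0.le hbb hp0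
    obtain ⟨T, hT⟩ := blowup (n := N) hp1 hα0 (by linarith) hγ1 hγ0 hb hbp
    have key : ∀ (τ σ : ℝ) (U : ℝ → ℝ), τ < 1 → 1 < σ →
            ContDiffOn ℝ 2 U (Ioo τ σ) → IsSolOn N p U (Ioo τ σ) →
            U 1 = b → σ ≤ T ∧ ∀ x ∈ Ico 1 σ, b ≤ U x := by
      intro τ σ U hτ hσ hU hsol hU1
      have hmem : ∀ x ∈ Ico 1 σ, x ∈ Ioo τ σ := fun x hx => ⟨hτ.trans_le hx.1, hx.2⟩
      have hU' : ContDiffOn ℝ 1 (deriv U) (Ioo τ σ) :=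
        ((contDiffOn_succ_iff_deriv_of_isOpen (n := 1) isOpen_Ioo).1
          (by simpa [one_add_one_eq_two] using hU)).2.2
      refine hT σ U (deriv U) (deriv (deriv U)) hσ (fun x hx => ?_) (fun x hx => ?_)
        (fun x hx => hsol x (hmem x hx)) hU1
      · exact ((hU.differentiableOn (by norm_num)).differentiableAt
          (isOpen_Ioo.mem_nhds (hmem x hx))).hasDerivAt
      · exact ((hU'.differentiableOn (by norm_num)).differentiableAt
          (isOpen_Ioo.mem_nhds (hmem x hx))).hasDerivAt
    exact ⟨⟨T, fun τ σ U h1 h2 h3 h4 h5 => (key τ σ U h1 h2 h3 h4 h5).1⟩,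
      fun τ σ U h1 h2 h3 h4 h5 x hx =>
        hbb.trans_le ((key τ σ U h1 h2 h3 h4 h5).2 x ⟨hx.1.le, hx.2⟩)⟩
  · have hbp : b ^ (p - 1) < α * (α + 1) := by
      rw [← hb0']; exact Real.rpow_lt_rpow hb.le hbb hp0
    have hcase : b < bInf N p → γ = 1 - 2 * α ∨ (bInf N p - b) * Real.exp (4 * K) < bInf N p := by
      intro _
      split_ifs at hbs with h
      · left; rw [hγ, h]; push_cast; ring
      · right
        rw [← lt_div_iff₀ (Real.exp_pos _), div_eq_mul_inv, ← Real.exp_neg]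
        linarith
    obtain ⟨B, v, y, D, H, hB, F⟩ := exists_global_profile (by linarith) (by linarith) hα0 hβ hpα
      hp1 hb hc0 hcβ hbp hK hcase
    have hU' : ∀ x : ℝ, 0 < x → deriv (fun x => x ^ (-α) * v (x ^ 2)) x =
        x ^ (-α - 1) * (y (x ^ 2) - α * v (x ^ 2)) := fun x hx => (H.hasDerivAt_sol α hx).deriv
    obtain ⟨L, hL, hv, hy, hL1, hL2⟩ := F.lim
    obtain ⟨hT1, hT2⟩ := tendsto_sol (fun x _ => rfl) hU' hv hy
    refine ⟨fun x => x ^ (-α) * v (x ^ 2), H.contDiffOn_sol α, H.isSolOn_sol hβ hγ hp1 hB, ?_,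
      fun x hx => ?_, L, hL, hT1, hT2, hL1, hL2⟩
    · have := H.v_one
      simp [this]
    · have hx0 : 0 < x := by linarith
      have hx2 : 1 ≤ x ^ 2 := one_le_pow₀ hx.le
      refine ⟨?_, ?_, ?_⟩
      · have := F.pos _ hx2
        positivity
      · refine lt_of_le_of_lt ?_ hbb
        have h1 := mul_le_mul_of_nonneg_left (F.le _ hx2) (Real.rpow_nonneg hx0.le (-α))
        have h2 : (x ^ 2) ^ (α / 2) = x ^ α := by
          rw [← Real.rpow_natCast, ← Real.rpow_mul hx0.le]; congr 1; push_cast; ring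
        have h3 : x ^ (-α) * x ^ α = 1 := by
          rw [← Real.rpow_add hx0]; simp
        rw [h2] at h1
        linear_combination h1 + b * h3
      · rw [hU' x hx0]
        exact mul_neg_of_pos_of_neg (by positivity) (by linarith [F.y_lt _ hx2])
end
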